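/- Let Ω₀ and Ω₁ be smoothly bounded pseudoconvex domains in ℂ^n with Ω₀ compactly included in Ω₁. Assume there is a smooth plurisubharmonic function ρ on the closure of Ω₁ such that Ω₀ = {z ∈ Ω₁ : ρ(z) < 0}. Then holomorphic functions in L²(Ω₁) are dense in the space of holomorphic functions in L²(Ω₀). -/

import Mathlib

open MeasureTheory Filter Set Metric Complex
open scoped ENNReal NNReal Topology

noncomputable section

namespace Berndtsson

instance (n : ℕ) : MeasurableSpace (EuclideanSpace ℂ (Fin n)) := borel _
instance (n : ℕ) : BorelSpace (EuclideanSpace ℂ (Fin n)) := ⟨rfl⟩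
instance (n : ℕ) : MeasureSpace (EuclideanSpace ℂ (Fin n)) :=
  ⟨Measure.map (EuclideanSpace.equiv (Fin n) ℂ).symm volume⟩

abbrev Cn (n : ℕ) := EuclideanSpace ℂ (Fin n)

/-- A function `f`, with values in `EReal`, is plurisubharmonic on `s` if it is upper
semicontinuous on `s` and satisfies the sub-mean value inequality on every complex circle
whose corresponding closed disk is contained in `s` (formulated via continuous majorants,
which for upper semicontinuous integrands is equivalent to the upper-integral form). -/
def PlurisubharmonicOn {E : Type*} [NormedAddCommGroup E] [NormedSpace ℂ E]
    (f : E → EReal) (s : Set E) : Prop :=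
  UpperSemicontinuousOn f s ∧
    ∀ z ∈ s, ∀ w : E, ∀ r : ℝ, 0 < r →
      (∀ l : ℂ, ‖l‖ ≤ r → z + l • w ∈ s) →
      ∀ h : ℝ → ℝ, Continuous h →
        (∀ θ : ℝ, f (z + ((r : ℂ) * Complex.exp (θ * Complex.I)) • w) ≤ (h θ : EReal)) →
        f z ≤ (((2 * Real.pi)⁻¹ * ∫ θ in (0:ℝ)..(2 * Real.pi), h θ : ℝ) : EReal)

/-- Plurisubharmonicity for real-valued functions. -/
def PshOn {E : Type*} [NormedAddCommGroup E] [NormedSpace ℂ E] (f : E → ℝ) (s : Set E) : Prop :=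
  PlurisubharmonicOn (fun z => (f z : EReal)) s

/-- A pseudoconvex domain: an open set admitting a plurisubharmonic exhaustion function. -/
def Pseudoconvex {E : Type*} [NormedAddCommGroup E] [NormedSpace ℂ E] (D : Set E) : Prop :=
  IsOpen D ∧ ∃ u : E → ℝ, PshOn u D ∧ ∀ c : ℝ, IsCompact {z ∈ D | u z ≤ c}

/-- `log` with values in `EReal`, sending nonpositive reals to `⊥`. -/
def elog (x : ℝ) : EReal := if 0 < x then ((Real.log x : ℝ) : EReal) else ⊥

/-- Membership in the weighted Bergman space `A²(Ω, e^{-φ})`. -/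
def MemA2 {n : ℕ} (Ω : Set (Cn n)) (φ : Cn n → ℝ) (h : Cn n → ℂ) : Prop :=
  DifferentiableOn ℂ h Ω ∧
    IntegrableOn (fun ζ => ‖h ζ‖ ^ 2 * Real.exp (-φ ζ)) Ω volume

/-- `Kz` is the Bergman kernel of `A²(Ω, e^{-φ})` at the point `z`:
it belongs to the space and reproduces the value at `z` of every member. -/
def IsBergmanKernelAt {n : ℕ} (Ω : Set (Cn n)) (φ : Cn n → ℝ) (z : Cn n)
    (Kz : Cn n → ℂ) : Prop :=
  MemA2 Ω φ Kz ∧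
    ∀ h : Cn n → ℂ, MemA2 Ω φ h →
      ∫ ζ in Ω, h ζ * (starRingEnd ℂ) (Kz ζ) * (Real.exp (-φ ζ) : ℂ) = h z

/-- The Bergman kernel on the diagonal, via its extremal characterization
`K(z,z) = sup {|h(z)|² : h holomorphic on Ω, ∫_Ω |h|² e^{-φ} ≤ 1}`. -/
def bergmanDiag {n : ℕ} (Ω : Set (Cn n)) (φ : Cn n → ℝ) (z : Cn n) : ℝ :=
  sSup {v : ℝ | ∃ h : Cn n → ℂ, DifferentiableOn ℂ h Ω ∧
    IntegrableOn (fun ζ => ‖h ζ‖ ^ 2 * Real.exp (-φ ζ)) Ω volume ∧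
    (∫ ζ in Ω, ‖h ζ‖ ^ 2 * Real.exp (-φ ζ)) ≤ 1 ∧ v = ‖h z‖ ^ 2}

end Berndtsson

namespace Berndtsson

/-- A smoothly bounded pseudoconvex domain: a bounded domain with smooth boundary admitting a
plurisubharmonic defining function. -/
def SmoothlyBoundedPseudoconvex (n : ℕ) (Ω : Set (Cn n)) : Prop :=
  IsOpen Ω ∧ Bornology.IsBounded Ω ∧
    ∃ (r : Cn n → ℝ) (W : Set (Cn n)), IsOpen W ∧ closure Ω ⊆ W ∧
      ContDiffOn ℝ (⊤ : ℕ∞) r W ∧ PshOn r W ∧ Ω = {z ∈ W | r z < 0} ∧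
      ∀ z ∈ frontier Ω, fderiv ℝ r z ≠ 0

section

open scoped ContDiff ComplexConjugate

variable {n : ℕ}

/-- The `j`-th standard basis vector. -/
def stdVec (j : Fin n) : Cn n := EuclideanSpace.single j 1

/-- The first-order operator `½ (∂/∂xⱼ + s ∂/∂yⱼ)`. -/
def wirt (s : ℂ) (j : Fin n) (f : Cn n → ℂ) (z : Cn n) : ℂ :=
  (1 / 2) * (fderiv ℝ f z (stdVec j) + s * fderiv ℝ f z (I • stdVec j))

local notation "del" => wirt (-Complex.I)
local notation "dbar" => wirt Complex.I

lemma wirt_add {s : ℂ} {j : Fin n} {f g : Cn n → ℂ} {z : Cn n} (hf : DifferentiableAt ℝ f z)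
    (hg : DifferentiableAt ℝ g z) :
    wirt s j (fun x => f x + g x) z = wirt s j f z + wirt s j g z := by
  simp only [wirt, fderiv_fun_add hf hg, add_apply]
  ring

lemma wirt_sub {s : ℂ} {j : Fin n} {f g : Cn n → ℂ} {z : Cn n} (hf : DifferentiableAt ℝ f z)
    (hg : DifferentiableAt ℝ g z) :
    wirt s j (fun x => f x - g x) z = wirt s j f z - wirt s j g z := by
  simp only [wirt, fderiv_fun_sub hf hg, sub_apply]
  ring

lemma wirt_mul {s : ℂ} {j : Fin n} {f g : Cn n → ℂ} {z : Cn n} (hf : DifferentiableAt ℝ f z)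
    (hg : DifferentiableAt ℝ g z) :
    wirt s j (fun x => f x * g x) z = wirt s j f z * g z + f z * wirt s j g z := by
  simp only [wirt, fderiv_fun_mul hf hg, add_apply, smul_apply, smul_eq_mul]
  ring

@[simp] lemma wirt_const {s : ℂ} {j : Fin n} {c : ℂ} {z : Cn n} :
    wirt s j (fun _ => c) z = 0 := by
  simp [wirt]

lemma wirt_const_mul {s : ℂ} {j : Fin n} {f : Cn n → ℂ} {z : Cn n} (c : ℂ)
    (hf : DifferentiableAt ℝ f z) :
    wirt s j (fun x => c * f x) z = c * wirt s j f z := by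
  rw [wirt_mul (by fun_prop) hf, wirt_const]; ring

lemma wirt_conj {s : ℂ} {j : Fin n} {f : Cn n → ℂ} {z : Cn n} :
    wirt s j (fun x => conj (f x)) z = conj (wirt (conj s) j f z) := by
  have h : fderiv ℝ (fun x => conj (f x)) z
      = (conjCLE : ℂ →L[ℝ] ℂ).comp (fderiv ℝ f z) := conjCLE.comp_fderiv
  simp [wirt, h, map_ofNat]

lemma del_conj {j : Fin n} {f : Cn n → ℂ} {z : Cn n} :
    del j (fun x => conj (f x)) z = conj (dbar j f z) := by
  simp [wirt_conj]

lemma dbar_conj {j : Fin n} {f : Cn n → ℂ} {z : Cn n} :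
    dbar j (fun x => conj (f x)) z = conj (del j f z) := by
  simp [wirt_conj]

lemma conj_del_ofReal {j : Fin n} {f : Cn n → ℝ} {z : Cn n} :
    conj (del j (fun x => (f x : ℂ)) z) = dbar j (fun x => (f x : ℂ)) z := by
  rw [← dbar_conj]; simp

lemma wirt_congr {s : ℂ} {j : Fin n} {f g : Cn n → ℂ} {z : Cn n} (h : f =ᶠ[𝓝 z] g) :
    wirt s j f z = wirt s j g z := by
  simp only [wirt, h.fderiv_eq]

lemma wirt_eventuallyEq {s : ℂ} {j : Fin n} {f g : Cn n → ℂ} {z : Cn n} (h : f =ᶠ[𝓝 z] g) :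
    wirt s j f =ᶠ[𝓝 z] wirt s j g := by
  filter_upwards [h.eventuallyEq_nhds] with x hx using wirt_congr hx

/-- Chain rule for a real function of a real function. -/
lemma wirt_comp_ofReal {s : ℂ} {j : Fin n} {T : ℝ → ℝ} {f : Cn n → ℝ} {z : Cn n} {T' : ℝ}
    (hT : HasDerivAt T T' (f z)) (hf : DifferentiableAt ℝ f z) :
    wirt s j (fun x => (T (f x) : ℂ)) z = T' * wirt s j (fun x => (f x : ℂ)) z := by
  have h1 : HasFDerivAt (fun x => (f x : ℂ)) (ofRealCLM.comp (fderiv ℝ f z)) z :=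
    ofRealCLM.hasFDerivAt.comp z hf.hasFDerivAt
  have h2 : HasFDerivAt (fun x => (T (f x) : ℂ)) (ofRealCLM.comp (T' • fderiv ℝ f z)) z :=
    ofRealCLM.hasFDerivAt.comp z (hT.comp_hasFDerivAt z hf.hasFDerivAt)
  simp only [wirt, h1.fderiv, h2.fderiv]
  simp
  ring

lemma contDiffAt_wirt {s : ℂ} {j : Fin n} {f : Cn n → ℂ} {z : Cn n} (hf : ContDiffAt ℝ ∞ f z) :
    ContDiffAt ℝ ∞ (wirt s j f) z := by
  have h : ContDiffAt ℝ ∞ (fderiv ℝ f) z := hf.fderiv_right (by simp)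
  unfold wirt
  exact contDiffAt_const.mul ((h.clm_apply contDiffAt_const).add
    (contDiffAt_const.mul (h.clm_apply contDiffAt_const)))

lemma fderiv_wirt {t : ℂ} {k : Fin n} {f : Cn n → ℂ} {z : Cn n} (hf : ContDiffAt ℝ ∞ f z)
    (a : Cn n) :
    fderiv ℝ (wirt t k f) z a = (1 / 2) * (fderiv ℝ (fderiv ℝ f) z a (stdVec k)
      + t * fderiv ℝ (fderiv ℝ f) z a (I • stdVec k)) := by
  have h : DifferentiableAt ℝ (fderiv ℝ f) z :=
    (hf.fderiv_right (m := ∞) (by simp)).differentiableAt (by simp)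
  have h1 : ∀ b : Cn n, HasFDerivAt (fun x => fderiv ℝ f x b)
      ((fderiv ℝ (fderiv ℝ f) z).flip b) z := fun b => by
    simpa using h.hasFDerivAt.clm_apply (hasFDerivAt_const b z)
  have h2 : HasFDerivAt (wirt t k f) _ z :=
    ((h1 (stdVec k)).add ((h1 (I • stdVec k)).const_mul t)).const_mul (1 / 2 : ℂ)
  rw [h2.fderiv]
  simp
  ring

lemma wirt_comm {s t : ℂ} {j k : Fin n} {f : Cn n → ℂ} {z : Cn n} (hf : ContDiffAt ℝ ∞ f z) :
    wirt s j (wirt t k f) z = wirt t k (wirt s j f) z := by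
  have hs : IsSymmSndFDerivAt ℝ f z := hf.isSymmSndFDerivAt (by simpa using ENat.LEInfty.out)
  change (1 / 2) * (fderiv ℝ (wirt t k f) z (stdVec j)
    + s * fderiv ℝ (wirt t k f) z (I • stdVec j)) = (1 / 2) * (fderiv ℝ (wirt s j f) z (stdVec k)
    + t * fderiv ℝ (wirt s j f) z (I • stdVec k))
  rw [fderiv_wirt hf, fderiv_wirt hf, fderiv_wirt hf, fderiv_wirt hf, hs.eq (stdVec j) (stdVec k),
    hs.eq (stdVec j) (I • stdVec k), hs.eq (I • stdVec j) (stdVec k),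
    hs.eq (I • stdVec j) (I • stdVec k)]
  ring

/-- Smooth functions with compact support contained in `U`. -/
structure TestFun (U : Set (Cn n)) (f : Cn n → ℂ) : Prop where
  smooth : ContDiff ℝ ∞ f
  compact : HasCompactSupport f
  subset : tsupport f ⊆ U

namespace TestFun

variable {U : Set (Cn n)} {f g : Cn n → ℂ}

lemma differentiable (hf : TestFun U f) : Differentiable ℝ f := hf.smooth.differentiable (by simp)

lemma add (hf : TestFun U f) (hg : TestFun U g) : TestFun U (fun z => f z + g z) :=
  ⟨hf.smooth.add hg.smooth, hf.compact.add hg.compact,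
    (tsupport_add f g).trans (union_subset hf.subset hg.subset)⟩

lemma zero : TestFun U (fun _ => 0) :=
  ⟨contDiff_const, HasCompactSupport.zero, by
    have : tsupport (fun _ : Cn n => (0 : ℂ)) = ∅ := tsupport_eq_empty_iff.2 rfl
    simp [this]⟩

lemma sum {ι : Type*} (t : Finset ι) {f : ι → Cn n → ℂ} (hf : ∀ i ∈ t, TestFun U (f i)) :
    TestFun U (fun z => ∑ i ∈ t, f i z) := by
  classical
  induction t using Finset.induction_on with
  | empty => simpa using zero
  | insert a s ha ih =>
    simp only [Finset.sum_insert ha]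
    exact (hf a (by simp)).add (ih fun i hi => hf i (by simp [hi]))

lemma mul_left (hf : TestFun U f) (hg : ∀ z ∈ U, ContDiffAt ℝ ∞ g z) :
    TestFun U (fun z => g z * f z) := by
  have hsub : tsupport (fun z => g z * f z) ⊆ tsupport f := tsupport_mul_subset_right
  refine ⟨contDiff_iff_contDiffAt.2 fun z => ?_, hf.compact.mul_left, hsub.trans hf.subset⟩
  by_cases hz : z ∈ tsupport f
  · exact (hg z (hf.subset hz)).mul hf.smooth.contDiffAt
  · have h0 : f =ᶠ[𝓝 z] fun _ => 0 := notMem_tsupport_iff_eventuallyEq.1 hz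
    refine (contDiffAt_const (c := (0 : ℂ))).congr_of_eventuallyEq ?_
    filter_upwards [h0] with x hx
    simp [hx]

lemma mul_right (hf : TestFun U f) (hg : ∀ z ∈ U, ContDiffAt ℝ ∞ g z) :
    TestFun U (fun z => f z * g z) := by
  simpa only [mul_comm] using hf.mul_left hg

lemma mul (hf : TestFun U f) (hg : TestFun U g) : TestFun U (fun z => f z * g z) :=
  hf.mul_right fun _ _ => hg.smooth.contDiffAt

lemma const_mul (hf : TestFun U f) (c : ℂ) : TestFun U (fun z => c * f z) :=
  hf.mul_left fun _ _ => contDiffAt_const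

lemma sub (hf : TestFun U f) (hg : TestFun U g) : TestFun U (fun z => f z - g z) := by
  simpa [sub_eq_add_neg] using hf.add (hg.const_mul (-1))

lemma conjugate (hf : TestFun U f) : TestFun U (fun z => conj (f z)) := by
  refine ⟨conjCLE.contDiff.comp hf.smooth, hf.compact.comp_left (g := starRingEnd ℂ) (by simp), ?_⟩
  exact (closure_mono (Function.support_comp_subset (g := starRingEnd ℂ) (by simp) f)).trans hf.subset

lemma wirt (hf : TestFun U f) (s : ℂ) (j : Fin n) : TestFun U (wirt s j f) := by
  have hsub : tsupport (Berndtsson.wirt s j f) ⊆ tsupport f := by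
    refine closure_minimal (fun z hz => ?_) (isClosed_tsupport f)
    by_contra h
    apply hz
    have : f =ᶠ[𝓝 z] fun _ => 0 := notMem_tsupport_iff_eventuallyEq.1 h
    simp [wirt_congr this]
  refine ⟨contDiff_iff_contDiffAt.2 fun z => contDiffAt_wirt hf.smooth.contDiffAt, ?_, hsub.trans hf.subset⟩
  exact hf.compact.of_isClosed_subset (isClosed_tsupport _) hsub

lemma continuous (hf : TestFun U f) : Continuous f := hf.smooth.continuous

lemma mono {V : Set (Cn n)} (hf : TestFun U f) (h : U ⊆ V) : TestFun V f :=
  ⟨hf.smooth, hf.compact, hf.subset.trans h⟩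

end TestFun

instance : (volume : Measure (Cn n)).IsAddHaarMeasure := by
  change (Measure.map (EuclideanSpace.equiv (Fin n) ℂ).symm volume).IsAddHaarMeasure
  exact ((EuclideanSpace.equiv (Fin n) ℂ).symm).isAddHaarMeasure_map volume

namespace TestFun

variable {U : Set (Cn n)} {f g : Cn n → ℂ}

lemma integrable (hf : TestFun U f) : Integrable f :=
  hf.continuous.integrable_of_hasCompactSupport hf.compact

lemma integral_fderiv (hf : TestFun U f) (v : Cn n) : ∫ z, fderiv ℝ f z v = 0 := by
  have h1 : Integrable (fun z => fderiv ℝ f z v) := by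
    refine Continuous.integrable_of_hasCompactSupport ?_ (hf.compact.fderiv_apply ℝ v)
    exact (hf.smooth.continuous_fderiv (by simp)).clm_apply continuous_const
  have := integral_mul_fderiv_eq_neg_fderiv_mul_of_integrable (μ := volume) (f := fun _ : Cn n => (1 : ℂ))
    (g := f) (v := v) (by simp) (by simpa using h1) (by simpa using hf.integrable)
    (by simp) (fun z _ => hf.differentiable z)
  simpa using this

lemma integral_wirt (hf : TestFun U f) (s : ℂ) (j : Fin n) :
    ∫ z, Berndtsson.wirt s j f z = 0 := by
  have h1 : ∀ v, Integrable (fun z => fderiv ℝ f z v) := fun v => by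
    refine Continuous.integrable_of_hasCompactSupport ?_ (hf.compact.fderiv_apply ℝ v)
    exact (hf.smooth.continuous_fderiv (by simp)).clm_apply continuous_const
  simp only [Berndtsson.wirt]
  rw [integral_const_mul, integral_add (h1 _) ((h1 _).const_mul s), integral_const_mul,
    hf.integral_fderiv, hf.integral_fderiv]
  simp

/-- Integration by parts for Wirtinger derivatives. -/
lemma integral_mul_wirt (hf : TestFun U f) (hg : ∀ z ∈ U, ContDiffAt ℝ ∞ g z) (s : ℂ) (j : Fin n) :
    ∫ z, g z * Berndtsson.wirt s j f z = -∫ z, Berndtsson.wirt s j g z * f z := by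
  have h1 := (hf.mul_left hg).integral_wirt s j
  have h2 : ∀ z, Berndtsson.wirt s j (fun z => g z * f z) z
      = Berndtsson.wirt s j g z * f z + g z * Berndtsson.wirt s j f z := by
    intro z
    by_cases hz : z ∈ tsupport f
    · exact wirt_mul ((hg z (hf.subset hz)).differentiableAt (by simp)) (hf.differentiable z)
    · have h0 : f =ᶠ[𝓝 z] fun _ => 0 := notMem_tsupport_iff_eventuallyEq.1 hz
      have h3 : (fun z => g z * f z) =ᶠ[𝓝 z] fun _ => 0 := by
        filter_upwards [h0] with x hx
        simp [hx]
      simp [wirt_congr h0, wirt_congr h3, h0.self_of_nhds]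
  simp only [h2] at h1
  rw [integral_add (hf.mul_left fun z hz => contDiffAt_wirt (hg z hz)).integrable
    ((hf.wirt s j).mul_left hg).integrable] at h1
  linear_combination h1

end TestFun

lemma bochner_pair {U : Set (Cn n)} {f g W P Q : Cn n → ℂ} {j k : Fin n} (hf : TestFun U f)
    (hg : TestFun U g) (hW : ∀ z ∈ U, ContDiffAt ℝ ∞ W z) (hP : ∀ z ∈ U, ContDiffAt ℝ ∞ P z)
    (hQ : ∀ z ∈ U, ContDiffAt ℝ ∞ Q z)
    (hWP : ∀ z ∈ U, del j W z = -P z * W z) (hWQ : ∀ z ∈ U, dbar k W z = -Q z * W z) :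
    ∫ z, (del j f z - P z * f z) * (dbar k g z - Q z * g z) * W z
      = (∫ z, dbar k P z * f z * g z * W z) + ∫ z, dbar k f z * del j g z * W z := by
  have hA : TestFun U fun z => del j f z - P z * f z := (hf.wirt _ j).sub (hf.mul_left hP)
  have hB : TestFun U fun z => dbar k g z - Q z * g z := (hg.wirt _ k).sub (hg.mul_left hQ)
  have h1 := ((hA.mul hg).mul_right hW).integral_wirt I k
  have h2 := (((hf.wirt I k).mul hg).mul_right hW).integral_wirt (-I) j
  have i0 := ((hA.mul hB).mul_right hW).integrable
  have i1 := (((hf.mul_left fun z hz => contDiffAt_wirt (s := I) (j := k) (hP z hz)).mul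
    hg).mul_right hW).integrable
  have i2 := (((hf.wirt I k).mul (hg.wirt (-I) j)).mul_right hW).integrable
  rw [← integral_add i1 i2, ← sub_eq_zero, ← integral_sub i0 (i1.fun_add i2)]
  have h3 := congrArg₂ (· - ·) h1 h2
  simp only [sub_zero] at h3
  rw [← integral_sub (((hA.mul hg).mul_right hW).wirt I k).integrable
    ((((hf.wirt I k).mul hg).mul_right hW).wirt (-I) j).integrable] at h3
  rw [← h3]
  congr 1 with z
  by_cases hz : z ∈ U
  · have dW := (hW z hz).differentiableAt (by simp)
    have dP := (hP z hz).differentiableAt (by simp)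
    have d1 := (hf.wirt (-I) j).differentiable z
    have d2 := hf.differentiable z
    have d3 := (hf.wirt I k).differentiable z
    rw [wirt_mul ((hA.mul hg).differentiable z) dW,
      wirt_mul (hA.differentiable z) (hg.differentiable z), wirt_sub d1 (dP.fun_mul d2),
      wirt_mul dP d2, wirt_mul ((d3.fun_mul (hg.differentiable z))) dW,
      wirt_mul d3 (hg.differentiable z), hWP z hz, hWQ z hz,
      wirt_comm (s := I) (t := -I) hf.smooth.contDiffAt]
    ring
  · have n1 := image_eq_zero_of_notMem_tsupport (fun h => hz (hf.subset h))
    have n2 := image_eq_zero_of_notMem_tsupport (fun h => hz ((hA.mul hB).subset h))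
    have n3 := image_eq_zero_of_notMem_tsupport (fun h => hz ((hf.wirt I k).subset h))
    have n4 := image_eq_zero_of_notMem_tsupport
      (fun h => hz ((((hA.mul hg).mul_right hW).wirt I k).subset h))
    have n5 := image_eq_zero_of_notMem_tsupport
      (fun h => hz (((((hf.wirt I k).mul hg).mul_right hW).wirt (-I) j).subset h))
    rw [n4, n5, n2, n1, n3]
    ring

/-- The divergence-type operator adjoint to `∂̄` in the weighted space. -/
def wdiv (P : Fin n → Cn n → ℂ) (v : Cn n → ℂ) (z : Cn n) : ℂ :=
  ∑ j, (del j (dbar j v) z - P j z * dbar j v z)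

lemma wdiv_testFun {U : Set (Cn n)} {v : Cn n → ℂ} {P : Fin n → Cn n → ℂ} (hv : TestFun U v)
    (hP : ∀ j, ∀ z ∈ U, ContDiffAt ℝ ∞ (P j) z) : TestFun U (wdiv P v) :=
  TestFun.sum _ fun j _ => ((hv.wirt _ j).wirt _ j).sub ((hv.wirt _ j).mul_left (hP j))

/-- Hörmander's inequality for `∂̄`-exact forms. -/
lemma hormander_ineq {U : Set (Cn n)} {v : Cn n → ℂ} {P : Fin n → Cn n → ℂ} {w : Cn n → ℝ}
    (hv : TestFun U v) (hw : ∀ z ∈ U, ContDiffAt ℝ ∞ w z) (hw0 : ∀ z ∈ U, 0 ≤ w z)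
    (hP : ∀ j, ∀ z ∈ U, ContDiffAt ℝ ∞ (P j) z)
    (hwP : ∀ j, ∀ z ∈ U, del j (fun x => (w x : ℂ)) z = -P j z * w z) :
    ∫ z, (∑ j, ∑ k, dbar k (P j) z * dbar j v z * conj (dbar k v z)).re * w z
      ≤ ∫ z, ‖wdiv P v z‖ ^ 2 * w z := by
  have hwC : ∀ z ∈ U, ContDiffAt ℝ ∞ (fun x => (w x : ℂ)) z := fun z hz =>
    ofRealCLM.contDiff.contDiffAt.comp z (hw z hz)
  have hPc : ∀ j, ∀ z ∈ U, ContDiffAt ℝ ∞ (fun x => conj (P j x)) z := fun j z hz =>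
    conjCLE.contDiff.contDiffAt.comp z (hP j z hz)
  have hf : ∀ j, TestFun U (dbar j v) := fun j => hv.wirt I j
  have hwQ : ∀ k, ∀ z ∈ U, dbar k (fun x => (w x : ℂ)) z = -conj (P k z) * w z := by
    intro k z hz
    rw [← conj_del_ofReal, hwP k z hz]
    simp
  have hpair := fun j k => bochner_pair (hf j) (hf k).conjugate hwC (hP j) (hPc k) (hwP j) (hwQ k)
  have iL : ∀ j k, Integrable fun z => (del j (dbar j v) z - P j z * dbar j v z) *
      (dbar k (fun x => conj (dbar k v x)) z - conj (P k z) * conj (dbar k v z)) * (w z : ℂ) :=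
    fun j k => (((((hf j).wirt _ j).sub ((hf j).mul_left (hP j))).mul
      ((((hf k).conjugate).wirt _ k).sub ((hf k).conjugate.mul_left (hPc k)))).mul_right
        hwC).integrable
  have i1 : ∀ j k, Integrable fun z =>
      dbar k (P j) z * dbar j v z * conj (dbar k v z) * (w z : ℂ) := fun j k =>
    ((((hf j).mul_left fun z hz => contDiffAt_wirt (s := I) (j := k) (hP j z hz)).mul
      (hf k).conjugate).mul_right hwC).integrable
  have i2 : ∀ j k, Integrable fun z => dbar k (dbar j v) z *
      del j (fun x => conj (dbar k v x)) z * (w z : ℂ) := fun j k =>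
    ((((hf j).wirt I k).mul ((hf k).conjugate.wirt (-I) j)).mul_right hwC).integrable
  have hS : ∀ z, ((‖wdiv P v z‖ ^ 2 * w z : ℝ) : ℂ) = ∑ j, ∑ k,
      (del j (dbar j v) z - P j z * dbar j v z) *
      (dbar k (fun x => conj (dbar k v x)) z - conj (P k z) * conj (dbar k v z)) * (w z : ℂ) := by
    intro z
    have hconj : conj (wdiv P v z)
        = ∑ k, (dbar k (fun x => conj (dbar k v x)) z - conj (P k z) * conj (dbar k v z)) := by
      simp only [wdiv, map_sum, map_sub, map_mul, dbar_conj]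
    push_cast
    rw [← Complex.mul_conj', hconj, wdiv, Finset.sum_mul_sum]
    simp only [Finset.sum_mul]
  have h0 : ((∫ z, ‖wdiv P v z‖ ^ 2 * w z : ℝ) : ℂ)
      = (∫ z, (∑ j, ∑ k, dbar k (P j) z * dbar j v z * conj (dbar k v z)) * (w z : ℂ))
        + ∫ z, ((∑ j, ∑ k, ‖dbar k (dbar j v) z‖ ^ 2 * w z : ℝ) : ℂ) := by
    rw [← integral_complex_ofReal]
    simp only [hS]
    have e1 : ∀ z, (∑ j, ∑ k, dbar k (P j) z * dbar j v z * conj (dbar k v z)) * (w z : ℂ)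
        = ∑ j, ∑ k, dbar k (P j) z * dbar j v z * conj (dbar k v z) * (w z : ℂ) := by
      intro z; simp only [Finset.sum_mul]
    have e2 : ∀ z, ((∑ j, ∑ k, ‖dbar k (dbar j v) z‖ ^ 2 * w z : ℝ) : ℂ)
        = ∑ j, ∑ k, dbar k (dbar j v) z * del j (fun x => conj (dbar k v x)) z * (w z : ℂ) := by
      intro z
      push_cast
      refine Finset.sum_congr rfl fun j _ => Finset.sum_congr rfl fun k _ => ?_
      rw [del_conj, ← Complex.mul_conj', wirt_comm (s := I) (t := I) hv.smooth.contDiffAt]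
    simp only [e1, e2]
    rw [integral_finsetSum _ fun j _ => integrable_finsetSum _ fun k _ => iL j k,
      integral_finsetSum _ fun j _ => integrable_finsetSum _ fun k _ => i1 j k,
      integral_finsetSum _ fun j _ => integrable_finsetSum _ fun k _ => i2 j k,
      ← Finset.sum_add_distrib]
    refine Finset.sum_congr rfl fun j _ => ?_
    rw [integral_finsetSum _ fun k _ => iL j k, integral_finsetSum _ fun k _ => i1 j k,
      integral_finsetSum _ fun k _ => i2 j k, ← Finset.sum_add_distrib]
    exact Finset.sum_congr rfl fun k _ => hpair j k
  have h1 := congrArg re h0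
  rw [ofReal_re, add_re, integral_complex_ofReal, ofReal_re] at h1
  rw [h1]
  have hre : ∫ z, (∑ j, ∑ k, dbar k (P j) z * dbar j v z * conj (dbar k v z)).re * w z
      = (∫ z, (∑ j, ∑ k, dbar k (P j) z * dbar j v z * conj (dbar k v z)) * (w z : ℂ)).re := by
    have hInt : Integrable fun z =>
        (∑ j, ∑ k, dbar k (P j) z * dbar j v z * conj (dbar k v z)) * (w z : ℂ) := by
      simp only [Finset.sum_mul]
      exact integrable_finsetSum _ fun j _ => integrable_finsetSum _ fun k _ => i1 j k
    have := integral_re hInt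
    simp only [RCLike.re_to_complex] at this
    rw [← this]
    simp only [re_mul_ofReal]
  rw [hre]
  refine le_add_of_nonneg_right (integral_nonneg fun z => ?_)
  refine Finset.sum_nonneg fun j _ => Finset.sum_nonneg fun k _ => ?_
  by_cases hz : z ∈ U
  · exact mul_nonneg (by positivity) (hw0 z hz)
  · have := image_eq_zero_of_notMem_tsupport (fun h => hz (((hf j).wirt I k).subset h))
    simp [this]

/-- The Levi form of a real function. -/
def levi (f : Cn n → ℝ) (z : Cn n) (w : Fin n → ℂ) : ℝ :=
  (∑ j, ∑ k, dbar k (del j fun x => (f x : ℂ)) z * w j * conj (w k)).re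

/-- An open set `D` on which `-q` is a smooth negative plurisubharmonic exhaustion function which is
bounded and has bounded gradient. -/
structure HDomain (D : Set (Cn n)) (q : Cn n → ℝ) : Prop where
  isOpen : IsOpen D
  smooth : ∀ z ∈ D, ContDiffAt ℝ ∞ q z
  pos : ∀ z ∈ D, 0 < q z
  levi_nonpos : ∀ z ∈ D, ∀ w, levi q z w ≤ 0
  bounded : ∃ C, ∀ z ∈ D, q z ≤ C
  bounded_fderiv : ∃ C, ∀ z ∈ D, ‖fderiv ℝ q z‖ ≤ C
  compact : ∀ ε > 0, IsCompact {z ∈ D | ε ≤ q z}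

lemma ContDiffAt.ofReal' {f : Cn n → ℝ} {z : Cn n} (hf : ContDiffAt ℝ ∞ f z) :
    ContDiffAt ℝ ∞ (fun x => (f x : ℂ)) z :=
  ofRealCLM.contDiff.contDiffAt.comp z hf

/-- The weight `q ^ m * exp (-exp (c * ρ))`. -/
def wgt (q ρ : Cn n → ℝ) (c : ℝ) (m : ℕ) (z : Cn n) : ℝ :=
  q z ^ m * Real.exp (-Real.exp (c * ρ z))

/-- The negative logarithmic derivative of `wgt`. -/
def wgtP (q ρ : Cn n → ℝ) (c : ℝ) (m : ℕ) (j : Fin n) (z : Cn n) : ℂ :=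
  (c * Real.exp (c * ρ z) : ℝ) * del j (fun x => (ρ x : ℂ)) z
    - (m / q z : ℝ) * del j (fun x => (q x : ℂ)) z

lemma TestFun.integrable_mul_norm_sq {U : Set (Cn n)} {f : Cn n → ℂ} {g : Cn n → ℝ}
    (hf : TestFun U f) (hg : ∀ z ∈ U, ContDiffAt ℝ ∞ g z) :
    Integrable fun z => g z * ‖f z‖ ^ 2 := by
  have h := ((hf.mul hf.conjugate).mul_left fun z hz => ContDiffAt.ofReal' (hg z hz)).integrable.re
  refine h.congr (ae_of_all _ fun z => ?_)
  simp only [RCLike.re_to_complex, Complex.mul_conj', re_ofReal_mul]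
  norm_cast

section weights

variable {D : Set (Cn n)} {q ρ : Cn n → ℝ} {c : ℝ} {z : Cn n}

lemma contDiffAt_wgt (hq : ContDiffAt ℝ ∞ q z) (hρ : ContDiffAt ℝ ∞ ρ z) (c : ℝ) (m : ℕ) :
    ContDiffAt ℝ ∞ (wgt q ρ c m) z := by
  unfold wgt
  fun_prop

lemma wgt_pos (hq : 0 < q z) (ρ : Cn n → ℝ) (c : ℝ) (m : ℕ) : 0 < wgt q ρ c m z := by
  unfold wgt
  positivity

lemma contDiffAt_wgtP (hq : ContDiffAt ℝ ∞ q z) (hρ : ContDiffAt ℝ ∞ ρ z) (hq0 : 0 < q z) (c : ℝ)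
    (m : ℕ) (j : Fin n) : ContDiffAt ℝ ∞ (wgtP q ρ c m j) z := by
  unfold wgtP
  have h1 : ContDiffAt ℝ ∞ (fun x => c * Real.exp (c * ρ x)) z := by fun_prop
  have h2 : ContDiffAt ℝ ∞ (fun x => m / q x) z := contDiffAt_const.div hq hq0.ne'
  exact ((ContDiffAt.ofReal' h1).mul (contDiffAt_wirt (ContDiffAt.ofReal' hρ))).sub
    ((ContDiffAt.ofReal' h2).mul (contDiffAt_wirt (ContDiffAt.ofReal' hq)))

lemma wirt_exp_mul (hρ : ContDiffAt ℝ ∞ ρ z) (c : ℝ) (s : ℂ) (j : Fin n) :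
    wirt s j (fun x => (Real.exp (c * ρ x) : ℂ)) z
      = (c * Real.exp (c * ρ z) : ℝ) * wirt s j (fun x => (ρ x : ℂ)) z := by
  refine wirt_comp_ofReal (T := fun t => Real.exp (c * t)) ?_ (hρ.differentiableAt (by simp))
  simpa [mul_comm] using ((hasDerivAt_id (ρ z)).const_mul c).exp

lemma del_wgt (hq : ContDiffAt ℝ ∞ q z) (hρ : ContDiffAt ℝ ∞ ρ z) (hq0 : 0 < q z) (c : ℝ)
    (m : ℕ) (j : Fin n) :
    del j (fun x => (wgt q ρ c m x : ℂ)) z = -wgtP q ρ c m j z * wgt q ρ c m z := by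
  have hq' := hq.differentiableAt (n := ∞) (by simp)
  have he : ContDiffAt ℝ ∞ (fun x => Real.exp (c * ρ x)) z := by fun_prop
  have he' := he.differentiableAt (by simp)
  have hE : ContDiffAt ℝ ∞ (fun x => Real.exp (-Real.exp (c * ρ x))) z := by fun_prop
  have h1 : del j (fun x => ((q x ^ m : ℝ) : ℂ)) z
      = ((m * q z ^ (m - 1) : ℝ) : ℂ) * del j (fun x => (q x : ℂ)) z :=
    wirt_comp_ofReal (T := fun t => t ^ m) (hasDerivAt_pow m _) hq'
  have h2 : del j (fun x => (Real.exp (-Real.exp (c * ρ x)) : ℂ)) z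
      = ((-Real.exp (-Real.exp (c * ρ z)) : ℝ) : ℂ)
        * del j (fun x => (Real.exp (c * ρ x) : ℂ)) z :=
    wirt_comp_ofReal (T := fun t => Real.exp (-t))
      (by simpa using (hasDerivAt_id (Real.exp (c * ρ z))).neg.exp) he'
  rw [wirt_exp_mul hρ] at h2
  have h3 : (fun x => (wgt q ρ c m x : ℂ))
      = fun x => ((q x ^ m : ℝ) : ℂ) * (Real.exp (-Real.exp (c * ρ x)) : ℂ) := by
    ext x
    simp [wgt]
  rw [h3, wirt_mul ((ContDiffAt.ofReal' (hq.pow m)).differentiableAt (by simp))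
    ((ContDiffAt.ofReal' hE).differentiableAt (by simp)), h1, h2, wgtP, wgt]
  have hq0' : (q z : ℂ) ≠ 0 := by exact_mod_cast hq0.ne'
  have h4 : (m : ℂ) * (q z : ℂ) ^ (m - 1) = m / q z * q z ^ m := by
    cases m with
    | zero => simp
    | succ m => field_simp; simp [pow_succ]
  push_cast
  rw [h4]
  ring

lemma dbar_wgtP (hq : ContDiffAt ℝ ∞ q z) (hρ : ContDiffAt ℝ ∞ ρ z) (hq0 : 0 < q z) (c : ℝ)
    (m : ℕ) (j k : Fin n) :
    dbar k (wgtP q ρ c m j) z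
      = (c ^ 2 * Real.exp (c * ρ z) : ℝ) * (del j (fun x => (ρ x : ℂ)) z
          * conj (del k (fun x => (ρ x : ℂ)) z))
        + (c * Real.exp (c * ρ z) : ℝ) * dbar k (del j fun x => (ρ x : ℂ)) z
        - (m / q z : ℝ) * dbar k (del j fun x => (q x : ℂ)) z
        + (m / q z ^ 2 : ℝ) * (del j (fun x => (q x : ℂ)) z
          * conj (del k (fun x => (q x : ℂ)) z)) := by
  have he : ContDiffAt ℝ ∞ (fun x => c * Real.exp (c * ρ x)) z := by fun_prop
  have hd : ContDiffAt ℝ ∞ (fun x => m / q x) z := contDiffAt_const.div hq hq0.ne'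
  have h1 : dbar k (fun x => ((c * Real.exp (c * ρ x) : ℝ) : ℂ)) z
      = ((c * (c * Real.exp (c * ρ z)) : ℝ) : ℂ) * dbar k (fun x => (ρ x : ℂ)) z := by
    refine wirt_comp_ofReal (T := fun t => c * Real.exp (c * t)) ?_ (hρ.differentiableAt (by simp))
    refine HasDerivAt.const_mul c ?_
    simpa [mul_comm] using ((hasDerivAt_id (ρ z)).const_mul c).exp
  have h2 : dbar k (fun x => ((m / q x : ℝ) : ℂ)) z
      = ((-(m / q z ^ 2) : ℝ) : ℂ) * dbar k (fun x => (q x : ℂ)) z := by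
    refine wirt_comp_ofReal (T := fun t => m / t) ?_ (hq.differentiableAt (by simp))
    simpa [div_eq_mul_inv] using (hasDerivAt_inv hq0.ne').const_mul (m : ℝ)
  have cρ := contDiffAt_wirt (s := -I) (j := j) (ContDiffAt.ofReal' hρ)
  have cq := contDiffAt_wirt (s := -I) (j := j) (ContDiffAt.ofReal' hq)
  have h3 : wgtP q ρ c m j = fun z => (c * Real.exp (c * ρ z) : ℝ) * del j (fun x => (ρ x : ℂ)) z
    - (m / q z : ℝ) * del j (fun x => (q x : ℂ)) z := rfl
  have e1 := (ContDiffAt.ofReal' he).differentiableAt (by simp)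
  have e2 := (ContDiffAt.ofReal' hd).differentiableAt (by simp)
  have e3 := cρ.differentiableAt (by simp)
  have e4 := cq.differentiableAt (by simp)
  rw [h3, wirt_sub (e1.fun_mul e3) (e2.fun_mul e4), wirt_mul e1 e3, wirt_mul e2 e4, h1, h2,
    conj_del_ofReal, conj_del_ofReal]
  push_cast
  ring

/-- Weighted estimate for the component of `∂̄v` in the direction of the gradient of `ρ`. -/
lemma HDomain.apriori (hD : HDomain D q) (hρ : ∀ z ∈ D, ContDiffAt ℝ ∞ ρ z)
    (hρL : ∀ z ∈ D, ∀ w, 0 ≤ levi ρ z w) (hc : 0 < c) {v : Cn n → ℂ} (hv : TestFun D v) :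
    ∫ z, c ^ 2 * Real.exp (c * ρ z) * ‖∑ j, del j (fun x => (ρ x : ℂ)) z * dbar j v z‖ ^ 2
        * wgt q ρ c 18 z
      ≤ 2 * ∫ z, ‖wdiv (wgtP q ρ c 15) v z‖ ^ 2 * wgt q ρ c 18 z := by
  have hf : ∀ j, TestFun D (dbar j v) := fun j => hv.wirt I j
  have hw : ∀ z ∈ D, ContDiffAt ℝ ∞ (wgt q ρ c 18) z := fun z hz =>
    contDiffAt_wgt (hD.smooth z hz) (hρ z hz) c 18
  have hwp : ∀ z ∈ D, 0 < wgt q ρ c 18 z := fun z hz => wgt_pos (hD.pos z hz) ρ c 18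
  have hP : ∀ (m : ℕ) (j : Fin n), ∀ z ∈ D, ContDiffAt ℝ ∞ (wgtP q ρ c m j) z := fun m j z hz =>
    contDiffAt_wgtP (hD.smooth z hz) (hρ z hz) (hD.pos z hz) c m j
  have hdel : ∀ {f : Cn n → ℝ}, (∀ z ∈ D, ContDiffAt ℝ ∞ f z) →
      TestFun D fun z => ∑ j, del j (fun x => (f x : ℂ)) z * dbar j v z := fun {f} h =>
    TestFun.sum _ fun j _ => (hf j).mul_left fun z hz => contDiffAt_wirt (ContDiffAt.ofReal' (h z hz))
  set X := fun z => ∑ j, del j (fun x => (ρ x : ℂ)) z * dbar j v z with hX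
  set Z := fun z => ∑ j, del j (fun x => (q x : ℂ)) z * dbar j v z with hZ
  have hXt : TestFun D X := hdel hρ
  have hZt : TestFun D Z := hdel hD.smooth
  have hnorm : ∀ Y : Cn n → ℂ, ∀ z, ((‖Y z‖ ^ 2 : ℝ) : ℂ) = Y z * conj (Y z) := fun Y z => by
    rw [Complex.mul_conj']; norm_cast
  have pt1 : ∀ z ∈ D, (∑ j, ∑ k, dbar k (wgtP q ρ c 18 j) z * dbar j v z * conj (dbar k v z)).re
      = c ^ 2 * Real.exp (c * ρ z) * ‖X z‖ ^ 2
        + c * Real.exp (c * ρ z) * levi ρ z (fun j => dbar j v z)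
        - 18 / q z * levi q z (fun j => dbar j v z) + 18 / q z ^ 2 * ‖Z z‖ ^ 2 := by
    intro z hz
    have hS : ∀ f : Cn n → ℝ, ((‖∑ j, del j (fun x => (f x : ℂ)) z * dbar j v z‖ ^ 2 : ℝ) : ℂ)
        = ∑ j, ∑ k, del j (fun x => (f x : ℂ)) z * conj (del k (fun x => (f x : ℂ)) z)
          * dbar j v z * conj (dbar k v z) := by
      intro f
      push_cast
      rw [← Complex.mul_conj', map_sum, Finset.sum_mul_sum]
      refine Finset.sum_congr rfl fun j _ => Finset.sum_congr rfl fun k _ => ?_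
      rw [map_mul]
      ring
    have key : ∑ j, ∑ k, dbar k (wgtP q ρ c 18 j) z * dbar j v z * conj (dbar k v z)
        = (c ^ 2 * Real.exp (c * ρ z) : ℝ) * ((‖X z‖ ^ 2 : ℝ) : ℂ)
          + (c * Real.exp (c * ρ z) : ℝ) * (∑ j, ∑ k, dbar k (del j fun x => (ρ x : ℂ)) z
            * dbar j v z * conj (dbar k v z))
          - (18 / q z : ℝ) * (∑ j, ∑ k, dbar k (del j fun x => (q x : ℂ)) z
            * dbar j v z * conj (dbar k v z)) + (18 / q z ^ 2 : ℝ) * ((‖Z z‖ ^ 2 : ℝ) : ℂ) := by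
      rw [hX, hZ]
      simp only [hS, Finset.mul_sum]
      simp only [← Finset.sum_add_distrib, ← Finset.sum_sub_distrib]
      refine Finset.sum_congr rfl fun j _ => Finset.sum_congr rfl fun k _ => ?_
      rw [dbar_wgtP (hD.smooth z hz) (hρ z hz) (hD.pos z hz)]
      push_cast
      ring
    rw [key]
    simp only [add_re, sub_re, re_ofReal_mul, ofReal_re, levi]
  have pt2 : ∀ z ∈ D, ‖wdiv (wgtP q ρ c 18) v z‖ ^ 2
      ≤ 2 * ‖wdiv (wgtP q ρ c 15) v z‖ ^ 2 + 18 / q z ^ 2 * ‖Z z‖ ^ 2 := by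
    intro z hz
    have hq := hD.pos z hz
    have h1 : wdiv (wgtP q ρ c 18) v z = wdiv (wgtP q ρ c 15) v z + (3 / q z : ℝ) * Z z := by
      simp only [wdiv, hZ, Finset.mul_sum, ← Finset.sum_add_distrib]
      refine Finset.sum_congr rfl fun j _ => ?_
      simp only [wgtP]
      push_cast
      ring
    have h2 : ‖((3 / q z : ℝ) : ℂ) * Z z‖ = 3 / q z * ‖Z z‖ := by
      rw [norm_mul, norm_real, Real.norm_of_nonneg (by positivity)]
    have h3 := norm_add_le (wdiv (wgtP q ρ c 15) v z) ((3 / q z : ℝ) * Z z)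
    rw [h1]
    rw [h2] at h3
    have h4 : 18 / q z ^ 2 * ‖Z z‖ ^ 2 = 2 * (3 / q z * ‖Z z‖) ^ 2 := by ring
    rw [h4]
    nlinarith [sq_nonneg (‖wdiv (wgtP q ρ c 15) v z‖ - 3 / q z * ‖Z z‖), norm_nonneg
      (wdiv (wgtP q ρ c 15) v z + (3 / q z : ℝ) * Z z)]
  have hexp : ∀ z ∈ D, ContDiffAt ℝ ∞ (fun z => c ^ 2 * Real.exp (c * ρ z) * wgt q ρ c 18 z) z :=
    fun z hz => by
      have := hρ z hz
      have := hw z hz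
      fun_prop
  have hdivq : ∀ z ∈ D, ContDiffAt ℝ ∞ (fun z => 18 / q z ^ 2 * wgt q ρ c 18 z) z := fun z hz =>
    (contDiffAt_const.div ((hD.smooth z hz).pow 2) (pow_pos (hD.pos z hz) 2).ne').mul (hw z hz)
  have iA := hXt.integrable_mul_norm_sq hexp
  have iB := hZt.integrable_mul_norm_sq hdivq
  have iT := (wdiv_testFun hv (hP 15)).integrable_mul_norm_sq hw
  have iT18 := (wdiv_testFun hv (hP 18)).integrable_mul_norm_sq hw
  have iR : Integrable fun z =>
      (∑ j, ∑ k, dbar k (wgtP q ρ c 18 j) z * dbar j v z * conj (dbar k v z)).re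
        * wgt q ρ c 18 z := by
    have ht : TestFun D fun z => ∑ j, ∑ k,
        dbar k (wgtP q ρ c 18 j) z * dbar j v z * conj (dbar k v z) :=
      TestFun.sum _ fun j _ => TestFun.sum _ fun k _ =>
        ((hf j).mul_left fun z hz => contDiffAt_wirt (hP 18 j z hz)).mul (hf k).conjugate
    refine (ht.mul_right fun z hz => ContDiffAt.ofReal' (hw z hz)).integrable.re.congr
      (ae_of_all _ fun z => ?_)
    simp only [RCLike.re_to_complex, re_mul_ofReal]
  have hH := hormander_ineq hv hw (fun z hz => (hwp z hz).le) (hP 18) fun j z hz =>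
    del_wgt (hD.smooth z hz) (hρ z hz) (hD.pos z hz) c 18 j
  have hAB : ∫ z, (c ^ 2 * Real.exp (c * ρ z) * wgt q ρ c 18 z * ‖X z‖ ^ 2
      + 18 / q z ^ 2 * wgt q ρ c 18 z * ‖Z z‖ ^ 2)
      ≤ ∫ z, (∑ j, ∑ k, dbar k (wgtP q ρ c 18 j) z * dbar j v z * conj (dbar k v z)).re
        * wgt q ρ c 18 z := by
    refine integral_mono (iA.fun_add iB) iR fun z => ?_
    by_cases hz : z ∈ D
    · simp only [pt1 z hz]
      have h1 := hρL z hz fun j => dbar j v z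
      have h2 := hD.levi_nonpos z hz fun j => dbar j v z
      have h3 : 0 ≤ c * Real.exp (c * ρ z) * levi ρ z (fun j => dbar j v z) := by positivity
      have h4 : 0 ≤ 18 / q z * -levi q z (fun j => dbar j v z) :=
        mul_nonneg (div_nonneg (by norm_num) (hD.pos z hz).le) (by linarith)
      nlinarith [mul_nonneg (add_nonneg h3 h4) (hwp z hz).le]
    · have n1 := image_eq_zero_of_notMem_tsupport (fun h => hz (hXt.subset h))
      have n2 := image_eq_zero_of_notMem_tsupport (fun h => hz (hZt.subset h))
      have n3 : ∀ j, dbar j v z = 0 := fun j =>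
        image_eq_zero_of_notMem_tsupport (fun h => hz ((hf j).subset h))
      simp [n1, n2, n3]
  have hTB : ∫ z, ‖wdiv (wgtP q ρ c 18) v z‖ ^ 2 * wgt q ρ c 18 z
      ≤ ∫ z, (2 * (wgt q ρ c 18 z * ‖wdiv (wgtP q ρ c 15) v z‖ ^ 2)
        + 18 / q z ^ 2 * wgt q ρ c 18 z * ‖Z z‖ ^ 2) := by
    refine integral_mono (by simpa only [mul_comm] using iT18) ((iT.const_mul 2).fun_add iB)
      fun z => ?_
    by_cases hz : z ∈ D
    · have := mul_le_mul_of_nonneg_right (pt2 z hz) (hwp z hz).le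
      simp only
      linarith
    · have n1 := image_eq_zero_of_notMem_tsupport
        (fun h => hz ((wdiv_testFun hv (hP 18)).subset h))
      have n2 := image_eq_zero_of_notMem_tsupport (fun h => hz (hZt.subset h))
      have n3 := image_eq_zero_of_notMem_tsupport
        (fun h => hz ((wdiv_testFun hv (hP 15)).subset h))
      simp [n1, n2, n3]
  rw [integral_add iA iB] at hAB
  rw [integral_add (iT.const_mul 2) iB, integral_const_mul] at hTB
  have e1 : ∀ z, c ^ 2 * Real.exp (c * ρ z) * ‖X z‖ ^ 2 * wgt q ρ c 18 z
      = c ^ 2 * Real.exp (c * ρ z) * wgt q ρ c 18 z * ‖X z‖ ^ 2 := fun z => by ring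
  have e2 : ∀ z, ‖wdiv (wgtP q ρ c 15) v z‖ ^ 2 * wgt q ρ c 18 z
      = wgt q ρ c 18 z * ‖wdiv (wgtP q ρ c 15) v z‖ ^ 2 := fun z => by ring
  change ∫ z, c ^ 2 * Real.exp (c * ρ z) * ‖X z‖ ^ 2 * wgt q ρ c 18 z ≤ _
  simp only [e1, e2]
  linarith

end weights

/-- Second-order Taylor expansion. -/
lemma taylor_two {E : Type*} [NormedAddCommGroup E] [NormedSpace ℝ E] {f : E → ℝ} {z : E}
    (hf : ContDiffAt ℝ ∞ f z) {ε : ℝ} (hε : 0 < ε) :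
    ∃ δ > 0, ∀ v : E, ‖v‖ < δ → f (z + v) ≤ f z + fderiv ℝ f z v
      + (1 / 2) * fderiv ℝ (fderiv ℝ f) z v v + ε * ‖v‖ ^ 2 := by
  have hs : IsSymmSndFDerivAt ℝ f z := hf.isSymmSndFDerivAt (by simpa using ENat.LEInfty.out)
  have hd : HasFDerivAt (fderiv ℝ f) (fderiv ℝ (fderiv ℝ f) z) z :=
    ((hf.fderiv_right (m := ∞) (by simp)).differentiableAt (by simp)).hasFDerivAt
  have h1 : ∀ᶠ v in 𝓝 (0 : E),
      ‖fderiv ℝ f (z + v) - fderiv ℝ f z - fderiv ℝ (fderiv ℝ f) z v‖ ≤ ε * ‖v‖ := by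
    have := (hasFDerivAt_iff_isLittleO_nhds_zero.1 hd).def hε
    simpa using this
  have h2 : ∀ᶠ v in 𝓝 (0 : E), DifferentiableAt ℝ f (z + v) := by
    have h3 : ∀ᶠ x in 𝓝 z, DifferentiableAt ℝ f x := by
      have h4 : ContDiffAt ℝ 1 f z := hf.of_le (by simp)
      filter_upwards [h4.eventually (by simp)] with x hx using hx.differentiableAt (by simp)
    have : Tendsto (fun v => z + v) (𝓝 0) (𝓝 z) := by
      simpa using (continuous_const_add z).tendsto 0
    exact this.eventually h3
  obtain ⟨δ, hδ, h⟩ := Metric.eventually_nhds_iff_ball.1 (h1.and h2)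
  refine ⟨δ, hδ, fun v hv => ?_⟩
  set g : E → ℝ := fun v => f (z + v) - fderiv ℝ f z v
    - (1 / 2) * fderiv ℝ (fderiv ℝ f) z v v with hg
  have hgd : ∀ x ∈ ball (0 : E) δ, HasFDerivAt g
      (fderiv ℝ f (z + x) - fderiv ℝ f z - fderiv ℝ (fderiv ℝ f) z x) x := by
    intro x hx
    have e1 : HasFDerivAt (fun v => f (z + v)) (fderiv ℝ f (z + x)) x := by
      have := (h x hx).2.hasFDerivAt.comp x ((hasFDerivAt_id x).const_add z)
      rwa [ContinuousLinearMap.comp_id] at this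
    have e2 := ((fderiv ℝ (fderiv ℝ f) z).hasFDerivAt (x := x)).clm_apply (hasFDerivAt_id x)
    have e3 : HasFDerivAt g _ x :=
      (e1.sub (fderiv ℝ f z).hasFDerivAt).sub (e2.const_mul (1 / 2 : ℝ))
    refine e3.congr_fderiv ?_
    refine ContinuousLinearMap.ext fun y => ?_
    have := hs.eq x y
    simp
    rw [this]
    ring
  have hv' : v ∈ closedBall (0 : E) ‖v‖ := by simp
  have hsub : closedBall (0 : E) ‖v‖ ⊆ ball 0 δ := closedBall_subset_ball hv
  have := (convex_closedBall (0 : E) ‖v‖).norm_image_sub_le_of_norm_hasFDerivWithin_le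
    (f := g) (C := ε * ‖v‖) (fun x hx => (hgd x (hsub hx)).hasFDerivWithinAt)
    (fun x hx => ((h x (hsub hx)).1).trans (by
      have : ‖x‖ ≤ ‖v‖ := by simpa using hx
      gcongr)) (mem_closedBall_self (norm_nonneg v)) hv'
  have h5 := (Real.le_norm_self _).trans this
  simp only [hg, add_zero, map_zero, sub_zero, mul_zero] at h5
  nlinarith [h5]

lemma PshOn.mono {E : Type*} [NormedAddCommGroup E] [NormedSpace ℂ E] {f : E → ℝ} {s t : Set E}
    (hf : PshOn f t) (h : s ⊆ t) : PshOn f s :=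
  ⟨fun x hx => (hf.1 x (h hx)).mono h, fun z hz w r hr hl =>
    hf.2 z (h hz) w r hr fun l hl' => h (hl l hl')⟩

lemma PshOn.laplacian_nonneg {E : Type*} [NormedAddCommGroup E] [NormedSpace ℂ E]
    {f : E → ℝ} {U : Set E} (hU : IsOpen U) (hf : PshOn f U) {z : E} (hz : z ∈ U)
    (hs : ContDiffAt ℝ ∞ f z) (w : E) :
    0 ≤ fderiv ℝ (fderiv ℝ f) z w w + fderiv ℝ (fderiv ℝ f) z (I • w) (I • w) := by
  set B := fderiv ℝ (fderiv ℝ f) z with hB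
  by_contra! hA
  set A := B w w + B (I • w) (I • w) with hAdef
  set ε := -A / (8 * (‖w‖ ^ 2 + 1)) with hε
  have hε0 : 0 < ε := by
    rw [hε]
    apply div_pos (by linarith) (by positivity)
  have hεw : ε * ‖w‖ ^ 2 ≤ -A / 8 := by
    rw [hε, div_mul_eq_mul_div, div_le_div_iff₀ (by positivity) (by norm_num)]
    nlinarith [sq_nonneg ‖w‖]
  obtain ⟨δ, hδ, ht⟩ := taylor_two hs hε0
  obtain ⟨δ', hδ', hU'⟩ := Metric.isOpen_iff.1 hU z hz
  obtain ⟨r, hr, hrw⟩ : ∃ r > 0, r * ‖w‖ < min δ δ' := by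
    refine ⟨min δ δ' / (2 * (‖w‖ + 1)), by positivity, ?_⟩
    have hm : 0 < min δ δ' := lt_min hδ hδ'
    rw [div_mul_eq_mul_div, div_lt_iff₀ (by positivity)]
    nlinarith [norm_nonneg w]
  have hsub := hf.2 z hz w r hr (fun l hl => hU' (by
    rw [mem_ball, dist_eq_norm, add_sub_cancel_left, norm_smul]
    exact (mul_le_mul_of_nonneg_right hl (norm_nonneg w)).trans_lt
      (hrw.trans_le (min_le_right _ _))))
  set H : ℝ → ℝ := fun θ => f z + r * (Real.cos θ * fderiv ℝ f z w
      + Real.sin θ * fderiv ℝ f z (I • w))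
      + (r ^ 2 / 2) * (Real.cos θ ^ 2 * B w w + Real.sin θ * Real.cos θ * (B w (I • w) + B (I • w) w)
        + Real.sin θ ^ 2 * B (I • w) (I • w)) + ε * (r * ‖w‖) ^ 2 with hH
  have hle := hsub H (by fun_prop) (fun θ => by
    have hv : ((r : ℂ) * Complex.exp (θ * I)) • w
        = (r * Real.cos θ) • w + (r * Real.sin θ) • (I • w) := by
      rw [Complex.exp_mul_I, ← ofReal_cos, ← ofReal_sin, mul_add, add_smul,
        ← Complex.coe_smul, ← Complex.coe_smul, smul_smul]
      push_cast
      congr 2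
      ring
    have hn : ‖((r : ℂ) * Complex.exp (θ * I)) • w‖ = r * ‖w‖ := by
      rw [norm_smul, norm_mul, Complex.norm_exp_ofReal_mul_I, norm_real,
        Real.norm_of_nonneg hr.le, mul_one]
    have := ht _ (hn.trans_lt (hrw.trans_le (min_le_left _ _)))
    rw [hn] at this
    have h2 : f (z + ((r : ℂ) * Complex.exp (θ * I)) • w) ≤ H θ := by
      refine this.trans (le_of_eq ?_)
      rw [hv, hH]
      simp only [map_add, map_smul, _root_.add_apply, _root_.smul_apply, smul_eq_mul]
      ring
    exact EReal.coe_le_coe_iff.2 h2)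
  have hI : ∫ θ in (0:ℝ)..(2 * Real.pi), H θ
      = 2 * Real.pi * (f z + ε * (r * ‖w‖) ^ 2 + r ^ 2 / 4 * A) := by
    have e : H = fun θ => (f z + ε * (r * ‖w‖) ^ 2) + (r * fderiv ℝ f z w) * Real.cos θ
        + (r * fderiv ℝ f z (I • w)) * Real.sin θ + (r ^ 2 / 2 * B w w) * Real.cos θ ^ 2
        + (r ^ 2 / 2 * (B w (I • w) + B (I • w) w)) * (Real.sin θ * Real.cos θ)
        + (r ^ 2 / 2 * B (I • w) (I • w)) * Real.sin θ ^ 2 := by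
      ext θ
      simp only [hH]
      ring
    have ii : ∀ g : ℝ → ℝ, Continuous g → IntervalIntegrable g volume 0 (2 * Real.pi) :=
      fun g hg => hg.intervalIntegrable _ _
    rw [e, intervalIntegral.integral_add (ii _ (by fun_prop)) (ii _ (by fun_prop)),
      intervalIntegral.integral_add (ii _ (by fun_prop)) (ii _ (by fun_prop)),
      intervalIntegral.integral_add (ii _ (by fun_prop)) (ii _ (by fun_prop)),
      intervalIntegral.integral_add (ii _ (by fun_prop)) (ii _ (by fun_prop)),
      intervalIntegral.integral_add (ii _ (by fun_prop)) (ii _ (by fun_prop))]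
    simp only [intervalIntegral.integral_const_mul, intervalIntegral.integral_const, integral_cos,
      integral_sin, integral_cos_sq, integral_sin_sq, integral_sin_mul_cos₁]
    simp
    ring
  rw [hI, EReal.coe_le_coe_iff, inv_mul_cancel_left₀ (by positivity)] at hle
  have h3 : ε * (r * ‖w‖) ^ 2 = r ^ 2 * (ε * ‖w‖ ^ 2) := by ring
  rw [h3] at hle
  nlinarith [pow_pos hr 2]

lemma levi_eq {f : Cn n → ℝ} {z : Cn n} (hf : ContDiffAt ℝ ∞ f z) (w : Fin n → ℂ) :
    levi f z w = (1 / 4) * (fderiv ℝ (fderiv ℝ f) z (∑ j, w j • stdVec j) (∑ j, w j • stdVec j)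
      + fderiv ℝ (fderiv ℝ f) z (I • ∑ j, w j • stdVec j) (I • ∑ j, w j • stdVec j)) := by
  have hs : IsSymmSndFDerivAt ℝ f z := hf.isSymmSndFDerivAt (by simpa using ENat.LEInfty.out)
  have hcast : ∀ a b : Cn n, fderiv ℝ (fderiv ℝ fun x => (f x : ℂ)) z a b
      = (fderiv ℝ (fderiv ℝ f) z a b : ℂ) := by
    intro a b
    have h1 : fderiv ℝ (fun x => (f x : ℂ)) =ᶠ[𝓝 z] fun x => ofRealCLM.comp (fderiv ℝ f x) := by
      have h4 : ContDiffAt ℝ 1 f z := hf.of_le (by simp)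
      filter_upwards [h4.eventually (by simp)] with x hx
      exact (ofRealCLM.hasFDerivAt.comp x (hx.differentiableAt (by simp)).hasFDerivAt).fderiv
    have hd : HasFDerivAt (fderiv ℝ f) (fderiv ℝ (fderiv ℝ f) z) z :=
      ((hf.fderiv_right (m := ∞) (by simp)).differentiableAt (by simp)).hasFDerivAt
    rw [h1.fderiv_eq, ((hasFDerivAt_const ofRealCLM z).clm_comp hd).fderiv]
    simp
  set B := fderiv ℝ (fderiv ℝ f) z
  have hd : ∀ j k, dbar k (del j fun x => (f x : ℂ)) z
      = (1 / 4) * ((B (stdVec j) (stdVec k) + B (I • stdVec j) (I • stdVec k) : ℝ)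
        + I * (B (I • stdVec k) (stdVec j) - B (stdVec k) (I • stdVec j) : ℝ)) := by
    intro j k
    change (1 / 2) * (fderiv ℝ (wirt (-I) j fun x => (f x : ℂ)) z (stdVec k)
      + I * fderiv ℝ (wirt (-I) j fun x => (f x : ℂ)) z (I • stdVec k)) = _
    rw [fderiv_wirt (ContDiffAt.ofReal' hf), fderiv_wirt (ContDiffAt.ofReal' hf), hcast, hcast,
      hcast, hcast, hs.eq (stdVec j) (stdVec k), hs.eq (I • stdVec j) (I • stdVec k)]
    push_cast
    ring_nf
    rw [I_sq]
    ring
  have hw : ∑ j, w j • stdVec j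
      = ∑ j, ((w j).re • stdVec j + (w j).im • (I • stdVec j) : Cn n) := by
    refine Finset.sum_congr rfl fun j _ => ?_
    conv_lhs => rw [← re_add_im (w j), add_smul, mul_smul, Complex.coe_smul, Complex.coe_smul]
  have hIw : I • ∑ j, w j • stdVec j
      = ∑ j, ((w j).re • (I • stdVec j) - (w j).im • stdVec j : Cn n) := by
    rw [hw, Finset.smul_sum]
    refine Finset.sum_congr rfl fun j _ => ?_
    rw [smul_add, smul_comm I (w j).re, smul_comm I (w j).im, smul_smul, I_mul_I, neg_one_smul,
      smul_neg, sub_eq_add_neg]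
  rw [levi, hIw, hw]
  simp only [hd, map_sum, _root_.sum_apply, re_sum, ← Finset.sum_add_distrib, Finset.mul_sum]
  have hswap : ∀ G : Fin n → Fin n → ℝ, ∑ j, ∑ k, G j k = ∑ j, ∑ k, G k j := fun G =>
    Finset.sum_comm
  refine Finset.sum_congr rfl fun j _ => Finset.sum_congr rfl fun k _ => ?_
  simp only [map_add, map_sub, map_smul, _root_.add_apply, _root_.sub_apply, _root_.smul_apply,
    smul_eq_mul]
  rw [hs.eq (stdVec k) (stdVec j), hs.eq (I • stdVec k) (I • stdVec j),
    hs.eq (I • stdVec k) (stdVec j), hs.eq (stdVec k) (I • stdVec j)]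
  simp
  ring

lemma PshOn.levi_nonneg {f : Cn n → ℝ} {U : Set (Cn n)} (hU : IsOpen U) (hf : PshOn f U)
    {z : Cn n} (hz : z ∈ U) (hs : ContDiffAt ℝ ∞ f z) (w : Fin n → ℂ) : 0 ≤ levi f z w := by
  rw [levi_eq hs]
  exact mul_nonneg (by norm_num) (hf.laplacian_nonneg hU hz hs _)

lemma sum_stdVec (v : Cn n) :
    v = ∑ j, ((v j).re • stdVec j + (v j).im • (I • stdVec j)) := by
  ext k
  rw [WithLp.ofLp_sum, Finset.sum_apply, Finset.sum_eq_single k]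
  · apply Complex.ext <;> simp [stdVec]
  · intro j _ hj
    simp [stdVec, hj.symm]
  · simp

lemma differentiableAt_of_dbar_eq_zero {f : Cn n → ℂ} {z : Cn n} (hf : DifferentiableAt ℝ f z)
    (h : ∀ j, dbar j f z = 0) : DifferentiableAt ℂ f z := by
  rw [differentiableAt_iff_restrictScalars ℝ hf]
  set L := fderiv ℝ f z with hL
  have h0 : ∀ j, L (I • stdVec j) = I * L (stdVec j) := by
    intro j
    have := h j
    simp only [wirt, ← hL] at this
    linear_combination (-2 * I) * this + L (I • stdVec j) * I_sq
  have h1 : ∀ v, L (I • v) = I * L v := by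
    intro v
    conv_lhs => rw [sum_stdVec v]
    conv_rhs => rw [sum_stdVec v]
    simp only [Finset.smul_sum, map_sum, Finset.mul_sum, smul_add, map_add]
    refine Finset.sum_congr rfl fun j _ => ?_
    rw [smul_comm I, smul_comm I, smul_smul I I, I_mul_I]
    simp only [map_smul, h0, real_smul, neg_smul, one_smul, map_neg]
    linear_combination (-((v j).im : ℂ)) * L (stdVec j) * I_sq
  have h2 : ∀ (c : ℂ) v, L (c • v) = c * L v := by
    intro c v
    have : c • v = c.re • v + c.im • (I • v) := by
      conv_lhs => rw [← re_add_im c]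
      rw [add_smul, mul_smul]
      rfl
    rw [this, map_add, map_smul, map_smul, h1]
    conv_rhs => rw [← re_add_im c]
    simp only [real_smul]
    ring
  exact ⟨{ toFun := L, map_add' := map_add L, map_smul' := fun c v => by simpa using h2 c v,
           cont := L.continuous }, by ext; rfl⟩

lemma dbar_eq_zero {f : Cn n → ℂ} {z : Cn n} (hf : DifferentiableAt ℂ f z) (j : Fin n) :
    dbar j f z = 0 := by
  have h : fderiv ℝ f z = (fderiv ℂ f z).restrictScalars ℝ := hf.fderiv_restrictScalars ℝ
  simp only [wirt, h, ContinuousLinearMap.coe_restrictScalars', map_smul, smul_eq_mul]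
  linear_combination (1 / 2 : ℂ) * (fderiv ℂ f z (stdVec j)) * I_sq

/-- Rotation by a unit complex number preserves the volume. -/
lemma measurePreserving_smul {a : ℂ} (ha : ‖a‖ = 1) :
    MeasurePreserving (fun t : Cn n => a • t) := by
  have ha0 : a ≠ 0 := by rintro rfl; simp at ha
  let e : Cn n ≃L[ℝ] Cn n :=
    (ContinuousLinearEquiv.smulLeft (Units.mk0 a ha0) : Cn n ≃L[ℂ] Cn n).restrictScalars ℝ
  have he : ∀ t, e t = a • t := fun t => rfl
  refine ⟨(continuous_const_smul a).measurable, ?_⟩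
  have : (Measure.map e (volume : Measure (Cn n))).IsAddHaarMeasure := e.isAddHaarMeasure_map _
  have h1 := Measure.isAddLeftInvariant_eq_smul (Measure.map e volume) (volume : Measure (Cn n))
  have h2 : e ⁻¹' ball (0 : Cn n) 1 = ball 0 1 := by
    ext t
    simp [he, norm_smul, ha]
  have h3 : (Measure.map e (volume : Measure (Cn n))) (ball 0 1) = volume (ball (0 : Cn n) 1) := by
    rw [Measure.map_apply e.continuous.measurable measurableSet_ball, h2]
  have h4 : Measure.addHaarScalarFactor (Measure.map e volume) (volume : Measure (Cn n)) = 1 := by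
    rw [h1, Measure.smul_apply, ENNReal.smul_def, smul_eq_mul] at h3
    have h5 := (ENNReal.mul_eq_right (measure_ball_pos volume (0 : Cn n) one_pos).ne'
      measure_ball_lt_top.ne).1 h3
    exact_mod_cast h5
  rw [h4, one_smul] at h1
  exact h1

/-- Convolution. -/
def conv (κ u : Cn n → ℂ) (x : Cn n) : ℂ := ∫ t, κ t * u (x - t)

lemma conv_eq_convolution (κ u : Cn n → ℂ) :
    conv κ u = convolution κ u (ContinuousLinearMap.mul ℝ ℂ) volume := rfl

lemma conv_swap (κ u : Cn n → ℂ) (x : Cn n) : conv κ u x = ∫ y, κ (x - y) * u y := by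
  rw [conv, ← integral_sub_left_eq_self _ volume x]
  simp

namespace TestFun

variable {U : Set (Cn n)} {κ u : Cn n → ℂ}

lemma contDiff_conv (hκ : TestFun U κ) (hu : LocallyIntegrable u) : ContDiff ℝ ∞ (conv κ u) := by
  rw [conv_eq_convolution]
  exact hκ.compact.contDiff_convolution_left _ hκ.smooth hu

lemma integrable_conv (hκ : TestFun U κ) (hu : LocallyIntegrable u) (x : Cn n) :
    Integrable fun t => κ t * u (x - t) :=
  (hκ.compact.convolutionExists_left (ContinuousLinearMap.mul ℝ ℂ) hκ.continuous hu x).integrable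

lemma integrable_conv_swap (hκ : TestFun U κ) (hu : LocallyIntegrable u) (x : Cn n) :
    Integrable fun y => κ (x - y) * u y := by
  simpa using (hκ.integrable_conv hu x).comp_sub_left x

lemma fderiv_conv (hκ : TestFun U κ) (hu : LocallyIntegrable u) (x a : Cn n) :
    fderiv ℝ (conv κ u) x a = conv (fun t => fderiv ℝ κ t a) u x := by
  have h := hκ.compact.hasFDerivAt_convolution_left (ContinuousLinearMap.mul ℝ ℂ)
    (hκ.smooth.of_le (by exact_mod_cast le_top)) hu x
  have h2 := ((hκ.compact.fderiv ℝ).convolutionExists_left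
    ((ContinuousLinearMap.mul ℝ ℂ).precompL (Cn n))
    (hκ.smooth.continuous_fderiv (by simp)) hu x).integrable
  rw [conv_eq_convolution, h.fderiv, convolution_def, ContinuousLinearMap.integral_apply h2]
  rfl

lemma wirt_conv (hκ : TestFun U κ) (hu : LocallyIntegrable u) (s : ℂ) (j : Fin n) (x : Cn n) :
    Berndtsson.wirt s j (conv κ u) x = conv (Berndtsson.wirt s j κ) u x := by
  have h1 : ∀ a, Integrable fun t => fderiv ℝ κ t a * u (x - t) := fun a =>
    ((hκ.compact.fderiv_apply ℝ a).convolutionExists_left (ContinuousLinearMap.mul ℝ ℂ)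
      ((hκ.smooth.continuous_fderiv (by simp)).clm_apply continuous_const) hu x).integrable
  rw [Berndtsson.wirt, hκ.fderiv_conv hu, hκ.fderiv_conv hu]
  simp only [conv, Berndtsson.wirt]
  rw [← integral_const_mul, ← integral_add (h1 _) ((h1 _).const_mul _), ← integral_const_mul]
  congr 1
  ext t
  ring

end TestFun

/-- A radial bump function supported in the ball of radius `δ`. -/
def mol₀ (δ : ℝ) (t : Cn n) : ℝ := Real.smoothTransition (1 - ‖t‖ ^ 2 / δ ^ 2)

/-- A radial mollifier supported in the ball of radius `δ`. -/
def mol (δ : ℝ) (t : Cn n) : ℝ := mol₀ δ t / ∫ s : Cn n, mol₀ δ s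

/-- The radial mollifier, as a complex function. -/
def kern (δ : ℝ) (t : Cn n) : ℂ := (mol δ t : ℂ)

variable {δ : ℝ}

lemma contDiff_mol₀ : ContDiff ℝ ∞ (mol₀ δ : Cn n → ℝ) := by
  have := (contDiff_norm_sq (E := Cn n) ℝ (n := ∞))
  exact Real.smoothTransition.contDiff.comp (contDiff_const.sub (this.div_const _))

lemma mol₀_eq_zero (hδ : 0 < δ) {t : Cn n} (ht : δ ≤ ‖t‖) : mol₀ δ t = 0 := by
  refine Real.smoothTransition.zero_of_nonpos ?_
  rw [sub_nonpos, one_le_div (by positivity)]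
  gcongr

lemma mol₀_nonneg (t : Cn n) : 0 ≤ mol₀ δ t := Real.smoothTransition.nonneg _

lemma hasCompactSupport_mol₀ (hδ : 0 < δ) : HasCompactSupport (mol₀ δ : Cn n → ℝ) :=
  HasCompactSupport.intro (isCompact_closedBall 0 δ) fun t ht =>
    mol₀_eq_zero hδ (by simpa using (not_le.1 (by simpa using ht)).le)

lemma integrable_mol₀ (hδ : 0 < δ) : Integrable (mol₀ δ : Cn n → ℝ) :=
  contDiff_mol₀.continuous.integrable_of_hasCompactSupport (hasCompactSupport_mol₀ hδ)

lemma integral_mol₀_pos (hδ : 0 < δ) : 0 < ∫ s : Cn n, mol₀ δ s := by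
  refine contDiff_mol₀.continuous.integral_pos_of_hasCompactSupport_nonneg_nonzero
    (hasCompactSupport_mol₀ hδ) mol₀_nonneg (x := 0) ?_
  simp [mol₀]

lemma mol_nonneg (t : Cn n) : 0 ≤ mol δ t :=
  div_nonneg (mol₀_nonneg t) (integral_nonneg mol₀_nonneg)

lemma mol_eq_zero (hδ : 0 < δ) {t : Cn n} (ht : δ ≤ ‖t‖) : mol δ t = 0 := by
  simp [mol, mol₀_eq_zero hδ ht]

lemma integrable_mol (hδ : 0 < δ) : Integrable (mol δ : Cn n → ℝ) :=
  (integrable_mol₀ hδ).div_const _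

lemma integral_mol (hδ : 0 < δ) : ∫ t : Cn n, mol δ t = 1 := by
  simp only [mol]
  rw [integral_div, div_self (integral_mol₀_pos hδ).ne']

lemma mol_smul {a : ℂ} (ha : ‖a‖ = 1) (t : Cn n) : mol δ (a • t) = mol δ t := by
  simp [mol, mol₀, norm_smul, ha]

lemma testFun_kern (hδ : 0 < δ) : TestFun (closedBall 0 δ) (kern δ : Cn n → ℂ) := by
  have h0 : ∀ t ∉ closedBall (0 : Cn n) δ, kern δ t = 0 := fun t ht => by
    rw [kern, mol_eq_zero hδ, ofReal_zero]
    simpa using (not_le.1 (by simpa using ht)).le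
  refine ⟨ofRealCLM.contDiff.comp (contDiff_mol₀.div_const _),
    HasCompactSupport.intro (isCompact_closedBall 0 δ) h0, closure_minimal ?_ isClosed_closedBall⟩
  intro t ht
  by_contra h
  exact ht (h0 t h)

lemma integral_kern (hδ : 0 < δ) : ∫ t : Cn n, kern δ t = 1 := by
  simp only [kern]
  rw [integral_complex_ofReal, integral_mol hδ, ofReal_one]

/-- The mean value property, averaged against the radial mollifier. -/
lemma conv_kern_eq {F : Cn n → ℂ} {x₀ : Cn n} {δ R : ℝ} (hF : DifferentiableOn ℂ F (ball x₀ R))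
    (hδ : 0 < δ) (hR : δ < R) : conv (kern δ) F x₀ = F x₀ := by
  have hk := testFun_kern (n := n) hδ
  have hmem : ∀ {ζ : ℂ} {t : Cn n}, ‖ζ‖ * ‖t‖ < R → x₀ - ζ • t ∈ ball x₀ R := by
    intro ζ t h
    rwa [mem_ball, dist_eq_norm, sub_sub_cancel_left, norm_neg, norm_smul]
  set Φ : ℝ → Cn n → ℂ := fun θ t => kern δ t * F (x₀ - cexp (θ * I) • t) with hΦ
  have hcont : Continuous (Function.uncurry Φ) := by
    refine continuous_iff_continuousAt.2 fun ⟨θ, t⟩ => ?_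
    rcases lt_or_ge ‖t‖ R with ht | ht
    · have h1 : ContinuousAt F (x₀ - cexp (θ * I) • t) :=
        ((hF _ (hmem (by simpa [norm_exp_ofReal_mul_I] using ht))).differentiableAt
          (isOpen_ball.mem_nhds (hmem (by simpa [norm_exp_ofReal_mul_I] using ht)))).continuousAt
      have h2 : ContinuousAt (fun p : ℝ × Cn n => x₀ - cexp (p.1 * I) • p.2) (θ, t) := by
        fun_prop
      have h3 : ContinuousAt (fun p : ℝ × Cn n => kern δ p.2) (θ, t) :=
        (hk.continuous.comp continuous_snd).continuousAt
      exact h3.mul (ContinuousAt.comp (f := fun p : ℝ × Cn n => x₀ - cexp (p.1 * I) • p.2) h1 h2)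
    · have h0 : Function.uncurry Φ =ᶠ[𝓝 (θ, t)] fun _ => 0 := by
        have : {p : ℝ × Cn n | δ < ‖p.2‖} ∈ 𝓝 (θ, t) :=
          (isOpen_lt continuous_const (by fun_prop)).mem_nhds (hR.trans_le ht)
        filter_upwards [this] with p hp
        simp [Function.uncurry, hΦ, kern, mol_eq_zero hδ (le_of_lt hp)]
      exact continuousAt_const.congr h0.symm
  have hInt : Integrable (Function.uncurry Φ)
      ((volume.restrict (uIoc 0 (2 * Real.pi))).prod (volume : Measure (Cn n))) := by
    have h1 : IntegrableOn (Function.uncurry Φ)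
        (uIoc 0 (2 * Real.pi) ×ˢ closedBall (0 : Cn n) δ) (volume.prod volume) :=
      (hcont.continuousOn.integrableOn_compact
        (isCompact_uIcc.prod (isCompact_closedBall _ _))).mono_set
          (prod_mono uIoc_subset_uIcc subset_rfl)
    have h2 : IntegrableOn (Function.uncurry Φ) (univ ×ˢ closedBall (0 : Cn n) δ)
        ((volume.restrict (uIoc 0 (2 * Real.pi))).prod volume) := by
      rw [IntegrableOn, ← Measure.prod_restrict] at h1 ⊢
      simpa using h1
    refine (integrableOn_iff_integrable_of_support_subset fun p hp => ?_).1 h2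
    simp only [mem_prod, mem_univ, true_and]
    by_contra h
    refine hp ?_
    have : δ ≤ ‖p.2‖ := by simpa using (not_le.1 (by simpa using h)).le
    simp [Function.uncurry, hΦ, kern, mol_eq_zero hδ this]
  have hswap := intervalIntegral_integral_swap hInt
  have hl : ∀ θ : ℝ, ∫ t, Φ θ t = conv (kern δ) F x₀ := by
    intro θ
    have ha := norm_exp_ofReal_mul_I θ
    have he : MeasurableEmbedding fun t : Cn n => cexp (θ * I) • t :=
      (Homeomorph.smulOfNeZero (cexp (θ * I)) (exp_ne_zero _)).measurableEmbedding
    have := (measurePreserving_smul (n := n) ha).integral_comp he fun t => kern δ t * F (x₀ - t)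
    rw [conv, ← this]
    simp only [hΦ, kern, mol_smul ha]
  have hr : ∀ t, ∫ θ in (0 : ℝ)..2 * Real.pi, Φ θ t = kern δ t * (2 * Real.pi * F x₀) := by
    intro t
    rcases lt_or_ge ‖t‖ δ with ht | ht
    · have hd : ∀ ζ : ℂ, ‖ζ‖ ≤ 1 → DifferentiableAt ℂ (fun ζ : ℂ => F (x₀ - ζ • t)) ζ := by
        intro ζ hζ
        have hm : x₀ - ζ • t ∈ ball x₀ R := hmem (by nlinarith [norm_nonneg t])
        have h1 : DifferentiableAt ℂ F (x₀ - ζ • t) :=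
          (hF _ hm).differentiableAt (isOpen_ball.mem_nhds hm)
        exact h1.comp ζ (f := fun ζ : ℂ => x₀ - ζ • t) (by fun_prop)
      have h2 := circleAverage_of_differentiable_on_off_countable (R := 1) (c := (0 : ℂ))
        (f := fun ζ : ℂ => F (x₀ - ζ • t)) countable_empty
        (fun ζ hζ => (hd ζ (by simpa using hζ)).continuousAt.continuousWithinAt)
        (fun ζ hζ => hd ζ (by simpa using (show ‖ζ‖ < 1 by simpa using hζ.1).le))
      simp only [Real.circleAverage, circleMap_zero, zero_smul, sub_zero, ofReal_one, one_mul] at h2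
      simp only [hΦ]
      rw [intervalIntegral.integral_const_mul, ← h2, real_smul]
      push_cast
      rw [mul_inv_cancel_left₀ (by simp)]
    · simp [hΦ, kern, mol_eq_zero hδ ht]
  simp only [hl, hr] at hswap
  rw [intervalIntegral.integral_const, integral_mul_const, integral_kern hδ, sub_zero,
    real_smul] at hswap
  push_cast at hswap
  have h2 : (2 * Real.pi : ℂ) ≠ 0 := by simp
  rw [one_mul] at hswap
  exact mul_left_cancel₀ h2 hswap

lemma conv_congr_ball {κ u v : Cn n → ℂ} {x : Cn n} {δ : ℝ} (hκ : TestFun (closedBall 0 δ) κ)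
    (h : ∀ y ∈ closedBall x δ, u y = v y) : conv κ u x = conv κ v x := by
  simp only [conv]
  congr 1
  ext t
  by_cases ht : t ∈ closedBall (0 : Cn n) δ
  · rw [h _ (by simpa [dist_eq_norm] using ht)]
  · simp [image_eq_zero_of_notMem_tsupport fun h' => ht (hκ.subset h')]

lemma DifferentiableOn.contDiffAt_real {F : Cn n → ℂ} {U : Set (Cn n)}
    (hF : DifferentiableOn ℂ F U) (hU : IsOpen U) {x : Cn n} (hx : x ∈ U) :
    ContDiffAt ℝ ∞ F x := by
  obtain ⟨R, hR, hRU⟩ := Metric.isOpen_iff.1 hU x hx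
  set δ := R / 4 with hδ
  have hδ0 : 0 < δ := by positivity
  have hsub : closedBall x (2 * δ) ⊆ U := (closedBall_subset_ball (by linarith)).trans hRU
  set w := (closedBall x (2 * δ)).indicator F
  have hw : Integrable w :=
    ((hF.continuousOn.mono hsub).integrableOn_compact (isCompact_closedBall _ _)).integrable_indicator
      measurableSet_closedBall
  have hk := testFun_kern (n := n) hδ0
  refine (hk.contDiff_conv hw.locallyIntegrable).contDiffAt.congr_of_eventuallyEq ?_
  filter_upwards [ball_mem_nhds x hδ0] with y hy
  have hy' : dist y x < δ := hy
  rw [← conv_kern_eq (F := F) (x₀ := y) (R := 2 * δ) (hF.mono ?_) hδ0 (by linarith)]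
  · refine conv_congr_ball hk fun z hz => ?_
    refine (indicator_of_mem ?_ F).symm
    have := dist_triangle z y x
    rw [mem_closedBall] at hz ⊢
    linarith
  · refine Subset.trans (fun z hz => ?_) hRU
    have := dist_triangle z y x
    rw [mem_ball] at hz ⊢
    linarith

lemma lintegral_sq_le_of_isProbabilityMeasure {α : Type*} [MeasurableSpace α] (P : Measure α)
    [IsProbabilityMeasure P] {f : α → ℝ≥0∞} (hf : AEMeasurable f P) :
    (∫⁻ t, f t ∂P) ^ 2 ≤ ∫⁻ t, f t ^ 2 ∂P := by
  have h := ENNReal.lintegral_mul_le_Lp_mul_Lq P Real.HolderConjugate.two_two hf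
    (aemeasurable_const (b := (1 : ℝ≥0∞)))
  simp only [Pi.mul_apply, mul_one, ENNReal.one_rpow, lintegral_one, measure_univ] at h
  calc (∫⁻ t, f t ∂P) ^ 2 ≤ ((∫⁻ t, f t ^ (2 : ℝ) ∂P) ^ (1 / 2 : ℝ)) ^ 2 := by gcongr
    _ = ∫⁻ t, f t ^ 2 ∂P := by
      rw [← ENNReal.rpow_natCast, ← ENNReal.rpow_mul]
      norm_num

lemma lintegral_enorm_conv_sub_sq_le {δ : ℝ} (hδ : 0 < δ) {u : Cn n → ℂ} (hu : MemLp u 2)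
    {S : ℝ≥0∞} (hS : ∀ t : Cn n, ‖t‖ < δ → ∫⁻ x, ‖u (x - t) - u x‖ₑ ^ 2 ≤ S) :
    ∫⁻ x, ‖conv (kern δ) u x - u x‖ₑ ^ 2 ≤ S := by
  have hk := testFun_kern (n := n) hδ
  have hloc : LocallyIntegrable u := hu.locallyIntegrable (by norm_num)
  have hkm : Measurable fun t : Cn n => ‖kern δ t‖ₑ := hk.continuous.enorm.measurable
  set P : Measure (Cn n) := volume.withDensity fun t => ‖kern δ t‖ₑ
  have hP : IsProbabilityMeasure P := by
    refine ⟨?_⟩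
    rw [withDensity_apply _ MeasurableSet.univ, setLIntegral_univ]
    have h1 := ofReal_integral_eq_lintegral_ofReal (integrable_mol (n := n) hδ)
      (ae_of_all _ mol_nonneg)
    rw [integral_mol hδ, ENNReal.ofReal_one] at h1
    rw [h1]
    refine lintegral_congr fun t => ?_
    rw [kern, ← ofReal_norm, norm_real, Real.norm_of_nonneg (mol_nonneg t)]
  have hPac : P ≪ volume := withDensity_absolutelyContinuous _ _
  have hjoint : AEStronglyMeasurable (fun p : Cn n × Cn n => u (p.1 - p.2) - u p.1)
      (volume.prod volume) :=
    (hu.1.comp_quasiMeasurePreserving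
      (quasiMeasurePreserving_sub_of_right_invariant volume volume)).sub hu.1.comp_fst
  have hpt : ∀ x, ‖conv (kern δ) u x - u x‖ₑ ≤ ∫⁻ t, ‖u (x - t) - u x‖ₑ ∂P := by
    intro x
    have h1 : conv (kern δ) u x - u x = ∫ t, kern δ t * (u (x - t) - u x) := by
      simp only [mul_sub]
      rw [integral_sub (hk.integrable_conv hloc x) (hk.integrable.mul_const _), integral_mul_const,
        integral_kern hδ, one_mul, conv]
    rw [h1, lintegral_withDensity_eq_lintegral_mul_non_measurable _ hkm (by simp)]
    refine (enorm_integral_le_lintegral_enorm _).trans (le_of_eq ?_)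
    simp
  have hm : ∀ x, AEMeasurable (fun t => ‖u (x - t) - u x‖ₑ) volume := fun x =>
    ((hu.1.comp_quasiMeasurePreserving
      (quasiMeasurePreserving_sub_left_of_right_invariant volume x)).sub
        aestronglyMeasurable_const).enorm
  calc ∫⁻ x, ‖conv (kern δ) u x - u x‖ₑ ^ 2
      ≤ ∫⁻ x, ∫⁻ t, ‖u (x - t) - u x‖ₑ ^ 2 ∂P := by
        refine lintegral_mono fun x => ?_
        exact (pow_le_pow_left₀ (by simp) (hpt x) 2).trans
          (lintegral_sq_le_of_isProbabilityMeasure P ((hm x).mono_ac hPac))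
    _ = ∫⁻ t, (∫⁻ x, ‖u (x - t) - u x‖ₑ ^ 2) ∂P := by
        refine lintegral_lintegral_swap (μ := volume) (ν := P)
          (f := fun x t => ‖u (x - t) - u x‖ₑ ^ 2) ?_
        have h2 : (volume : Measure (Cn n)).prod P ≪ volume.prod volume :=
          (Measure.AbsolutelyContinuous.refl (volume : Measure (Cn n))).prod hPac
        exact ((hjoint.enorm.pow_const 2).mono_ac h2)
    _ ≤ ∫⁻ _, S ∂P := by
        refine lintegral_mono_ae (μ := P) ?_
        rw [ae_withDensity_iff hkm]
        refine ae_of_all _ fun t ht => hS t ?_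
        by_contra h
        apply ht
        rw [kern, mol_eq_zero hδ (not_lt.1 h)]
        simp
    _ = S := by simp

lemma tendsto_lintegral_translate {u : Cn n → ℂ} (hu : MemLp u 2) :
    Tendsto (fun t => ∫⁻ x, ‖u (x - t) - u x‖ₑ ^ 2) (𝓝 0) (𝓝 0) := by
  let g : Cn n → C(Cn n, Cn n) := fun t => ⟨fun x => x - t, by fun_prop⟩
  have hg : Continuous g := ContinuousMap.continuous_of_continuous_uncurry _ (by
    change Continuous fun p : Cn n × Cn n => p.2 - p.1
    fun_prop)
  have hgm : ∀ t, MeasurePreserving (g t) (volume : Measure (Cn n)) volume := fun t =>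
    measurePreserving_sub_right volume t
  have h1 : Continuous fun t => Lp.compMeasurePreserving (g t) (hgm t) (hu.toLp u) :=
    continuous_const.compMeasurePreservingLp hg hgm (by simp)
  have h2 : ∀ t, edist (Lp.compMeasurePreserving (g t) (hgm t) (hu.toLp u)) (hu.toLp u) ^ 2
      = ∫⁻ x, ‖u (x - t) - u x‖ₑ ^ 2 := by
    intro t
    rw [Lp.toLp_compMeasurePreserving, Lp.edist_toLp_toLp]
    have := eLpNorm_nnreal_pow_eq_lintegral (f := (u ∘ g t) - u) (μ := volume) (p := 2) (by simp)
    simpa [g] using this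
  have h3 : Lp.compMeasurePreserving (g 0) (hgm 0) (hu.toLp u) = hu.toLp u := by
    rw [Lp.toLp_compMeasurePreserving]
    congr 1
    ext x
    simp [g]
  have h4 := (h1.edist (continuous_const (y := hu.toLp u))).tendsto 0
  simp only [h3, edist_self] at h4
  have h5 := ((ENNReal.continuous_pow 2).tendsto 0).comp h4
  simpa [Function.comp_def, h2] using h5

lemma tendsto_lintegral_conv_kern {u : Cn n → ℂ} (hu : MemLp u 2) :
    Tendsto (fun δ => ∫⁻ x, ‖conv (kern δ) u x - u x‖ₑ ^ 2) (𝓝[>] 0) (𝓝 0) := by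
  rw [ENNReal.tendsto_nhds_zero]
  intro ε hε
  have h1 := (ENNReal.tendsto_nhds_zero.1 (tendsto_lintegral_translate hu)) ε hε
  obtain ⟨r, hr, h2⟩ := Metric.eventually_nhds_iff.1 h1
  filter_upwards [Ioo_mem_nhdsGT hr] with δ hδ
  refine lintegral_enorm_conv_sub_sq_le hδ.1 hu fun t ht => h2 ?_
  simpa using ht.trans hδ.2

lemma memLp_conv_kern_sub {δ : ℝ} (hδ : 0 < δ) {u : Cn n → ℂ} (hu : MemLp u 2) :
    MemLp (fun x => conv (kern δ) u x - u x) 2 := by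
  have hk := testFun_kern (n := n) hδ
  have hloc : LocallyIntegrable u := hu.locallyIntegrable (by norm_num)
  refine ⟨(hk.contDiff_conv hloc).continuous.aestronglyMeasurable.sub hu.1, ?_⟩
  have h1 : ∫⁻ x, ‖conv (kern δ) u x - u x‖ₑ ^ 2 < ⊤ := by
    refine (lintegral_enorm_conv_sub_sq_le hδ hu (S := (2 * eLpNorm u 2 volume) ^ 2)
      fun t _ => ?_).trans_lt (ENNReal.pow_lt_top (ENNReal.mul_lt_top (by simp) hu.2))
    have := eLpNorm_nnreal_pow_eq_lintegral (f := fun x => u (x - t) - u x) (μ := volume) (p := 2)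
      (by simp)
    simp only [NNReal.coe_ofNat, ENNReal.coe_ofNat, ENNReal.rpow_ofNat] at this
    rw [← this]
    gcongr
    have hm : MemLp (fun x => u (x - t)) 2 :=
      hu.comp_measurePreserving (measurePreserving_sub_right volume t)
    refine (eLpNorm_sub_le hm.1 hu.1 (by norm_num)).trans (le_of_eq ?_)
    rw [two_mul]
    congr 1
    exact eLpNorm_comp_measurePreserving hu.1 (measurePreserving_sub_right volume t)
  have := eLpNorm_nnreal_pow_eq_lintegral (f := fun x => conv (kern δ) u x - u x) (μ := volume)
    (p := 2) (by simp)
  simp only [NNReal.coe_ofNat, ENNReal.coe_ofNat, ENNReal.rpow_ofNat] at this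
  rw [← this] at h1
  simpa using h1

lemma sq_norm_integral_le {α : Type*} [MeasurableSpace α] {μ : Measure α} {h : α → ℂ} {P Q : α → ℝ}
    (hP : Integrable P μ) (hQ : Integrable Q μ) (hP0 : ∀ x, 0 ≤ P x) (hQ0 : ∀ x, 0 ≤ Q x)
    (hPQ : ∀ x, ‖h x‖ ^ 2 ≤ P x * Q x) :
    ‖∫ x, h x ∂μ‖ ^ 2 ≤ (∫ x, P x ∂μ) * ∫ x, Q x ∂μ := by
  set X := ‖∫ x, h x ∂μ‖
  set A := ∫ x, P x ∂μ
  set B := ∫ x, Q x ∂μ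
  have hA : 0 ≤ A := integral_nonneg hP0
  have hB : 0 ≤ B := integral_nonneg hQ0
  have hX : 0 ≤ X := norm_nonneg _
  have key : ∀ s : ℝ, 0 < s → 2 * X ≤ s * A + s⁻¹ * B := by
    intro s hs
    have h1 : X ≤ ∫ x, (s * P x + s⁻¹ * Q x) / 2 ∂μ := by
      refine norm_integral_le_of_norm_le (((hP.const_mul s).add (hQ.const_mul s⁻¹)).div_const 2)
        (ae_of_all _ fun x => ?_)
      refine abs_le_of_sq_le_sq' ?_ (by have := hP0 x; have := hQ0 x; positivity) |>.2
      refine (hPQ x).trans ?_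
      have h2 : s * P x * (s⁻¹ * Q x) = P x * Q x := by field_simp
      nlinarith [sq_nonneg (s * P x - s⁻¹ * Q x)]
    rw [integral_div, integral_add (hP.const_mul s) (hQ.const_mul s⁻¹), integral_const_mul,
      integral_const_mul] at h1
    linarith
  refine le_of_forall_pos_le_add fun ε hε => ?_
  rcases hX.eq_or_lt with h0 | h0
  · rw [← h0]
    nlinarith [mul_nonneg hA hB]
  set e := ε / (A + 1)
  have he : 0 < e := by positivity
  have h1 := key ((B + e) / X) (by positivity)
  have h2 : ((B + e) / X)⁻¹ * B ≤ X := by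
    rw [inv_div, div_mul_eq_mul_div, div_le_iff₀ (by positivity)]
    nlinarith
  have h3 : X ≤ (B + e) / X * A := by linarith
  have h4 : X ^ 2 ≤ (B + e) * A := by
    rw [div_mul_eq_mul_div, le_div_iff₀ h0] at h3
    nlinarith
  have h5 : e * A ≤ ε := by
    rw [div_mul_eq_mul_div, div_le_iff₀ (by positivity)]
    nlinarith
  nlinarith

lemma energy_pointwise {b χ : ℝ} (hb : 0 < b) (d g p v : ℂ) :
    1 / 2 * (b * χ ^ 2 * ‖d‖ ^ 2) - 5 * (b * ‖p‖ ^ 2 * ‖v‖ ^ 2) - 2 * (χ ^ 2 / b * ‖g‖ ^ 2)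
      ≤ ((b * d - g) * (2 * χ * p * conj v + χ ^ 2 * conj d)).re := by
  have h0 : (b * d - g) * (2 * χ * p * conj v + χ ^ 2 * conj d)
      = ((b * χ ^ 2 * ‖d‖ ^ 2 : ℝ) : ℂ) + 2 * b * χ * d * p * conj v - g * (2 * χ * p * conj v)
        - χ ^ 2 * g * conj d := by
    push_cast
    rw [← Complex.mul_conj']
    ring
  have h1 : -(2 * b * |χ| * ‖d‖ * ‖p‖ * ‖v‖) ≤ (2 * b * χ * d * p * conj v : ℂ).re := by
    refine (neg_le_neg ?_).trans (neg_abs_le _)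
    refine (abs_re_le_norm _).trans (le_of_eq ?_)
    simp [abs_of_pos hb]
  have h2 : (g * (2 * χ * p * conj v) : ℂ).re ≤ 2 * |χ| * ‖g‖ * ‖p‖ * ‖v‖ := by
    refine (re_le_norm _).trans (le_of_eq ?_)
    simp
    ring
  have h3 : (χ ^ 2 * g * conj d : ℂ).re ≤ |χ| ^ 2 * ‖g‖ * ‖d‖ := by
    refine (re_le_norm _).trans (le_of_eq ?_)
    simp
  rw [h0, sub_re, sub_re, add_re, ofReal_re]
  rw [← sq_abs χ]
  set x := |χ| * ‖d‖
  set y := ‖p‖ * ‖v‖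
  set c := |χ| * ‖g‖
  have e1 : 2 * (b * x * y) ≤ 1 / 4 * (b * x ^ 2) + 4 * (b * y ^ 2) := by
    nlinarith [mul_nonneg hb.le (sq_nonneg (x / 2 - 2 * y))]
  have e2 : x * c ≤ 1 / 4 * (b * x ^ 2) + c ^ 2 / b := by
    have : c ^ 2 / b = b * (c / b) ^ 2 := by field_simp
    have h4 : x * c = b * (x * (c / b)) := by field_simp
    rw [this, h4]
    nlinarith [mul_nonneg hb.le (sq_nonneg (x / 2 - c / b))]
  have e3 : 2 * (c * y) ≤ c ^ 2 / b + b * y ^ 2 := by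
    have : c ^ 2 / b = b * (c / b) ^ 2 := by field_simp
    have h4 : c * y = b * (y * (c / b)) := by field_simp
    rw [this, h4]
    nlinarith [mul_nonneg hb.le (sq_nonneg (y - c / b))]
  have t1 : b * |χ| ^ 2 * ‖d‖ ^ 2 = b * x ^ 2 := by ring
  have t2 : b * ‖p‖ ^ 2 * ‖v‖ ^ 2 = b * y ^ 2 := by ring
  have t3 : |χ| ^ 2 / b * ‖g‖ ^ 2 = c ^ 2 / b := by ring
  have t4 : 2 * b * |χ| * ‖d‖ * ‖p‖ * ‖v‖ = 2 * (b * x * y) := by ring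
  have t5 : 2 * |χ| * ‖g‖ * ‖p‖ * ‖v‖ = 2 * (c * y) := by ring
  have t6 : |χ| ^ 2 * ‖g‖ * ‖d‖ = x * c := by ring
  rw [t1, t2, t3]
  rw [t4] at h1
  rw [t5] at h2
  rw [t6] at h3
  linarith

section Energy

variable {D : Set (Cn n)} {b χ : Cn n → ℝ}

lemma energy_ineq (hb : ∀ z ∈ D, ContDiffAt ℝ ∞ b z) (hb0 : ∀ z ∈ D, 0 < b z)
    (hχ : TestFun D fun x => (χ x : ℂ)) {v : Cn n → ℂ} {H g : Fin n → Cn n → ℂ}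
    (hv : ∀ z ∈ D, ContDiffAt ℝ ∞ v z) (hH : ∀ j, ∀ z ∈ D, ContDiffAt ℝ ∞ (H j) z)
    (hg : ∀ j, ∀ z ∈ D, ContDiffAt ℝ ∞ (g j) z)
    (hHg : ∀ j, ∀ z ∈ D, b z * dbar j v z = H j z + g j z)
    (hdiv : ∀ z ∈ tsupport fun x => (χ x : ℂ), ∑ j, del j (H j) z = 0) :
    ∫ z, ∑ j, b z * ‖χ z * dbar j v z‖ ^ 2
      ≤ 10 * (∫ z, ∑ j, b z * ‖del j (fun x => (χ x : ℂ)) z * v z‖ ^ 2)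
        + 4 * ∫ z, ∑ j, (b z)⁻¹ * ‖χ z * g j z‖ ^ 2 := by
  set ψ : Cn n → ℂ := fun z => χ z * (χ z * conj (v z)) with hψdef
  have hvc : ∀ z ∈ D, ContDiffAt ℝ ∞ (fun x => conj (v x)) z := fun z hz =>
    conjCLE.contDiff.contDiffAt.comp z (hv z hz)
  have hχv : TestFun D fun z => χ z * conj (v z) := hχ.mul_right hvc
  have hψ : TestFun D ψ := hχ.mul hχv
  have h1 : ∀ j, ∫ z, H j z * del j ψ z = -∫ z, del j (H j) z * ψ z := fun j =>
    hψ.integral_mul_wirt (hH j) _ j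
  have hi1 : ∀ j, Integrable fun z => H j z * del j ψ z := fun j =>
    ((hψ.wirt _ j).mul_left (hH j)).integrable
  have hi2 : ∀ j, Integrable fun z => del j (H j) z * ψ z := fun j =>
    (hψ.mul_left fun z hz => contDiffAt_wirt (hH j z hz)).integrable
  have h2 : ∫ z, ∑ j, H j z * del j ψ z = 0 := by
    rw [integral_finsetSum _ fun j _ => hi1 j]
    simp only [h1]
    rw [Finset.sum_neg_distrib, ← integral_finsetSum _ fun j _ => hi2 j, neg_eq_zero]
    refine integral_eq_zero_of_ae (ae_of_all _ fun z => ?_)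
    simp only [← Finset.sum_mul, Pi.zero_apply]
    by_cases hz : z ∈ tsupport fun x => (χ x : ℂ)
    · rw [hdiv z hz, zero_mul]
    · have := image_eq_zero_of_notMem_tsupport hz
      simp [hψdef, show (χ z : ℂ) = 0 from this]
  have hdelψ : ∀ j, ∀ z ∈ D, del j ψ z
      = 2 * χ z * del j (fun x => (χ x : ℂ)) z * conj (v z) + χ z ^ 2 * conj (dbar j v z) := by
    intro j z hz
    have d1 := hχ.differentiable z
    have d2 := (hvc z hz).differentiableAt (n := ∞) (by simp)
    rw [hψdef, wirt_mul d1 (d1.fun_mul d2), wirt_mul d1 d2, del_conj]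
    ring
  have hA : ∀ j, Integrable fun z => b z * ‖χ z * dbar j v z‖ ^ 2 := fun j =>
    (hχ.mul_right fun z hz => contDiffAt_wirt (hv z hz)).integrable_mul_norm_sq hb
  have hB : ∀ j, Integrable fun z => b z * ‖del j (fun x => (χ x : ℂ)) z * v z‖ ^ 2 := fun j =>
    ((hχ.wirt _ j).mul_right hv).integrable_mul_norm_sq hb
  have hC : ∀ j, Integrable fun z => (b z)⁻¹ * ‖χ z * g j z‖ ^ 2 := fun j =>
    (hχ.mul_right (hg j)).integrable_mul_norm_sq fun z hz => (hb z hz).inv (hb0 z hz).ne'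
  have h3 : ∫ z, ((∑ j, 1 / 2 * (b z * ‖χ z * dbar j v z‖ ^ 2))
      - (∑ j, 5 * (b z * ‖del j (fun x => (χ x : ℂ)) z * v z‖ ^ 2))
      - ∑ j, 2 * ((b z)⁻¹ * ‖χ z * g j z‖ ^ 2)) ≤ ∫ z, (∑ j, H j z * del j ψ z).re := by
    refine integral_mono (((integrable_finsetSum _ fun j _ => (hA j).const_mul _).sub
      (integrable_finsetSum _ fun j _ => (hB j).const_mul _)).sub
        (integrable_finsetSum _ fun j _ => (hC j).const_mul _))
      (integrable_finsetSum _ fun j _ => hi1 j).re fun z => ?_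
    simp only [re_sum]
    rw [← Finset.sum_sub_distrib, ← Finset.sum_sub_distrib]
    refine Finset.sum_le_sum fun j _ => ?_
    by_cases hz : z ∈ D
    · have h4 := energy_pointwise (hb0 z hz) (χ := χ z) (dbar j v z) (g j z)
        (del j (fun x => (χ x : ℂ)) z) (v z)
      rw [hHg j z hz, add_sub_cancel_right, ← hdelψ j z hz] at h4
      refine le_trans (le_of_eq ?_) h4
      simp only [norm_mul, norm_real, Real.norm_eq_abs, mul_pow, sq_abs]
      ring
    · have e1 : χ z = 0 := by
        have := image_eq_zero_of_notMem_tsupport fun h => hz (hχ.subset h)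
        simpa using this
      have e2 : del j (fun x => (χ x : ℂ)) z = 0 :=
        image_eq_zero_of_notMem_tsupport fun h => hz ((hχ.wirt _ j).subset h)
      have e3 : del j ψ z = 0 :=
        image_eq_zero_of_notMem_tsupport fun h => hz ((hψ.wirt _ j).subset h)
      simp [e1, e2, e3]
  have h4 : ∫ z, (∑ j, H j z * del j ψ z).re = 0 := by
    have := integral_re (integrable_finsetSum Finset.univ fun j _ => hi1 j)
    simp only [RCLike.re_to_complex] at this
    rw [this, h2, zero_re]
  rw [h4, integral_sub, integral_sub] at h3
  · simp only [← Finset.mul_sum] at h3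
    rw [integral_const_mul, integral_const_mul, integral_const_mul] at h3
    simp only [← Finset.mul_sum]
    linarith
  · exact integrable_finsetSum _ fun j _ => (hA j).const_mul _
  · exact integrable_finsetSum _ fun j _ => (hB j).const_mul _
  · exact (integrable_finsetSum _ fun j _ => (hA j).const_mul _).sub
      (integrable_finsetSum _ fun j _ => (hB j).const_mul _)
  · exact integrable_finsetSum _ fun j _ => (hC j).const_mul _

end Energy

lemma tendsto_integral_conv_kern {u : Cn n → ℂ} (hu : MemLp u 2) :
    Tendsto (fun δ => ∫ x, ‖conv (kern δ) u x - u x‖ ^ 2) (𝓝[>] 0) (𝓝 0) := by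
  have h := (ENNReal.tendsto_toReal ENNReal.zero_ne_top).comp (tendsto_lintegral_conv_kern hu)
  refine h.congr' ?_
  filter_upwards [self_mem_nhdsWithin] with δ hδ
  have hm := memLp_conv_kern_sub hδ hu
  have hm2 : AEStronglyMeasurable (fun x => ‖conv (kern δ) u x - u x‖ ^ 2) volume := hm.1.norm.pow 2
  rw [integral_eq_lintegral_of_nonneg_ae (ae_of_all _ fun x => by positivity) hm2]
  simp [ENNReal.ofReal_pow, ofReal_norm]

lemma memLp_indicator_mul {K : Set (Cn n)} (hK : IsCompact K) {u g : Cn n → ℂ}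
    (hu : MemLp (K.indicator u) 2) (hg : ContinuousOn g K) :
    MemLp (K.indicator fun x => g x * u x) 2 := by
  obtain ⟨M, hM⟩ := hK.exists_bound_of_continuousOn hg
  have h1 : (K.indicator fun x => g x * u x) = fun x => K.indicator g x * K.indicator u x := by
    ext x
    by_cases hx : x ∈ K <;> simp [hx]
  have h2 : AEStronglyMeasurable (K.indicator g) volume :=
    (aestronglyMeasurable_indicator_iff hK.measurableSet).2
      (hg.aestronglyMeasurable hK.measurableSet)
  rw [h1]
  refine hu.of_le_mul (c := M) (h2.mul hu.1) (ae_of_all _ fun x => ?_)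
  rw [norm_mul]
  by_cases hx : x ∈ K
  · simp only [hx, indicator_of_mem]
    exact mul_le_mul_of_nonneg_right (hM x hx) (norm_nonneg _)
  · simp [hx]

/-- `u` is a distributional solution of `∑ ∂̄ⱼ*(b ∂ⱼ) u = 0` on `D`. -/
structure WeakSol (D : Set (Cn n)) (b : Cn n → ℝ) (u : Cn n → ℂ) : Prop where
  memLp : ∀ K ⊆ D, IsCompact K → MemLp (K.indicator u) 2
  weak : ∀ η, TestFun D η → ∫ z, u z * ∑ j, dbar j (fun x => b x * del j η x) z = 0

lemma wirt_comp_sub_left {s : ℂ} {j : Fin n} {f : Cn n → ℂ} (hf : Differentiable ℝ f) (x y : Cn n) :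
    wirt s j (fun y => f (x - y)) y = -wirt s j f (x - y) := by
  have h := ((hf (x - y)).hasFDerivAt.comp y ((hasFDerivAt_id y).const_sub x)).fderiv
  change fderiv ℝ (fun y => f (x - y)) y = _ at h
  simp only [wirt, h]
  simp
  ring

section Regularity

variable {D K : Set (Cn n)} {b : Cn n → ℝ} {u : Cn n → ℂ}

lemma WeakSol.sum_del_conv (hu : WeakSol D b u) (hb : ∀ z ∈ D, ContDiffAt ℝ ∞ b z)
    (hKD : K ⊆ D) (hK : IsCompact K) {δ : ℝ} (hδ : 0 < δ) {x : Cn n} (hx : closedBall x δ ⊆ K) :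
    ∑ j, del j (fun y => dbar j (conv (kern δ) (K.indicator fun x => b x * u x)) y
      - conv (kern δ) (K.indicator fun x => dbar j (fun x => (b x : ℂ)) x * u x) y) x = 0 := by
  have hk := testFun_kern (n := n) hδ
  have hbc : ∀ z ∈ D, ContDiffAt ℝ ∞ (fun x => (b x : ℂ)) z := fun z hz => (ContDiffAt.ofReal' (hb z hz))
  have hf : MemLp (K.indicator fun x => b x * u x) 2 :=
    memLp_indicator_mul hK (hu.memLp K hKD hK) fun z hz =>
      (hbc z (hKD hz)).continuousAt.continuousWithinAt
  have hF : ∀ j, MemLp (K.indicator fun x => dbar j (fun x => (b x : ℂ)) x * u x) 2 := fun j =>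
    memLp_indicator_mul hK (hu.memLp K hKD hK) fun z hz =>
      (contDiffAt_wirt (hbc z (hKD hz))).continuousAt.continuousWithinAt
  have hf' : LocallyIntegrable (K.indicator fun x => b x * u x) :=
    hf.locallyIntegrable (by norm_num)
  have hF' : ∀ j, LocallyIntegrable (K.indicator fun x => dbar j (fun x => (b x : ℂ)) x * u x) :=
    fun j => (hF j).locallyIntegrable (by norm_num)
  set f := K.indicator fun x => b x * u x with hfdef
  set F : Fin n → Cn n → ℂ := fun j => K.indicator fun x => dbar j (fun x => (b x : ℂ)) x * u x
    with hFdef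
  have hk1 : ∀ s j, TestFun (closedBall 0 δ) (wirt s j (kern δ)) := fun s j => hk.wirt s j
  have hk2 : ∀ s j t k, TestFun (closedBall 0 δ) (wirt t k (wirt s j (kern δ))) :=
    fun s j t k => (hk1 s j).wirt t k
  set η : Cn n → ℂ := fun y => kern δ (x - y) with hη
  have hηs : tsupport η ⊆ closedBall x δ := by
    refine closure_minimal (fun y hy => ?_) isClosed_closedBall
    have := hk.subset (subset_tsupport _ hy)
    simpa [dist_eq_norm, norm_sub_rev] using this
  have hηt : TestFun D η := by
    exact ⟨hk.smooth.comp (contDiff_const.sub contDiff_id),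
      HasCompactSupport.of_support_subset_isCompact (isCompact_closedBall x δ)
        ((subset_tsupport _).trans hηs), hηs.trans (hx.trans hKD)⟩
  have hη1 : ∀ j, del j η = fun y => -del j (kern δ) (x - y) := fun j =>
    funext fun y => wirt_comp_sub_left hk.differentiable x y
  have hη2 : ∀ j y, dbar j (del j η) y = dbar j (del j (kern δ)) (x - y) := by
    intro j y
    have h1 : del j η = fun y => (fun z => -1 * del j (kern δ) z) (x - y) := by
      rw [hη1]; ext y; ring
    have h2 := ((hk1 (-I) j).const_mul (-1)).differentiable
    rw [h1, wirt_comp_sub_left h2, wirt_const_mul _ ((hk1 (-I) j).differentiable _)]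
    ring
  have h3 : ∀ j, del j (fun y => dbar j (conv (kern δ) f) y - conv (kern δ) (F j) y) x
      = ∫ y, (dbar j (del j η) y * f y + del j η y * F j y) := by
    intro j
    have e1 : dbar j (conv (kern δ) f) = conv (dbar j (kern δ)) f :=
      funext fun y => hk.wirt_conv hf' _ _ y
    rw [wirt_sub, e1, (hk1 I j).wirt_conv hf', hk.wirt_conv (hF' j), conv_swap, conv_swap,
      ← integral_sub ((hk2 _ _ _ _).integrable_conv_swap hf' x)
        ((hk1 _ _).integrable_conv_swap (hF' j) x)]
    · refine integral_congr_ae (ae_of_all _ fun y => ?_)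
      change _ = dbar j (del j η) y * f y + del j η y * F j y
      rw [hη2, congrFun (hη1 j) y, wirt_comm hk.smooth.contDiffAt]
      ring
    · rw [e1]
      exact ((hk1 I j).contDiff_conv hf').differentiable (by simp) x
    · exact (hk.contDiff_conv (hF' j)).differentiable (by simp) x
  have hi : ∀ j, Integrable fun y => dbar j (del j η) y * f y + del j η y * F j y := by
    intro j
    simp only [hη2]
    refine ((hk2 _ _ _ _).integrable_conv_swap hf' x).add ?_
    simpa [hη1] using ((hk1 _ _).integrable_conv_swap (hF' j) x).neg
  rw [Finset.sum_congr rfl fun j _ => h3 j, ← integral_finsetSum _ fun j _ => hi j, ← hu.weak η hηt]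
  refine integral_congr_ae (ae_of_all _ fun y => ?_)
  simp only [Finset.mul_sum]
  refine Finset.sum_congr rfl fun j _ => ?_
  by_cases hy : y ∈ K
  · rw [wirt_mul ((hbc y (hKD hy)).differentiableAt (by simp)) ((hηt.wirt _ j).differentiable y)]
    simp only [hfdef, hFdef, hy, indicator_of_mem]
    ring
  · have hy2 : η =ᶠ[𝓝 y] fun _ => 0 :=
      notMem_tsupport_iff_eventuallyEq.1 fun h => hy (hx (hηs h))
    have hy3 : (fun x => (b x : ℂ) * del j η x) =ᶠ[𝓝 y] fun _ => 0 := by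
      filter_upwards [wirt_eventuallyEq (s := -I) (j := j) hy2] with z hz
      rw [hz]
      simp
    rw [wirt_congr hy3]
    simp [hfdef, hFdef, hy]

end Regularity

section Regularity

variable {D K : Set (Cn n)} {b χ : Cn n → ℝ} {u θ : Cn n → ℂ}

lemma integrable_mul_norm_sq_of_memLp_indicator (hK : IsCompact K) (hu : MemLp (K.indicator u) 2)
    {g : Cn n → ℝ} {φ : Cn n → ℂ} (hg : ContinuousOn g K) (hg0 : ∀ z ∈ K, 0 ≤ g z)
    (hφ : ContinuousOn φ K) (hφ0 : ∀ z ∉ K, φ z = 0) :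
    Integrable fun z => g z * ‖φ z * u z‖ ^ 2 := by
  have h1 : ContinuousOn (fun z => (√(g z) : ℂ) * φ z) K :=
    (continuous_ofReal.comp_continuousOn hg.sqrt).mul hφ
  refine (memLp_indicator_mul hK hu h1).integrable_norm_pow (by norm_num) |>.congr
    (ae_of_all _ fun z => ?_)
  by_cases hz : z ∈ K
  · simp only [hz, indicator_of_mem, norm_mul, mul_pow, norm_real, Real.norm_eq_abs, sq_abs,
      Real.sq_sqrt (hg0 z hz)]
    ring
  · simp [hz, hφ0 z hz]

lemma regularity_pointwise {b χ m : ℝ} (hb : 0 < b) {f w u : ℂ} {p d F Φ : Fin n → ℂ}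
    (hf : f = b * u) (hF : ∀ j, F j = d j * u)
    (hm : m = (∑ j, 2 * b⁻¹ * ‖p j‖ ^ 2) + 2 * b⁻¹ * χ ^ 2
      + ∑ j, 2 * b⁻¹ * χ ^ 2 * (‖d j‖ ^ 2 * (b⁻¹) ^ 2)) :
    10 * (∑ j, b * ‖p j * (w / b)‖ ^ 2) + 4 * ∑ j, b⁻¹ * ‖χ * (Φ j - w / b * d j)‖ ^ 2
      ≤ 20 * (∑ j, b * ‖p j * u‖ ^ 2) + 14 * m * (‖w - f‖ ^ 2 + ∑ j, ‖Φ j - F j‖ ^ 2) := by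
  have hbc : (b : ℂ) ≠ 0 := by exact_mod_cast hb.ne'
  have hsq : ∀ a c : ℂ, ‖a + c‖ ^ 2 ≤ 2 * ‖a‖ ^ 2 + 2 * ‖c‖ ^ 2 := fun a c => by
    have := norm_add_le a c
    nlinarith [sq_nonneg (‖a‖ - ‖c‖), norm_nonneg (a + c)]
  have h1 : ∀ j, b * ‖p j * (w / b)‖ ^ 2
      ≤ 2 * (b * ‖p j * u‖ ^ 2) + 2 * b⁻¹ * ‖p j‖ ^ 2 * ‖w - f‖ ^ 2 := by
    intro j
    have e : p j * (w / b) = p j * u + p j * ((w - f) / b) := by rw [hf]; field_simp; ring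
    have h2 := hsq (p j * u) (p j * ((w - f) / b))
    have h3 : b * (2 * ‖p j * ((w - f) / b)‖ ^ 2) = 2 * b⁻¹ * ‖p j‖ ^ 2 * ‖w - f‖ ^ 2 := by
      rw [norm_mul, norm_div, norm_real, Real.norm_of_nonneg hb.le]
      field_simp
    rw [e]
    nlinarith
  have h2 : ∀ j, b⁻¹ * ‖χ * (Φ j - w / b * d j)‖ ^ 2 ≤ 2 * b⁻¹ * χ ^ 2 * ‖Φ j - F j‖ ^ 2
      + 2 * b⁻¹ * χ ^ 2 * (‖d j‖ ^ 2 * (b⁻¹) ^ 2) * ‖w - f‖ ^ 2 := by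
    intro j
    have e : χ * (Φ j - w / b * d j) = χ * (Φ j - F j) + -(χ * ((w - f) / b * d j)) := by
      rw [hf, hF]; field_simp; ring
    have h2 := hsq (χ * (Φ j - F j)) (-(χ * ((w - f) / b * d j)))
    have h3 : ‖-(χ * ((w - f) / b * d j))‖ ^ 2
        = χ ^ 2 * (‖d j‖ ^ 2 * (b⁻¹) ^ 2) * ‖w - f‖ ^ 2 := by
      rw [norm_neg, norm_mul, norm_mul, norm_div, norm_real, norm_real,
        Real.norm_of_nonneg hb.le, mul_pow, Real.norm_eq_abs, sq_abs]
      field_simp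
    have h4 : ‖χ * (Φ j - F j)‖ ^ 2 = χ ^ 2 * ‖Φ j - F j‖ ^ 2 := by
      rw [norm_mul, norm_real, mul_pow, Real.norm_eq_abs, sq_abs]
    rw [e]
    rw [h3, h4] at h2
    have := mul_le_mul_of_nonneg_left h2 (inv_pos.2 hb).le
    linarith
  have s1 := Finset.sum_le_sum fun j (_ : j ∈ Finset.univ) => h1 j
  have s2 := Finset.sum_le_sum fun j (_ : j ∈ Finset.univ) => h2 j
  rw [Finset.sum_add_distrib, ← Finset.mul_sum (f := fun j => b * ‖p j * u‖ ^ 2),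
    ← Finset.sum_mul] at s1
  rw [Finset.sum_add_distrib, ← Finset.mul_sum (f := fun j => ‖Φ j - F j‖ ^ 2),
    ← Finset.sum_mul] at s2
  set m1 := ∑ j, 2 * b⁻¹ * ‖p j‖ ^ 2
  set m2 := 2 * b⁻¹ * χ ^ 2
  set m3 := ∑ j, m2 * (‖d j‖ ^ 2 * (b⁻¹) ^ 2)
  have n1 : 0 ≤ m1 := Finset.sum_nonneg fun j _ => by positivity
  have n2 : 0 ≤ m2 := by positivity
  have n3 : 0 ≤ m3 := Finset.sum_nonneg fun j _ => by positivity
  have n4 : 0 ≤ ∑ j, ‖Φ j - F j‖ ^ 2 := Finset.sum_nonneg fun j _ => by positivity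
  have n5 : 0 ≤ ‖w - f‖ ^ 2 := by positivity
  rw [hm]
  nlinarith [mul_nonneg n1 n4, mul_nonneg n1 n5, mul_nonneg n2 n4, mul_nonneg n2 n5,
    mul_nonneg n3 n4, mul_nonneg n3 n5]

lemma WeakSol.norm_integral_dbar_sq_le (hD : IsOpen D) (hu : WeakSol D b u)
    (hb : ∀ z ∈ D, ContDiffAt ℝ ∞ b z) (hb0 : ∀ z ∈ D, 0 < b z)
    (hχ : TestFun D fun x => (χ x : ℂ)) (hθ : TestFun D θ) (hχθ : ∀ x ∈ tsupport θ, χ x = 1)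
    (j : Fin n) :
    ‖∫ z, u z * dbar j θ z‖ ^ 2
      ≤ (20 * ∫ z, ∑ k, b z * ‖del k (fun x => (χ x : ℂ)) z * u z‖ ^ 2)
        * ∫ z, (b z)⁻¹ * ‖θ z‖ ^ 2 := by
  set S := tsupport fun x => (χ x : ℂ) with hS
  obtain ⟨r, hr, hrD⟩ := hχ.compact.exists_cthickening_subset_open hD hχ.subset
  set K := cthickening r S with hKdef
  have hK : IsCompact K := hχ.compact.cthickening
  have hSK : S ⊆ K := self_subset_cthickening S
  have hθS : tsupport θ ⊆ S := fun x hx => subset_tsupport _ (by simp [hχθ x hx])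
  have hbc : ∀ z ∈ D, ContDiffAt ℝ ∞ (fun x => (b x : ℂ)) z := fun z hz =>
    ContDiffAt.ofReal' (hb z hz)
  have hbK : ContinuousOn b K := fun z hz => (hb z (hrD hz)).continuousAt.continuousWithinAt
  have hdbK : ∀ j, ContinuousOn (dbar j fun x => (b x : ℂ)) K := fun j z hz =>
    (contDiffAt_wirt (hbc z (hrD hz))).continuousAt.continuousWithinAt
  have huK := hu.memLp K hrD hK
  set f := K.indicator fun x => b x * u x with hfdef
  set F : Fin n → Cn n → ℂ := fun j => K.indicator fun x => dbar j (fun x => (b x : ℂ)) x * u x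
    with hFdef
  have hf : MemLp f 2 := memLp_indicator_mul hK huK (continuous_ofReal.comp_continuousOn hbK)
  have hF : ∀ j, MemLp (F j) 2 := fun j => memLp_indicator_mul hK huK (hdbK j)
  have hf' : LocallyIntegrable f := hf.locallyIntegrable (by norm_num)
  have hF' : ∀ j, LocallyIntegrable (F j) := fun j => (hF j).locallyIntegrable (by norm_num)
  set p : Fin n → Cn n → ℂ := fun k => del k fun x => (χ x : ℂ) with hp
  set d : Fin n → Cn n → ℂ := fun k => dbar k fun x => (b x : ℂ) with hd
  set m : Cn n → ℝ := fun z => (∑ j, 2 * (b z)⁻¹ * ‖p j z‖ ^ 2) + 2 * (b z)⁻¹ * χ z ^ 2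
      + ∑ j, 2 * (b z)⁻¹ * χ z ^ 2 * (‖d j z‖ ^ 2 * ((b z)⁻¹) ^ 2) with hm
  have hpt : ∀ k, TestFun D (p k) := fun k => hχ.wirt _ k
  have hχc : Continuous χ := by
    have := Complex.continuous_re.comp hχ.continuous
    exact this
  have hmK : ContinuousOn m K := by
    have hb' : ContinuousOn (fun z => (b z)⁻¹) K := hbK.inv₀ fun z hz => (hb0 z (hrD hz)).ne'
    have hp' : ∀ k, Continuous (p k) := fun k => (hpt k).continuous
    refine ((continuousOn_finsetSum _ fun k _ => ?_).add ?_).add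
      (continuousOn_finsetSum _ fun k _ => ?_)
    · exact (continuousOn_const.mul hb').mul ((hp' k).norm.pow 2).continuousOn
    · exact (continuousOn_const.mul hb').mul (hχc.pow 2).continuousOn
    · exact ((continuousOn_const.mul hb').mul (hχc.pow 2).continuousOn).mul
        (((hdbK k).norm.pow 2).mul (hb'.pow 2))
  obtain ⟨M, hM0, hM⟩ : ∃ M, 0 ≤ M ∧ ∀ z ∈ K, ‖m z‖ ≤ M := by
    obtain ⟨M, hM⟩ := hK.exists_bound_of_continuousOn hmK
    exact ⟨max M 0, le_max_right _ _, fun z hz => (hM z hz).trans (le_max_left _ _)⟩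
  have hS0 : ∀ z ∉ S, χ z = 0 ∧ ∀ k, p k z = 0 := fun z hz => by
    have hz1 := notMem_tsupport_iff_eventuallyEq.1 hz
    refine ⟨by simpa using hz1.self_of_nhds, fun k => ?_⟩
    have := (wirt_eventuallyEq (s := -I) (j := k) hz1).self_of_nhds
    rw [hp]
    simp only
    rw [this]
    exact wirt_const
  set A := ∫ z, ∑ k, b z * ‖p k z * u z‖ ^ 2 with hA
  have hAi : Integrable fun z => ∑ k, b z * ‖p k z * u z‖ ^ 2 :=
    integrable_finsetSum _ fun k _ => integrable_mul_norm_sq_of_memLp_indicator hK huK hbK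
      (fun z hz => (hb0 z (hrD hz)).le) (hpt k).continuous.continuousOn
      fun z hz => (hS0 z fun h => hz (hSK h)).2 k
  set B := ∫ z, (b z)⁻¹ * ‖θ z‖ ^ 2 with hB
  have hbinv : ∀ z ∈ D, ContDiffAt ℝ ∞ (fun z => (b z)⁻¹) z := fun z hz =>
    (hb z hz).inv (hb0 z hz).ne'
  have hBi : Integrable fun z => (b z)⁻¹ * ‖θ z‖ ^ 2 := hθ.integrable_mul_norm_sq hbinv
  set e : ℝ → ℝ := fun δ => (∫ z, ‖conv (kern δ) f z - f z‖ ^ 2)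
    + ∑ k, ∫ z, ‖conv (kern δ) (F k) z - F k z‖ ^ 2 with he
  have he0 : Tendsto e (𝓝[>] 0) (𝓝 0) := by
    have := (tendsto_integral_conv_kern hf).add
      (tendsto_finsetSum Finset.univ fun k _ => tendsto_integral_conv_kern (hF k))
    simpa using this
  set v : ℝ → Cn n → ℂ := fun δ z => conv (kern δ) f z / b z with hv
  have hθd : TestFun D (dbar j θ) := hθ.wirt _ j
  have key : ∀ δ ∈ Ioo 0 r, ‖∫ z, v δ z * dbar j θ z‖ ^ 2 ≤ (20 * A + 14 * M * e δ) * B := by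
    intro δ hδ
    have hk := testFun_kern (n := n) hδ.1
    set w := conv (kern δ) f with hw
    have hwc : ContDiff ℝ ∞ w := hk.contDiff_conv hf'
    have hΦc : ∀ k, ContDiff ℝ ∞ (conv (kern δ) (F k)) := fun k => hk.contDiff_conv (hF' k)
    have hvc : ∀ z ∈ D, ContDiffAt ℝ ∞ (v δ) z := fun z hz =>
      hwc.contDiffAt.mul ((hbc z hz).inv (by exact_mod_cast (hb0 z hz).ne'))
    have hwf : Integrable fun z => ‖w z - f z‖ ^ 2 :=
      (memLp_conv_kern_sub hδ.1 hf).integrable_norm_pow (by norm_num)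
    have hΦF : ∀ k, Integrable fun z => ‖conv (kern δ) (F k) z - F k z‖ ^ 2 := fun k =>
      (memLp_conv_kern_sub hδ.1 (hF k)).integrable_norm_pow (by norm_num)
    set g : Fin n → Cn n → ℂ := fun k z => conv (kern δ) (F k) z - v δ z * d k z with hg
    have hgc : ∀ k, ∀ z ∈ D, ContDiffAt ℝ ∞ (g k) z := fun k z hz =>
      (hΦc k).contDiffAt.sub ((hvc z hz).mul (contDiffAt_wirt (hbc z hz)))
    have E1 := energy_ineq (H := fun k z => dbar k w z - conv (kern δ) (F k) z) (g := g)
      hb hb0 hχ hvc (fun k z _ => (contDiffAt_wirt hwc.contDiffAt).sub (hΦc k).contDiffAt) hgc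
      (fun k z hz => by
        have hbz : (b z : ℂ) ≠ 0 := by exact_mod_cast (hb0 z hz).ne'
        have e1 : w =ᶠ[𝓝 z] fun x => b x * v δ x := by
          filter_upwards [hD.mem_nhds hz] with x hx
          have : (b x : ℂ) ≠ 0 := by exact_mod_cast (hb0 x hx).ne'
          simp only [hv, hw]
          field_simp
        have e2 : dbar k w z = d k z * v δ z + b z * dbar k (v δ) z := by
          rw [wirt_congr e1, wirt_mul ((hbc z hz).differentiableAt (by simp))
            ((hvc z hz).differentiableAt (by simp))]
        simp only [hg, e2]
        ring)
      (fun z hz => hu.sum_del_conv hb hrD hK hδ.1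
        ((closedBall_subset_closedBall hδ.2.le).trans (closedBall_subset_cthickening hz r)))
    have hP1 : ∀ k, Integrable fun z => b z * ‖p k z * v δ z‖ ^ 2 := fun k =>
      ((hpt k).mul_right hvc).integrable_mul_norm_sq hb
    have hP2 : ∀ k, Integrable fun z => (b z)⁻¹ * ‖χ z * g k z‖ ^ 2 := fun k =>
      (hχ.mul_right (hgc k)).integrable_mul_norm_sq hbinv
    have hP0 : ∀ k, Integrable fun z => b z * ‖χ z * dbar k (v δ) z‖ ^ 2 := fun k =>
      (hχ.mul_right fun z hz => contDiffAt_wirt (hvc z hz)).integrable_mul_norm_sq hb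
    have hei : Integrable fun z => ‖w z - f z‖ ^ 2
        + ∑ k, ‖conv (kern δ) (F k) z - F k z‖ ^ 2 :=
      hwf.add (integrable_finsetSum _ fun k _ => hΦF k)
    have E2 : 10 * (∫ z, ∑ k, b z * ‖p k z * v δ z‖ ^ 2)
        + 4 * (∫ z, ∑ k, (b z)⁻¹ * ‖χ z * g k z‖ ^ 2) ≤ 20 * A + 14 * M * e δ := by
      simp only [he, hA]
      rw [← integral_finsetSum _ fun k _ => hΦF k,
        ← integral_add hwf (integrable_finsetSum _ fun k _ => hΦF k), ← integral_const_mul,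
        ← integral_const_mul, ← integral_const_mul, ← integral_const_mul,
        ← integral_add ((integrable_finsetSum _ fun k _ => hP1 k).const_mul _)
          ((integrable_finsetSum _ fun k _ => hP2 k).const_mul _),
        ← integral_add (hAi.const_mul _)
          (hei.const_mul _)]
      refine integral_mono (((integrable_finsetSum _ fun k _ => hP1 k).const_mul _).add
        ((integrable_finsetSum _ fun k _ => hP2 k).const_mul _)) ((hAi.const_mul _).add (hei.const_mul _)) fun z => ?_
      by_cases hz : z ∈ S
      · have hzK := hSK hz
        refine (regularity_pointwise (hb0 z (hrD hzK)) (χ := χ z) (m := m z) (f := f z) (w := w z)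
          (u := u z) (p := fun k => p k z) (d := fun k => d k z) (F := fun k => F k z)
          (Φ := fun k => conv (kern δ) (F k) z) (by simp [hfdef, hzK])
          (fun k => by simp [hFdef, hzK, hd]) rfl).trans ?_
        have hMz : m z ≤ M := (le_abs_self _).trans (hM z hzK)
        have n1 : 0 ≤ ‖w z - f z‖ ^ 2 + ∑ k, ‖conv (kern δ) (F k) z - F k z‖ ^ 2 :=
          add_nonneg (by positivity) (Finset.sum_nonneg fun k _ => by positivity)
        gcongr
      · have n1 : 0 ≤ ‖w z - f z‖ ^ 2 + ∑ k, ‖conv (kern δ) (F k) z - F k z‖ ^ 2 :=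
          add_nonneg (by positivity) (Finset.sum_nonneg fun k _ => by positivity)
        simp only [(hS0 z hz).1, (hS0 z hz).2, zero_mul, ofReal_zero, norm_zero]
        simp
        positivity
    have hB0 : 0 ≤ B := integral_nonneg fun z => by
      by_cases hz : z ∈ D
      · have := hb0 z hz
        positivity
      · have : θ z = 0 := image_eq_zero_of_notMem_tsupport fun h => hz (hθ.subset h)
        simp [this]
    have e3 : ∫ z, v δ z * dbar j θ z = -∫ z, dbar j (v δ) z * θ z :=
      hθ.integral_mul_wirt hvc _ j
    rw [e3, norm_neg]
    refine (sq_norm_integral_le (P := fun z => ∑ k, b z * ‖χ z * dbar k (v δ) z‖ ^ 2)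
      (Q := fun z => (b z)⁻¹ * ‖θ z‖ ^ 2) (integrable_finsetSum _ fun k _ => hP0 k) hBi
      ?_ ?_ ?_).trans (mul_le_mul_of_nonneg_right (E1.trans E2) hB0)
    · intro z
      by_cases hz : z ∈ D
      · have := hb0 z hz
        exact Finset.sum_nonneg fun k _ => by positivity
      · simp [(hS0 z fun h => hz (hχ.subset h)).1]
    · intro z
      by_cases hz : z ∈ D
      · have := hb0 z hz
        positivity
      · simp [image_eq_zero_of_notMem_tsupport fun h => hz (hθ.subset h)]
    · intro z
      by_cases hz : z ∈ tsupport θ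
      · have hbz := hb0 z (hθ.subset hz)
        have h1 := Finset.single_le_sum (f := fun k => b z * ‖χ z * dbar k (v δ) z‖ ^ 2)
          (fun k _ => by positivity) (Finset.mem_univ j)
        refine le_trans (le_of_eq ?_) (mul_le_mul_of_nonneg_right h1 (by positivity))
        simp only [hχθ z hz, ofReal_one, one_mul, norm_mul]
        field_simp
      · simp [image_eq_zero_of_notMem_tsupport hz]
  have hlim : Tendsto (fun δ => ∫ z, v δ z * dbar j θ z) (𝓝[>] 0)
      (𝓝 (∫ z, u z * dbar j θ z)) := by
    have hbi : ∀ z ∈ D, ContDiffAt ℝ ∞ (fun x => (b x : ℂ)⁻¹) z := fun z hz =>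
      (hbc z hz).inv (by exact_mod_cast (hb0 z hz).ne')
    have hψ := hθd.mul_left hbi
    have hψi : Integrable fun z => ‖(b z : ℂ)⁻¹ * dbar j θ z‖ ^ 2 := by
      simpa using hψ.integrable_mul_norm_sq (g := fun _ => 1) fun _ _ => contDiffAt_const
    have hui : Integrable fun z => u z * dbar j θ z := by
      refine ((huK.locallyIntegrable (by norm_num)).integrable_smul_left_of_hasCompactSupport
        hθd.continuous hθd.compact).congr (ae_of_all _ fun z => ?_)
      by_cases hz : z ∈ K
      · simp [hz, mul_comm]
      · have : dbar j θ z = 0 := by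
          have h1 := notMem_tsupport_iff_eventuallyEq.1 fun h => hz (hSK (hθS h))
          rw [(wirt_eventuallyEq (s := I) (j := j) h1).self_of_nhds]
          exact wirt_const
        simp [this]
    rw [tendsto_iff_norm_sub_tendsto_zero]
    have hbound : Tendsto (fun δ => √((∫ z, ‖conv (kern δ) f z - f z‖ ^ 2)
        * ∫ z, ‖(b z : ℂ)⁻¹ * dbar j θ z‖ ^ 2)) (𝓝[>] 0) (𝓝 0) := by
      have := ((tendsto_integral_conv_kern hf).mul_const
        (∫ z, ‖(b z : ℂ)⁻¹ * dbar j θ z‖ ^ 2)).sqrt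
      simpa using this
    refine squeeze_zero' (Eventually.of_forall fun _ => norm_nonneg _) ?_ hbound
    filter_upwards [Ioo_mem_nhdsGT hr] with δ hδ
    have hk := testFun_kern (n := n) hδ.1
    have hwc : ContDiff ℝ ∞ (conv (kern δ) f) := hk.contDiff_conv hf'
    have hvi : Integrable fun z => v δ z * dbar j θ z :=
      (hθd.mul_left fun z hz => hwc.contDiffAt.mul (hbi z hz)).integrable
    refine Real.le_sqrt_of_sq_le ?_
    rw [← integral_sub hvi hui]
    refine sq_norm_integral_le ((memLp_conv_kern_sub hδ.1 hf).integrable_norm_pow (by norm_num))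
      hψi (fun _ => by positivity) (fun _ => by positivity) fun z => ?_
    rw [← mul_pow, ← norm_mul]
    refine le_of_eq ?_
    congr 2
    by_cases hz : z ∈ tsupport θ
    · have hzK := hSK (hθS hz)
      have hbz : (b z : ℂ) ≠ 0 := by exact_mod_cast (hb0 z (hrD hzK)).ne'
      simp only [hv, hfdef, hzK, indicator_of_mem]
      field_simp
    · have : dbar j θ z = 0 := by
        rw [(wirt_eventuallyEq (s := I) (j := j)
          (notMem_tsupport_iff_eventuallyEq.1 hz)).self_of_nhds]
        exact wirt_const
      simp [this]
  have h1 : Tendsto (fun δ => (20 * A + 14 * M * e δ) * B) (𝓝[>] 0)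
      (𝓝 ((20 * A + 14 * M * 0) * B)) := ((he0.const_mul _).const_add _).mul_const _
  rw [mul_zero, add_zero] at h1
  refine le_of_tendsto_of_tendsto (hlim.norm.pow 2) h1 ?_
  filter_upwards [Ioo_mem_nhdsGT hr] with δ hδ using key δ hδ

end Regularity

lemma norm_wirt_ofReal_le {s : ℂ} (hs : ‖s‖ ≤ 1) (j : Fin n) {f : Cn n → ℝ} {z : Cn n}
    (hf : DifferentiableAt ℝ f z) : ‖wirt s j (fun x => (f x : ℂ)) z‖ ≤ ‖fderiv ℝ f z‖ := by
  have h1 : HasFDerivAt (fun x => (f x : ℂ)) (ofRealCLM.comp (fderiv ℝ f z)) z :=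
    ofRealCLM.hasFDerivAt.comp z hf.hasFDerivAt
  have h2 : ‖fderiv ℝ f z (stdVec j)‖ ≤ ‖fderiv ℝ f z‖ := by
    simpa [stdVec] using (fderiv ℝ f z).le_opNorm (stdVec j)
  have h3 : ‖fderiv ℝ f z (I • stdVec j)‖ ≤ ‖fderiv ℝ f z‖ := by
    simpa [stdVec, norm_smul] using (fderiv ℝ f z).le_opNorm (I • stdVec j)
  simp only [wirt, h1.fderiv, ContinuousLinearMap.comp_apply, ofRealCLM_apply]
  calc ‖(1 / 2 : ℂ) * ((fderiv ℝ f z (stdVec j) : ℂ) + s * (fderiv ℝ f z (I • stdVec j) : ℂ))‖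
      ≤ 1 / 2 * (‖fderiv ℝ f z (stdVec j)‖ + ‖s‖ * ‖fderiv ℝ f z (I • stdVec j)‖) := by
        rw [norm_mul]
        refine mul_le_mul (by simp) ((norm_add_le _ _).trans (by simp)) (norm_nonneg _) (by simp)
    _ ≤ 1 / 2 * (‖fderiv ℝ f z‖ + 1 * ‖fderiv ℝ f z‖) := by gcongr
    _ = ‖fderiv ℝ f z‖ := by ring

lemma testFun_indicator {D K : Set (Cn n)} (hD : IsOpen D) (hK : IsCompact K) (hKD : K ⊆ D)
    {f : Cn n → ℂ} (hf : ∀ z ∈ D, ContDiffAt ℝ ∞ f z) (h0 : ∀ z ∈ D, z ∉ K → f z = 0) :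
    TestFun D (D.indicator f) := by
  have hs : tsupport (D.indicator f) ⊆ K := by
    refine closure_minimal (fun z hz => ?_) hK.isClosed
    by_contra h
    refine hz ?_
    by_cases hzD : z ∈ D
    · rw [indicator_of_mem hzD, h0 z hzD h]
    · rw [indicator_of_notMem hzD]
  refine ⟨contDiff_iff_contDiffAt.2 fun z => ?_,
    HasCompactSupport.of_support_subset_isCompact hK ((subset_tsupport _).trans hs), hs.trans hKD⟩
  by_cases hz : z ∈ D
  · refine (hf z hz).congr_of_eventuallyEq ?_
    filter_upwards [hD.mem_nhds hz] with x hx using indicator_of_mem hx f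
  · exact (contDiffAt_const (c := (0 : ℂ))).congr_of_eventuallyEq
      (notMem_tsupport_iff_eventuallyEq.1 fun h => hz (hKD (hs h)))

lemma deriv_smoothTransition_eq_zero {t : ℝ} (ht : t ∉ Icc (0 : ℝ) 1) :
    deriv Real.smoothTransition t = 0 := by
  by_cases h : t < 0
  · have : Real.smoothTransition =ᶠ[𝓝 t] fun _ => 0 := by
      filter_upwards [Iio_mem_nhds h] with x hx using Real.smoothTransition.zero_of_nonpos hx.le
    rw [this.deriv_eq, deriv_const]
  · have h1 : 1 < t := by
      by_contra h2
      exact ht ⟨not_lt.1 h, not_lt.1 h2⟩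
    have : Real.smoothTransition =ᶠ[𝓝 t] fun _ => 1 := by
      filter_upwards [Ioi_mem_nhds h1] with x hx using Real.smoothTransition.one_of_one_le hx.le
    rw [this.deriv_eq, deriv_const]

lemma exists_bound_deriv_smoothTransition :
    ∃ C, 0 ≤ C ∧ ∀ t, |deriv Real.smoothTransition t| ≤ C := by
  have hc : Continuous (deriv Real.smoothTransition) :=
    (Real.smoothTransition.contDiff (n := 1)).continuous_deriv le_rfl
  obtain ⟨C, hC⟩ := (isCompact_Icc (a := (0 : ℝ)) (b := 1)).exists_bound_of_continuousOn
    hc.continuousOn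
  refine ⟨C, (norm_nonneg _).trans (hC 0 (by simp)), fun t => ?_⟩
  by_cases ht : t ∈ Icc (0 : ℝ) 1
  · exact hC t ht
  · rw [deriv_smoothTransition_eq_zero ht, abs_zero]
    exact (norm_nonneg _).trans (hC 0 (by simp))

section

variable {D : Set (Cn n)} {q : Cn n → ℝ} {a b : Cn n → ℝ} {u θ : Cn n → ℂ}

lemma HDomain.integral_mul_dbar_eq_zero (hD : HDomain D q) (hb : ∀ z ∈ D, ContDiffAt ℝ ∞ b z)
    (hba : ∀ z ∈ D, b z = q z ^ 3 * a z) (ha0 : ∀ z ∈ D, 0 < a z) (hu : WeakSol D b u)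
    (hi : IntegrableOn (fun z => a z * ‖u z‖ ^ 2) D) (hθ : TestFun D θ) (j : Fin n) :
    ∫ z, u z * dbar j θ z = 0 := by
  obtain ⟨C, hC0, hC⟩ := exists_bound_deriv_smoothTransition
  obtain ⟨Q', hQ'⟩ := hD.bounded_fderiv
  set Q := max Q' 0 with hQdef
  have hQ0 : 0 ≤ Q := le_max_right _ _
  have hQ : ∀ z ∈ D, ‖fderiv ℝ q z‖ ≤ Q := fun z hz => (hQ' z hz).trans (le_max_left _ _)
  have hb0 : ∀ z ∈ D, 0 < b z := fun z hz => by
    rw [hba z hz]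
    exact mul_pos (pow_pos (hD.pos z hz) 3) (ha0 z hz)
  obtain ⟨m, hm0, hm⟩ : ∃ m > 0, ∀ z ∈ tsupport θ, m ≤ q z := by
    rcases (tsupport θ).eq_empty_or_nonempty with h | h
    · exact ⟨1, one_pos, by simp [h]⟩
    · obtain ⟨x, hx, hmin⟩ := (show IsCompact (tsupport θ) from hθ.compact).exists_isMinOn h
        (f := q) fun z hz => (hD.smooth z (hθ.subset hz)).continuousAt.continuousWithinAt
      exact ⟨q x, hD.pos x (hθ.subset hx), hmin⟩
  set A := ∫ z in D, a z * ‖u z‖ ^ 2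
  set B := ∫ z, (b z)⁻¹ * ‖θ z‖ ^ 2
  have key : ∀ ε ∈ Ioo 0 (m / 2), ‖∫ z, u z * dbar j θ z‖ ^ 2
      ≤ (20 * (n * (8 * ε * C ^ 2 * Q ^ 2) * A)) * B := by
    intro ε hε
    have hε0 : 0 < ε := hε.1
    set χ : Cn n → ℝ := D.indicator fun z => Real.smoothTransition (q z / ε - 1) with hχ
    have hχc : (fun x => (χ x : ℂ))
        = D.indicator fun z => (Real.smoothTransition (q z / ε - 1) : ℂ) := by
      ext z
      by_cases hz : z ∈ D <;> simp [hχ, hz]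
    have hχt : TestFun D fun x => (χ x : ℂ) := by
      rw [hχc]
      refine testFun_indicator hD.isOpen (hD.compact ε hε0) (fun z hz => hz.1) (fun z hz => ?_)
        fun z hz hzK => ?_
      · exact ContDiffAt.ofReal' (Real.smoothTransition.contDiffAt.comp z
          (((hD.smooth z hz).div_const _).sub contDiffAt_const))
      · have : q z < ε := by
          by_contra h
          exact hzK ⟨hz, not_lt.1 h⟩
        rw [Real.smoothTransition.zero_of_nonpos, ofReal_zero]
        rw [sub_nonpos, div_le_one hε0]
        exact this.le
    have hχd : ∀ k, ∀ z ∈ D, del k (fun x => (χ x : ℂ)) z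
        = ((deriv Real.smoothTransition (q z / ε - 1) * ε⁻¹ : ℝ) : ℂ)
          * del k (fun x => (q x : ℂ)) z := by
      intro k z hz
      have e1 : (fun x => (χ x : ℂ)) =ᶠ[𝓝 z]
          fun z => (Real.smoothTransition (q z / ε - 1) : ℂ) := by
        rw [hχc]
        filter_upwards [hD.isOpen.mem_nhds hz] with x hx using indicator_of_mem hx _
      rw [wirt_congr e1]
      refine wirt_comp_ofReal (T := fun t => Real.smoothTransition (t / ε - 1)) ?_
        ((hD.smooth z hz).differentiableAt (by simp))
      have h1 : HasDerivAt Real.smoothTransition (deriv Real.smoothTransition (q z / ε - 1))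
          (q z / ε - 1) :=
        ((Real.smoothTransition.contDiff (n := 1)).differentiable (by simp) _).hasDerivAt
      have h2 : HasDerivAt (fun t => t / ε - 1) ε⁻¹ (q z) := by
        simpa [one_div] using ((hasDerivAt_id (q z)).div_const ε).sub_const 1
      exact h1.comp (q z) h2
    have hχ1 : ∀ x ∈ tsupport θ, χ x = 1 := by
      intro x hx
      rw [hχ, indicator_of_mem (hθ.subset hx)]
      refine Real.smoothTransition.one_of_one_le ?_
      have : 2 ≤ q x / ε := by
        rw [le_div_iff₀ hε0]
        linarith [hm x hx, hε.2]
      linarith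
    have hout : ∀ k, ∀ z ∉ D, del k (fun x => (χ x : ℂ)) z = 0 := by
      intro k z hz
      rw [(wirt_eventuallyEq (s := -I) (j := k)
        (notMem_tsupport_iff_eventuallyEq.1 fun h => hz (hχt.subset h))).self_of_nhds]
      exact wirt_const
    have hB0 : 0 ≤ B := integral_nonneg fun z => by
      by_cases hz : z ∈ D
      · have := hb0 z hz
        positivity
      · simp [image_eq_zero_of_notMem_tsupport fun h => hz (hθ.subset h)]
    refine (hu.norm_integral_dbar_sq_le hD.isOpen hb hb0 hχt hθ hχ1 j).trans
      (mul_le_mul_of_nonneg_right (mul_le_mul_of_nonneg_left ?_ (by norm_num)) hB0)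
    rw [← integral_const_mul, ← integral_indicator hD.isOpen.measurableSet]
    refine integral_mono_of_nonneg (ae_of_all _ fun z => ?_)
      ((integrable_indicator_iff hD.isOpen.measurableSet).2 (hi.const_mul _))
      (ae_of_all _ fun z => ?_)
    · by_cases hz : z ∈ D
      · have := hb0 z hz
        exact Finset.sum_nonneg fun k _ => by positivity
      · simp [hout _ z hz]
    · by_cases hz : z ∈ D
      · rw [indicator_of_mem hz]
        have h1 : ∀ k, b z * ‖del k (fun x => (χ x : ℂ)) z * u z‖ ^ 2
            ≤ 8 * ε * C ^ 2 * Q ^ 2 * (a z * ‖u z‖ ^ 2) := by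
          intro k
          have ha := ha0 z hz
          have hq := hD.pos z hz
          rw [hχd k z hz, hba z hz]
          set S := deriv Real.smoothTransition (q z / ε - 1) with hS
          by_cases ht : q z / ε - 1 ∈ Icc (0 : ℝ) 1
          · have h2 : q z ≤ 2 * ε := by
              rw [← div_le_iff₀ hε0]
              linarith [ht.2]
            have h3 : ‖del k (fun x => (q x : ℂ)) z‖ ≤ Q :=
              (norm_wirt_ofReal_le (by simp) k
                ((hD.smooth z hz).differentiableAt (by simp))).trans (hQ z hz)
            have h4 : |S| ≤ C := hC _
            have h5 : q z ^ 3 * (ε⁻¹) ^ 2 ≤ 8 * ε := by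
              calc q z ^ 3 * (ε⁻¹) ^ 2 ≤ (2 * ε) ^ 3 * (ε⁻¹) ^ 2 := by gcongr
                _ = 8 * ε := by field_simp; norm_num
            rw [norm_mul, norm_mul, norm_real, Real.norm_eq_abs, abs_mul, abs_of_pos (inv_pos.2 hε0)]
            calc q z ^ 3 * a z * (|S| * ε⁻¹ * ‖del k (fun x => (q x : ℂ)) z‖ * ‖u z‖) ^ 2
                = (q z ^ 3 * (ε⁻¹) ^ 2) * |S| ^ 2 * ‖del k (fun x => (q x : ℂ)) z‖ ^ 2
                  * (a z * ‖u z‖ ^ 2) := by ring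
              _ ≤ 8 * ε * C ^ 2 * Q ^ 2 * (a z * ‖u z‖ ^ 2) := by gcongr
          · have h2 : S = 0 := deriv_smoothTransition_eq_zero ht
            simp only [h2, zero_mul, ofReal_zero, norm_zero]
            have : 0 ≤ 8 * ε * C ^ 2 * Q ^ 2 * (a z * ‖u z‖ ^ 2) := by positivity
            simpa using this
        refine (Finset.sum_le_sum fun k _ => h1 k).trans (le_of_eq ?_)
        simp
        ring
      · rw [indicator_of_notMem hz]
        simp [hout _ z hz]
  have hlim : Tendsto (fun ε : ℝ => (20 * (n * (8 * ε * C ^ 2 * Q ^ 2) * A)) * B) (𝓝[>] 0)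
      (𝓝 ((20 * (n * (8 * 0 * C ^ 2 * Q ^ 2) * A)) * B)) :=
    ((by fun_prop : Continuous fun ε : ℝ => (20 * (n * (8 * ε * C ^ 2 * Q ^ 2) * A)) * B).tendsto
      0).mono_left nhdsWithin_le_nhds
  have h0 : ‖∫ z, u z * dbar j θ z‖ ^ 2 ≤ (20 * (n * (8 * 0 * C ^ 2 * Q ^ 2) * A)) * B := by
    refine ge_of_tendsto hlim ?_
    filter_upwards [Ioo_mem_nhdsGT (half_pos hm0)] with ε hε using key ε hε
  have h1 : ‖∫ z, u z * dbar j θ z‖ ^ 2 ≤ 0 := by simpa using h0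
  exact norm_eq_zero.1 (pow_eq_zero_iff two_ne_zero |>.1 (le_antisymm h1 (by positivity)))

end

lemma norm_conv_sq_le {κ w : Cn n → ℂ} {U : Set (Cn n)} (hκ : TestFun U κ) (hw : MemLp w 2)
    (x : Cn n) : ‖conv κ w x‖ ^ 2 ≤ (∫ t, ‖κ t‖ ^ 2) * ∫ t, ‖w t‖ ^ 2 := by
  have h1 : MemLp κ 2 := hκ.continuous.memLp_of_hasCompactSupport hκ.compact
  have hP : Integrable fun t => ‖κ t‖ ^ 2 := h1.integrable_norm_pow (by norm_num)
  have hQ : Integrable fun t => ‖w t‖ ^ 2 := hw.integrable_norm_pow (by norm_num)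
  have h2 := sq_norm_integral_le (h := fun y => κ (x - y) * w y) (hP.comp_sub_left x) hQ
    (fun _ => by positivity) (fun _ => by positivity)
    (fun t => by rw [norm_mul, mul_pow])
  rwa [← conv_swap, integral_sub_left_eq_self (fun t => ‖κ t‖ ^ 2) volume x] at h2

lemma exists_holomorphic_ae_eq_ball {u : Cn n → ℂ} {x₀ : Cn n} {ε : ℝ} (hε : 0 < ε)
    (hu : MemLp ((closedBall x₀ (3 * ε)).indicator u) 2)
    (h : ∀ θ, TestFun (ball x₀ (3 * ε)) θ → ∀ j, ∫ z, u z * dbar j θ z = 0) :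
    ∃ F, DifferentiableOn ℂ F (ball x₀ ε) ∧ ∀ᵐ x, x ∈ ball x₀ ε → u x = F x := by
  set w := (closedBall x₀ (3 * ε)).indicator u with hwdef
  have hw : LocallyIntegrable w := hu.locallyIntegrable (by norm_num)
  have hhol : ∀ δ, 0 < δ → δ ≤ ε → DifferentiableOn ℂ (conv (kern δ) w) (ball x₀ (2 * ε)) := by
    intro δ hδ hδε x hx
    have hk := testFun_kern (n := n) hδ
    refine (differentiableAt_of_dbar_eq_zero
      ((hk.contDiff_conv hw).differentiable (by simp) x) fun j => ?_).differentiableWithinAt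
    rw [hk.wirt_conv hw, conv_swap]
    have hηs : tsupport (fun y => kern δ (x - y)) ⊆ closedBall x δ := by
      refine closure_minimal (fun y hy => ?_) isClosed_closedBall
      have := hk.subset (subset_tsupport _ hy)
      simpa [dist_eq_norm, norm_sub_rev] using this
    have hsub : closedBall x δ ⊆ ball x₀ (3 * ε) := by
      intro y hy
      have := dist_triangle y x x₀
      rw [mem_ball] at hx ⊢
      rw [mem_closedBall] at hy
      linarith
    have hθ : TestFun (ball x₀ (3 * ε)) fun y => kern δ (x - y) :=
      ⟨hk.smooth.comp (contDiff_const.sub contDiff_id),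
      HasCompactSupport.of_support_subset_isCompact (isCompact_closedBall x δ)
        ((subset_tsupport _).trans hηs), hηs.trans hsub⟩
    have h0 := h _ hθ j
    have hz := (hθ.wirt I j)
    rw [← neg_eq_zero, ← integral_neg, ← h0]
    congr 1
    ext y
    rw [wirt_comp_sub_left hk.differentiable]
    by_cases hy : y ∈ closedBall x₀ (3 * ε)
    · rw [hwdef, indicator_of_mem hy]; ring
    · have h3 : wirt I j (fun y => kern δ (x - y)) y = 0 := by
        refine image_eq_zero_of_notMem_tsupport fun h4 => hy ?_
        exact ball_subset_closedBall (hz.subset h4)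
      rw [wirt_comp_sub_left hk.differentiable, neg_eq_zero] at h3
      simp [h3]
  have hε2 : 0 < ε / 2 := by positivity
  have hk := testFun_kern (n := n) hε2
  refine ⟨conv (kern (ε / 2)) w, ?_, ?_⟩
  · exact (hhol _ hε2 (by linarith)).mono (ball_subset_ball (by linarith))
  set d : ℕ → ℝ := fun k => ε / (k + 1) with hd
  have hd0 : ∀ k, 0 < d k := fun k => by positivity
  have hdε : ∀ k, d k ≤ ε := fun k => div_le_self hε.le (by linarith [k.cast_nonneg (α := ℝ)])
  have hdlim : Tendsto d atTop (𝓝[>] 0) := by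
    refine tendsto_nhdsWithin_iff.2 ⟨?_, Eventually.of_forall hd0⟩
    have := (tendsto_one_div_add_atTop_nhds_zero_nat (𝕜 := ℝ)).const_mul ε
    simpa [hd, div_eq_mul_inv] using this
  have hE := (tendsto_integral_conv_kern hu).comp hdlim
  have hme : TendstoInMeasure volume (fun k => conv (kern (d k)) w) atTop w := by
    refine tendstoInMeasure_of_tendsto_eLpNorm (p := 2) (by norm_num)
      (fun k => ((testFun_kern (hd0 k)).contDiff_conv hw).continuous.aestronglyMeasurable) hu.1 ?_
    have h1 := ((tendsto_lintegral_conv_kern hu).comp hdlim).ennrpow_const (1 / 2)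
    rw [ENNReal.zero_rpow_of_pos (by norm_num)] at h1
    refine h1.congr fun k => ?_
    rw [eLpNorm_eq_lintegral_rpow_enorm_toReal (by norm_num) (by norm_num)]
    simp
  obtain ⟨ns, hns, hae⟩ := hme.exists_seq_tendsto_ae
  filter_upwards [hae] with x hx hxb
  have hxu : w x = u x :=
    indicator_of_mem (ball_subset_closedBall (ball_subset_ball (by linarith) hxb)) u
  rw [← hxu]
  refine tendsto_nhds_unique hx ?_
  suffices h0 : Tendsto (fun k => conv (kern (d k)) w x) atTop (𝓝 (conv (kern (ε / 2)) w x)) from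
    h0.comp hns.tendsto_atTop
  have hrep : ∀ k, conv (kern (d k)) w x - conv (kern (ε / 2)) w x
      = conv (kern (ε / 2)) (fun y => conv (kern (d k)) w y - w y) x := by
    intro k
    have h1 : conv (kern (ε / 2)) (conv (kern (d k)) w) x = conv (kern (d k)) w x := by
      refine conv_kern_eq (R := ε) ((hhol _ (hd0 k) (hdε k)).mono ?_) hε2 (by linarith)
      intro y hy
      have := dist_triangle y x x₀
      rw [mem_ball] at hxb hy ⊢
      linarith
    have hc : LocallyIntegrable (conv (kern (d k)) w) :=
      ((testFun_kern (hd0 k)).contDiff_conv hw).continuous.locallyIntegrable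
    rw [← h1]
    simp only [conv, mul_sub]
    exact (integral_sub (hk.integrable_conv hc x) (hk.integrable_conv hw x)).symm
  rw [tendsto_iff_norm_sub_tendsto_zero]
  have hb : ∀ k, ‖conv (kern (d k)) w x - conv (kern (ε / 2)) w x‖ ^ 2
      ≤ (∫ t : Cn n, ‖kern (ε / 2) t‖ ^ 2) * ∫ t, ‖conv (kern (d k)) w t - w t‖ ^ 2 := fun k => by
    rw [hrep]
    exact norm_conv_sq_le hk (memLp_conv_kern_sub (hd0 k) hu) x
  have h2 := squeeze_zero (fun k => by positivity) hb (by simpa using hE.const_mul _)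
  have h3 := h2.sqrt
  simpa [Real.sqrt_sq] using h3

lemma exists_holomorphic_ae_eq {D : Set (Cn n)} (hD : IsOpen D) {u : Cn n → ℂ}
    (hu : ∀ K ⊆ D, IsCompact K → MemLp (K.indicator u) 2)
    (h : ∀ θ, TestFun D θ → ∀ j, ∫ z, u z * dbar j θ z = 0) :
    ∃ F, DifferentiableOn ℂ F D ∧ ∀ᵐ x, x ∈ D → u x = F x := by
  have hloc : ∀ x, ∃ ε : ℝ, ∃ F, x ∈ D → 0 < ε ∧ ball x ε ⊆ D ∧
      DifferentiableOn ℂ F (ball x ε) ∧ ∀ᵐ y, y ∈ ball x ε → u y = F y := by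
    intro x
    by_cases hx : x ∈ D
    swap
    · exact ⟨0, 0, fun h => absurd h hx⟩
    obtain ⟨r, hr, hrD⟩ := Metric.isOpen_iff.1 hD x hx
    have h1 : closedBall x (3 * (r / 4)) ⊆ D :=
      (closedBall_subset_ball (by linarith)).trans hrD
    obtain ⟨F, hF⟩ := exists_holomorphic_ae_eq_ball (ε := r / 4) (by positivity)
      (hu _ h1 (isCompact_closedBall _ _)) fun θ hθ =>
        h θ (hθ.mono (ball_subset_closedBall.trans h1))
    exact ⟨r / 4, F, fun _ => ⟨by positivity, (ball_subset_ball (by linarith)).trans hrD, hF⟩⟩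
  choose ε F hF using hloc
  have heq : ∀ x ∈ D, ∀ y ∈ ball x (ε x), F y y = F x y := by
    intro x hx y hy
    obtain ⟨hx1, hx2, hx3, hx4⟩ := hF x hx
    obtain ⟨hy1, hy2, hy3, hy4⟩ := hF y (hx2 hy)
    have hopen : IsOpen (ball x (ε x) ∩ ball y (ε y)) := isOpen_ball.inter isOpen_ball
    refine Measure.eqOn_open_of_ae_eq (μ := (volume : Measure (Cn n))) ?_ hopen
      (hy3.continuousOn.mono inter_subset_right)
      (hx3.continuousOn.mono inter_subset_left) ⟨hy, mem_ball_self hy1⟩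
    rw [Filter.EventuallyEq, ae_restrict_iff' hopen.measurableSet]
    filter_upwards [hx4, hy4] with z h1 h2 hz
    rw [← h1 hz.1, ← h2 hz.2]
  refine ⟨fun x => F x x, fun x hx => ?_, ?_⟩
  · obtain ⟨hx1, hx2, hx3, hx4⟩ := hF x hx
    have h1 : (fun x => F x x) =ᶠ[𝓝 x] F x := by
      filter_upwards [ball_mem_nhds x hx1] with y hy using heq x hx y hy
    exact (((hx3 x (mem_ball_self hx1)).differentiableAt (ball_mem_nhds x hx1)).congr_of_eventuallyEq
      h1).differentiableWithinAt
  · rw [ae_iff]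
    refine measure_null_of_locally_null _ fun x hx => ?_
    have hxD : x ∈ D := by by_contra h; exact hx fun h' => absurd h' h
    obtain ⟨hx1, hx2, hx3, hx4⟩ := hF x hxD
    refine ⟨_, inter_mem_nhdsWithin _ (ball_mem_nhds x hx1), ?_⟩
    refine measure_mono_null ?_ (ae_iff.1 hx4)
    rintro y ⟨hy, hyb⟩ h1
    exact hy fun _ => (h1 hyb).trans (heq x hxD y hyb).symm

lemma exists_inner_sub_eq_zero {H : Type*} [NormedAddCommGroup H] [InnerProductSpace ℂ H]
    [CompleteSpace H] (R : Submodule ℂ H) (x : H) {B : ℝ} (hB0 : 0 ≤ B)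
    (hB : ∀ r ∈ R, ‖inner ℂ r x‖ ≤ B * ‖r‖) :
    ∃ p, ‖p‖ ≤ B ∧ ∀ r ∈ R, inner ℂ r (x - p) = 0 := by
  have hc : IsClosed (R.topologicalClosure : Set H) := R.isClosed_topologicalClosure
  have : CompleteSpace R.topologicalClosure := hc.completeSpace_coe
  set p := R.topologicalClosure.starProjection x with hp
  have hpm : p ∈ R.topologicalClosure := Submodule.starProjection_apply_mem _ x
  have horth : ∀ r ∈ R.topologicalClosure, inner ℂ r (x - p) = 0 := fun r hr =>
    Submodule.sub_starProjection_mem_orthogonal (K := R.topologicalClosure) x r hr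
  refine ⟨p, ?_, fun r hr => horth r (R.le_topologicalClosure hr)⟩
  have h1 : ‖inner ℂ p x‖ ≤ B * ‖p‖ := by
    have hcl : IsClosed {r : H | ‖inner ℂ r x‖ ≤ B * ‖r‖} :=
      isClosed_le (by fun_prop) (by fun_prop)
    exact closure_minimal (fun r hr => hB r hr) hcl hpm
  have h2 : inner ℂ p x = inner ℂ p p := by
    have := horth p hpm
    rw [inner_sub_right, sub_eq_zero] at this
    exact this
  rw [h2, inner_self_eq_norm_sq_to_K, norm_pow] at h1
  simp only [RCLike.norm_ofReal, abs_norm] at h1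
  by_contra hlt
  push Not at hlt
  nlinarith

lemma norm_sq_eq_integral {α : Type*} [MeasurableSpace α] {μ : Measure α} (F : Lp ℂ 2 μ) :
    ‖F‖ ^ 2 = ∫ a, ‖F a‖ ^ 2 ∂μ := by
  have h : ((‖F‖ ^ 2 : ℝ) : ℂ) = ((∫ a, ‖F a‖ ^ 2 ∂μ : ℝ) : ℂ) := by
    have h1 := inner_self_eq_norm_sq_to_K (𝕜 := ℂ) F
    rw [L2.inner_def] at h1
    rw [← integral_complex_ofReal]
    simp only [RCLike.inner_apply, Complex.mul_conj'] at h1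
    push_cast
    exact h1.symm
  exact_mod_cast h

lemma exists_memLp_integral_sub_mul_conj_eq_zero {α : Type*} [MeasurableSpace α] {μ : Measure α}
    (T : Submodule ℂ (α → ℂ)) (hT : ∀ t ∈ T, MemLp t 2 μ) {f : α → ℂ} (hf : MemLp f 2 μ) {B : ℝ}
    (hB0 : 0 ≤ B) (hB : ∀ t ∈ T, ‖∫ a, f a * conj (t a) ∂μ‖ ^ 2 ≤ B * ∫ a, ‖t a‖ ^ 2 ∂μ) :
    ∃ p : α → ℂ, MemLp p 2 μ ∧ ∫ a, ‖p a‖ ^ 2 ∂μ ≤ B ∧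
      ∀ t ∈ T, ∫ a, (f a - p a) * conj (t a) ∂μ = 0 := by
  let E : T →ₗ[ℂ] Lp ℂ 2 μ :=
    { toFun := fun t => (hT t t.2).toLp t
      map_add' := fun t s => MemLp.toLp_add (hT t t.2) (hT s s.2)
      map_smul' := fun c t => MemLp.toLp_const_smul c (hT t t.2) }
  have hE : ∀ t : T, E t =ᵐ[μ] t := fun t => (hT t t.2).coeFn_toLp
  obtain ⟨p, hp, horth⟩ := exists_inner_sub_eq_zero (LinearMap.range E) (hf.toLp f)
    (Real.sqrt_nonneg B) (by
      rintro _ ⟨t, rfl⟩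
      have h1 : inner ℂ (E t) (hf.toLp f) = ∫ a, f a * conj ((t : α → ℂ) a) ∂μ := by
        rw [L2.inner_def]
        refine integral_congr_ae ?_
        filter_upwards [hE t, hf.coeFn_toLp] with a h1 h2
        rw [h1, h2, RCLike.inner_apply]
      have h2 : ‖E t‖ ^ 2 = ∫ a, ‖(t : α → ℂ) a‖ ^ 2 ∂μ := by
        rw [norm_sq_eq_integral]
        refine integral_congr_ae ?_
        filter_upwards [hE t] with a h1
        rw [h1]
      have h3 := hB t t.2
      rw [← h1, ← h2] at h3
      refine le_of_sq_le_sq ?_ (by positivity)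
      rwa [mul_pow, Real.sq_sqrt hB0])
  refine ⟨p, Lp.memLp p, ?_, fun t ht => ?_⟩
  · rw [← norm_sq_eq_integral]
    calc ‖p‖ ^ 2 ≤ √B ^ 2 := by gcongr
      _ = B := Real.sq_sqrt hB0
  · rw [← horth (E ⟨t, ht⟩) ⟨_, rfl⟩, L2.inner_def]
    refine integral_congr_ae ?_
    filter_upwards [hE ⟨t, ht⟩, hf.coeFn_toLp, Lp.coeFn_sub (hf.toLp f) p] with a h1 h2 h3
    rw [h1, h3, RCLike.inner_apply, Pi.sub_apply, h2]

section

variable {D : Set (Cn n)} {q ρ : Cn n → ℝ} {c : ℝ}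

lemma wdiv_add {P : Fin n → Cn n → ℂ} {v w : Cn n → ℂ} (hv : TestFun D v) (hw : TestFun D w)
    (z : Cn n) : wdiv P (fun z => v z + w z) z = wdiv P v z + wdiv P w z := by
  have h1 : ∀ j, dbar j (fun z => v z + w z) = fun z => dbar j v z + dbar j w z := fun j =>
    funext fun z => wirt_add (hv.differentiable z) (hw.differentiable z)
  simp only [wdiv, h1, ← Finset.sum_add_distrib]
  refine Finset.sum_congr rfl fun j _ => ?_
  rw [wirt_add ((hv.wirt I j).differentiable z) ((hw.wirt I j).differentiable z)]
  ring

lemma wdiv_const_mul {P : Fin n → Cn n → ℂ} {v : Cn n → ℂ} (hv : TestFun D v) (a : ℂ)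
    (z : Cn n) : wdiv P (fun z => a * v z) z = a * wdiv P v z := by
  have h1 : ∀ j, dbar j (fun z => a * v z) = fun z => a * dbar j v z := fun j =>
    funext fun z => wirt_const_mul a (hv.differentiable z)
  simp only [wdiv, h1, Finset.mul_sum]
  refine Finset.sum_congr rfl fun j _ => ?_
  rw [wirt_const_mul a ((hv.wirt I j).differentiable z)]
  ring

lemma sum_del_wgt_mul_dbar (hD : HDomain D q) (hρ : ∀ z ∈ D, ContDiffAt ℝ ∞ ρ z) (m : ℕ)
    {v : Cn n → ℂ} (hv : TestFun D v) (z : Cn n) :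
    ∑ j, del j (fun x => wgt q ρ c m x * dbar j v x) z
      = wgt q ρ c m z * wdiv (wgtP q ρ c m) v z := by
  have hv' := fun j => hv.wirt I j
  rw [wdiv, Finset.mul_sum]
  refine Finset.sum_congr rfl fun j _ => ?_
  by_cases hz : z ∈ D
  · rw [wirt_mul ((ContDiffAt.ofReal' (contDiffAt_wgt (hD.smooth z hz) (hρ z hz) c m)).differentiableAt
      (by simp)) ((hv' j).differentiable z), del_wgt (hD.smooth z hz) (hρ z hz) (hD.pos z hz)]
    ring
  · have h0 : z ∉ tsupport (dbar j v) := fun h => hz ((hv' j).subset h)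
    have h1 := notMem_tsupport_iff_eventuallyEq.1 h0
    have h2 : (fun x => wgt q ρ c m x * dbar j v x) =ᶠ[𝓝 z] fun _ => 0 := by
      filter_upwards [h1] with x hx
      rw [hx]; simp
    rw [wirt_congr h2, wirt_congr h1, h1.eq_of_nhds]
    simp [wirt]

lemma HDomain.exists_holomorphic (hD : HDomain D q) (hρ : ∀ z ∈ D, ContDiffAt ℝ ∞ ρ z)
    {α : Cn n → ℂ} (hα : TestFun D α) {B : ℝ} (hB0 : 0 ≤ B)
    (hB : ∀ v, TestFun D v → ‖∫ z, α z * (wgt q ρ c 15 z * conj (wdiv (wgtP q ρ c 15) v z))‖ ^ 2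
      ≤ B * ∫ z, ‖wdiv (wgtP q ρ c 15) v z‖ ^ 2 * wgt q ρ c 18 z) :
    ∃ G, DifferentiableOn ℂ G D ∧ IntegrableOn (fun z => wgt q ρ c 12 z * ‖α z - G z‖ ^ 2) D ∧
      ∫ z in D, wgt q ρ c 12 z * ‖α z - G z‖ ^ 2 ≤ B := by
  set a := wgt q ρ c 12 with ha
  set b := wgt q ρ c 15 with hb
  set L := wdiv (wgtP q ρ c 15) with hL
  have ha0 : ∀ z ∈ D, 0 < a z := fun z hz => wgt_pos (hD.pos z hz) ρ c 12
  have has : ∀ z ∈ D, ContDiffAt ℝ ∞ a z := fun z hz =>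
    contDiffAt_wgt (hD.smooth z hz) (hρ z hz) c 12
  have hbs : ∀ z ∈ D, ContDiffAt ℝ ∞ b z := fun z hz =>
    contDiffAt_wgt (hD.smooth z hz) (hρ z hz) c 15
  have hba : ∀ z, b z = q z ^ 3 * a z := fun z => by simp only [hb, ha, wgt]; ring
  have hLt : ∀ v, TestFun D v → TestFun D (L v) := fun v hv => wdiv_testFun hv fun j z hz =>
    contDiffAt_wgtP (hD.smooth z hz) (hρ z hz) (hD.pos z hz) c 15 j
  have hL0 : ∀ v, TestFun D v → ∀ z, z ∉ D → L v z = 0 := fun v hv z hz =>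
    image_eq_zero_of_notMem_tsupport fun h => hz ((hLt v hv).subset h)
  set s : Cn n → ℝ := fun z => √(a z) with hs
  have hs0 : ∀ z ∈ D, 0 < s z := fun z hz => Real.sqrt_pos.2 (ha0 z hz)
  have hss : ∀ z ∈ D, s z ^ 2 = a z := fun z hz => Real.sq_sqrt (ha0 z hz).le
  have hsc : ∀ z ∈ D, ContDiffAt ℝ ∞ s z := fun z hz => (has z hz).sqrt (ha0 z hz).ne'
  have hsc' : ∀ z ∈ D, ContDiffAt ℝ ∞ (fun x => (s x : ℂ)) z := fun z hz =>
    ContDiffAt.ofReal' (hsc z hz)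
  have hgc : ∀ z ∈ D, ContDiffAt ℝ ∞ (fun x => ((s x * q x ^ 3 : ℝ) : ℂ)) z := fun z hz =>
    ContDiffAt.ofReal' ((hsc z hz).mul ((hD.smooth z hz).pow 3))
  have hmem : ∀ {f : Cn n → ℂ}, TestFun D f → MemLp f 2 := fun {f} hf =>
    hf.continuous.memLp_of_hasCompactSupport hf.compact
  let T : Submodule ℂ (Cn n → ℂ) :=
    { carrier := {t | ∃ v, TestFun D v ∧ ∀ z, t z = (s z * q z ^ 3 : ℝ) * L v z}
      zero_mem' := ⟨_, TestFun.zero, fun z => by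
        have h := wdiv_const_mul (P := wgtP q ρ c 15) (TestFun.zero (U := D)) 0 z
        simp only [mul_zero, zero_mul] at h
        rw [hL, h, mul_zero, Pi.zero_apply]⟩
      add_mem' := by
        rintro t r ⟨v, hv, ht⟩ ⟨w, hw, hr⟩
        refine ⟨_, hv.add hw, fun z => ?_⟩
        rw [hL, wdiv_add hv hw, Pi.add_apply, ht, hr, mul_add]
      smul_mem' := by
        rintro e t ⟨v, hv, ht⟩
        refine ⟨_, hv.const_mul e, fun z => ?_⟩
        rw [hL, wdiv_const_mul hv, Pi.smul_apply, ht, smul_eq_mul]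
        ring }
  have hTm : ∀ t ∈ T, MemLp t 2 := by
    rintro t ⟨v, hv, ht⟩
    rw [funext ht]
    exact hmem ((hLt v hv).mul_left hgc)
  have hf : MemLp (fun z => s z * α z) 2 := hmem (hα.mul_left hsc')
  obtain ⟨p, hp, hpB, hpT⟩ := exists_memLp_integral_sub_mul_conj_eq_zero T hTm hf hB0 (by
    rintro t ⟨v, hv, ht⟩
    have h1 : ∫ z, (s z * α z) * conj (t z) = ∫ z, α z * (b z * conj (L v z)) := by
      congr 1
      ext z
      by_cases hz : z ∈ D
      · rw [ht, hba, ← hss z hz]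
        push_cast
        simp only [map_mul, conj_ofReal, map_pow]
        ring
      · rw [ht, hL0 v hv z hz]; simp
    have h2 : ∫ z, ‖t z‖ ^ 2 = ∫ z, ‖L v z‖ ^ 2 * wgt q ρ c 18 z := by
      congr 1
      ext z
      by_cases hz : z ∈ D
      · rw [ht, norm_mul, mul_pow, norm_real, Real.norm_eq_abs, sq_abs, mul_pow, hss z hz]
        simp only [ha, wgt]
        ring
      · rw [ht, hL0 v hv z hz]; simp
    rw [h1, h2]
    exact hB v hv)
  set u : Cn n → ℂ := fun z => (s z : ℂ)⁻¹ * (s z * α z - p z) with hu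
  have hU : MemLp (fun z => s z * α z - p z) 2 := hf.sub hp
  have hweak : WeakSol D b u := by
    refine ⟨fun K hKD hK => ?_, fun η hη => ?_⟩
    · refine memLp_indicator_mul hK (hU.indicator hK.measurableSet) fun z hz => ?_
      exact ((hsc' z (hKD hz)).continuousAt.inv₀
        (by exact_mod_cast (hs0 z (hKD hz)).ne')).continuousWithinAt
    · have hv : TestFun D fun z => conj (η z) := hη.conjugate
      have ht := hpT (fun z => (s z * q z ^ 3 : ℝ) * L (fun z => conj (η z)) z) ⟨_, hv, fun z => rfl⟩
      rw [← ht]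
      congr 1
      ext z
      have h1 : ∑ j, dbar j (fun x => b x * del j η x) z
          = b z * conj (L (fun z => conj (η z)) z) := by
        have h2 := congrArg conj (sum_del_wgt_mul_dbar (c := c) hD hρ 15 hv z)
        simp only [map_sum, map_mul, conj_ofReal] at h2
        rw [← hb, ← hL] at h2
        rw [← h2]
        refine Finset.sum_congr rfl fun j _ => ?_
        rw [← dbar_conj]
        simp only [map_mul, conj_ofReal, dbar_conj, conj_conj]
      rw [h1]
      by_cases hz : z ∈ D
      · have h3 : (s z : ℂ) ≠ 0 := by exact_mod_cast (hs0 z hz).ne'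
        rw [hba, ← hss z hz, hu]
        push_cast
        simp only [map_mul, conj_ofReal, map_pow]
        field_simp
      · rw [hL0 _ hv z hz]; simp
  have hau : ∀ z ∈ D, a z * ‖u z‖ ^ 2 = ‖s z * α z - p z‖ ^ 2 := by
    intro z hz
    have := (hs0 z hz).ne'
    rw [hu, ← hss z hz]
    simp only [norm_mul, norm_inv, norm_real, Real.norm_eq_abs, mul_pow, inv_pow, sq_abs]
    field_simp
  have hi : IntegrableOn (fun z => a z * ‖u z‖ ^ 2) D := by
    refine IntegrableOn.congr_fun ?_ (fun z hz => (hau z hz).symm) hD.isOpen.measurableSet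
    exact (hU.integrable_norm_pow (by norm_num)).integrableOn
  obtain ⟨G, hG, hGu⟩ := exists_holomorphic_ae_eq hD.isOpen hweak.memLp fun θ hθ j =>
    hD.integral_mul_dbar_eq_zero hbs (fun z _ => hba z) ha0 hweak hi hθ j
  have hfin : (fun z => a z * ‖α z - G z‖ ^ 2) =ᵐ[volume.restrict D] fun z => ‖p z‖ ^ 2 := by
    rw [Filter.EventuallyEq, ae_restrict_iff' hD.isOpen.measurableSet]
    filter_upwards [hGu] with z h1 hz
    have h3 : (s z : ℂ) ≠ 0 := by exact_mod_cast (hs0 z hz).ne'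
    have h4 : α z - G z = (s z : ℂ)⁻¹ * p z := by
      rw [← h1 hz, hu]
      field_simp
      ring
    have := (hs0 z hz).ne'
    rw [h4, ← hss z hz]
    simp only [norm_mul, norm_inv, norm_real, Real.norm_eq_abs, mul_pow, inv_pow, sq_abs]
    field_simp
  have hpi : Integrable fun z => ‖p z‖ ^ 2 := hp.integrable_norm_pow (by norm_num)
  refine ⟨G, hG, hpi.integrableOn.congr hfin.symm, ?_⟩
  rw [integral_congr_ae hfin]
  exact (setIntegral_le_integral hpi (ae_of_all _ fun z => by positivity)).trans hpB

end

section

variable {D : Set (Cn n)} {q ρ : Cn n → ℝ} {h : Cn n → ℂ} {c : ℝ}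

/-- The cut-off of `h` to the part of `{ρ < 0}` where `c * ρ ≤ -1`. -/
def cutoff (D : Set (Cn n)) (ρ : Cn n → ℝ) (c : ℝ) (h : Cn n → ℂ) : Cn n → ℂ :=
  {z ∈ D | ρ z < 0}.indicator fun z => Real.smoothTransition (-1 - c * ρ z) * h z

lemma isOpen_sublevel (hD : IsOpen D) (hρ : ∀ z ∈ D, ContinuousAt ρ z) :
    IsOpen {z ∈ D | ρ z < 0} :=
  (continuousOn_of_forall_continuousAt hρ).isOpen_inter_preimage hD isOpen_Iio

lemma testFun_cutoff (hD : IsOpen D) (hρ : ∀ z ∈ D, ContDiffAt ℝ ∞ ρ z)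
    (hcpt : IsCompact (closure {z ∈ D | ρ z < 0})) (hsub : closure {z ∈ D | ρ z < 0} ⊆ D)
    (hh : DifferentiableOn ℂ h {z ∈ D | ρ z < 0}) (hc : 0 < c) :
    TestFun {z ∈ D | ρ z < 0} (cutoff D ρ c h) := by
  have hρc : ∀ z ∈ D, ContinuousAt ρ z := fun z hz => (hρ z hz).continuousAt
  have ho := isOpen_sublevel hD hρc
  have hK : IsCompact (closure {z ∈ D | ρ z < 0} ∩ ρ ⁻¹' Iic (-1 / c)) :=
    hcpt.of_isClosed_subset (ContinuousOn.preimage_isClosed_of_isClosed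
      (continuousOn_of_forall_continuousAt fun z hz => hρc z (hsub hz)) isClosed_closure isClosed_Iic)
      inter_subset_left
  refine testFun_indicator ho hK (fun z hz => ⟨hsub hz.1, ?_⟩) (fun z hz => ?_) (fun z hz hzK => ?_)
  · refine lt_of_le_of_lt hz.2 (div_neg_of_neg_of_pos (by norm_num) hc)
  · refine (ContDiffAt.ofReal' ?_).mul (DifferentiableOn.contDiffAt_real hh ho hz)
    exact Real.smoothTransition.contDiff.contDiffAt.comp z
      (contDiffAt_const.sub (contDiffAt_const.mul (hρ z hz.1)))
  · have : -1 / c < ρ z := by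
      by_contra h1
      exact hzK ⟨subset_closure hz, not_lt.1 h1⟩
    rw [div_lt_iff₀ hc] at this
    rw [Real.smoothTransition.zero_of_nonpos (by linarith)]
    simp

lemma dbar_cutoff (hD : IsOpen D) (hρ : ∀ z ∈ D, ContDiffAt ℝ ∞ ρ z)
    (hh : DifferentiableOn ℂ h {z ∈ D | ρ z < 0}) (j : Fin n) {z : Cn n}
    (hz : z ∈ {z ∈ D | ρ z < 0}) :
    dbar j (cutoff D ρ c h) z = -((c * deriv Real.smoothTransition (-1 - c * ρ z) : ℝ) * h z)
      * dbar j (fun x => (ρ x : ℂ)) z := by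
  have ho := isOpen_sublevel hD fun z hz => (hρ z hz).continuousAt
  have h1 : cutoff D ρ c h =ᶠ[𝓝 z] fun z => Real.smoothTransition (-1 - c * ρ z) * h z := by
    filter_upwards [ho.mem_nhds hz] with y hy
    exact indicator_of_mem (s := {z ∈ D | ρ z < 0}) hy _
  have hd : DifferentiableAt ℂ h z := (hh z hz).differentiableAt (ho.mem_nhds hz)
  have h2 : HasDerivAt (fun t => Real.smoothTransition (-1 - c * t))
      (-(c * deriv Real.smoothTransition (-1 - c * ρ z))) (ρ z) := by
    have h3 : HasDerivAt Real.smoothTransition (deriv Real.smoothTransition (-1 - c * ρ z))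
        (-1 - c * ρ z) :=
      ((Real.smoothTransition.contDiff (n := 1)).differentiable (by norm_num) _).hasDerivAt
    have h4 := h3.comp (ρ z) (((hasDerivAt_id (ρ z)).const_mul c).const_sub (-1))
    exact h4.congr_deriv (by ring)
  have h5 : ContDiffAt ℝ ∞ (fun x => Real.smoothTransition (-1 - c * ρ x)) z :=
    Real.smoothTransition.contDiff.contDiffAt.comp z
      (contDiffAt_const.sub (contDiffAt_const.mul (hρ z hz.1)))
  rw [wirt_congr h1, wirt_mul ((ContDiffAt.ofReal' h5).differentiableAt (by simp))
    (hd.restrictScalars ℝ), wirt_comp_ofReal h2 ((hρ z hz.1).differentiableAt (by simp)),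
    dbar_eq_zero hd]
  push_cast
  ring

lemma HDomain.pairing_le (hD : HDomain D q) (hρ : ∀ z ∈ D, ContDiffAt ℝ ∞ ρ z)
    (hρL : ∀ z ∈ D, ∀ w, 0 ≤ levi ρ z w)
    (hcpt : IsCompact (closure {z ∈ D | ρ z < 0})) (hsub : closure {z ∈ D | ρ z < 0} ⊆ D)
    (hh : DifferentiableOn ℂ h {z ∈ D | ρ z < 0}) (hc : 0 < c) {P : Cn n → ℝ}
    (hP : IntegrableOn P {z ∈ D | ρ z < 0})
    (hP1 : ∀ z ∈ {z ∈ D | ρ z < 0}, deriv Real.smoothTransition (-1 - c * ρ z) ^ 2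
      * Real.exp (-(c * ρ z)) * wgt q ρ c 12 z * ‖h z‖ ^ 2 ≤ P z)
    {v : Cn n → ℂ} (hv : TestFun D v) :
    ‖∫ z, cutoff D ρ c h z * (wgt q ρ c 15 z * conj (wdiv (wgtP q ρ c 15) v z))‖ ^ 2
      ≤ (2 * ∫ z in {z ∈ D | ρ z < 0}, P z) *
        ∫ z, ‖wdiv (wgtP q ρ c 15) v z‖ ^ 2 * wgt q ρ c 18 z := by
  set D₀ := {z ∈ D | ρ z < 0} with hD₀
  have ho : IsOpen D₀ := isOpen_sublevel hD.isOpen fun z hz => (hρ z hz).continuousAt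
  have hα : TestFun D₀ (cutoff D ρ c h) := testFun_cutoff hD.isOpen hρ hcpt hsub hh hc
  set α := cutoff D ρ c h with hαdef
  set b := wgt q ρ c 15 with hb
  have hbs : ∀ z ∈ D, ContDiffAt ℝ ∞ b z := fun z hz =>
    contDiffAt_wgt (hD.smooth z hz) (hρ z hz) c 15
  have hf : ∀ j, TestFun D fun z => b z * conj (dbar j v z) := fun j =>
    (hv.wirt I j).conjugate.mul_left fun z hz => ContDiffAt.ofReal' (hbs z hz)
  set X : Cn n → ℂ := fun z => ∑ j, del j (fun x => (ρ x : ℂ)) z * dbar j v z with hX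
  have hXt : TestFun D X := TestFun.sum _ fun j _ =>
    (hv.wirt I j).mul_left fun z hz => contDiffAt_wirt (ContDiffAt.ofReal' (hρ z hz))
  set g : Cn n → ℂ := D₀.indicator fun z =>
    ((c * deriv Real.smoothTransition (-1 - c * ρ z) : ℝ) * h z) * (b z * conj (X z)) with hg
  have h1 : ∫ z, α z * (b z * conj (wdiv (wgtP q ρ c 15) v z)) = ∫ z, g z := by
    have h2 : ∀ z, b z * conj (wdiv (wgtP q ρ c 15) v z)
        = ∑ j, dbar j (fun z => b z * conj (dbar j v z)) z := by
      intro z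
      have h2 := congrArg conj (sum_del_wgt_mul_dbar (c := c) hD hρ 15 hv z)
      simp only [map_sum, map_mul, conj_ofReal] at h2
      rw [← h2]
      refine Finset.sum_congr rfl fun j _ => ?_
      rw [← dbar_conj]
      simp only [map_mul, conj_ofReal, hb]
    have h3 : ∀ j, ∫ z, α z * dbar j (fun z => b z * conj (dbar j v z)) z
        = -∫ z, dbar j α z * (b z * conj (dbar j v z)) := fun j =>
      (hf j).integral_mul_wirt (fun z _ => hα.smooth.contDiffAt) I j
    have h4 : ∀ z, g z = ∑ j, -(dbar j α z * (b z * conj (dbar j v z))) := by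
      intro z
      by_cases hz : z ∈ D₀
      · rw [hg, indicator_of_mem hz, hX]
        simp only [map_sum, map_mul, Finset.mul_sum, conj_del_ofReal]
        refine Finset.sum_congr rfl fun j _ => ?_
        rw [hαdef, dbar_cutoff hD.isOpen hρ hh j hz]
        ring
      · rw [hg, indicator_of_notMem hz]
        refine (Finset.sum_eq_zero fun j _ => ?_).symm
        rw [image_eq_zero_of_notMem_tsupport fun h => hz ((hα.wirt I j).subset h)]
        simp
    simp only [h2, h4, Finset.mul_sum]
    rw [integral_finsetSum, integral_finsetSum]
    · simp only [h3, integral_neg]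
    · exact fun j _ => ((((hα.wirt I j).mono (fun z hz => hz.1)).mul (hf j)).integrable).neg
    · exact fun j _ => (((hα.mono (fun z hz => hz.1)).mul ((hf j).wirt I j)).integrable)
  have hQi : Integrable fun z => c ^ 2 * Real.exp (c * ρ z) * wgt q ρ c 18 z * ‖X z‖ ^ 2 := by
    refine hXt.integrable_mul_norm_sq fun z hz => ?_
    have h5 : ContDiffAt ℝ ∞ (fun z => c ^ 2 * Real.exp (c * ρ z)) z := by
      have := hρ z hz
      fun_prop
    exact h5.mul (contDiffAt_wgt (hD.smooth z hz) (hρ z hz) c 18)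
  have hw : ∀ z, 0 ≤ wgt q ρ c 18 z := fun z => by
    rw [wgt]
    exact mul_nonneg (Even.pow_nonneg (by decide) _) (Real.exp_pos _).le
  have hw12 : ∀ z, 0 ≤ wgt q ρ c 12 z := fun z => by
    rw [wgt]
    exact mul_nonneg (Even.pow_nonneg (by decide) _) (Real.exp_pos _).le
  have hP0 : ∀ z ∈ D₀, 0 ≤ P z := fun z hz => le_trans (by have := hw12 z; positivity) (hP1 z hz)
  have h6 := sq_norm_integral_le (h := g) ((integrable_indicator_iff ho.measurableSet).2 hP) hQi
    (fun z => indicator_nonneg hP0 z)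
    (fun z => by have := hw z; positivity) (fun z => by
      by_cases hz : z ∈ D₀
      · rw [hg, indicator_of_mem hz, indicator_of_mem hz]
        refine le_trans (le_of_eq ?_) (mul_le_mul_of_nonneg_right (hP1 z hz)
          (by have := hw z; positivity))
        have he : Real.exp (-(c * ρ z)) * Real.exp (c * ρ z) = 1 := by
          rw [← Real.exp_add]; simp
        simp only [norm_mul, norm_real, Real.norm_eq_abs, RCLike.norm_conj, mul_pow, sq_abs]
        simp only [hb, wgt, mul_pow]
        linear_combination (-(c ^ 2 * deriv Real.smoothTransition (-1 - c * ρ z) ^ 2 * ‖h z‖ ^ 2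
          * q z ^ 30 * Real.exp (-Real.exp (c * ρ z)) ^ 2 * ‖X z‖ ^ 2)) * he
      · rw [hg, indicator_of_notMem hz, indicator_of_notMem hz]; simp)
  rw [integral_indicator (f := P) ho.measurableSet] at h6
  have h7 := hD.apriori hρ hρL hc hv
  have h8 : ∫ z, c ^ 2 * Real.exp (c * ρ z) * wgt q ρ c 18 z * ‖X z‖ ^ 2
      ≤ 2 * ∫ z, ‖wdiv (wgtP q ρ c 15) v z‖ ^ 2 * wgt q ρ c 18 z := by
    refine le_trans (le_of_eq ?_) h7
    congr 1
    ext z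
    ring
  rw [h1]
  calc ‖∫ z, g z‖ ^ 2 ≤ _ := h6
    _ ≤ (∫ z in D₀, P z) * (2 * ∫ z, ‖wdiv (wgtP q ρ c 15) v z‖ ^ 2 * wgt q ρ c 18 z) :=
      mul_le_mul_of_nonneg_left h8 (setIntegral_nonneg ho.measurableSet hP0)
    _ = _ := by ring

end

section

variable {D : Set (Cn n)} {q ρ : Cn n → ℝ} {h : Cn n → ℂ} {c : ℝ}

lemma tendsto_integral_shell (hD : IsOpen D) (hρ : ∀ z ∈ D, ContinuousAt ρ z)
    (hh : ContinuousOn h {z ∈ D | ρ z < 0})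
    (hi : IntegrableOn (fun z => ‖h z‖ ^ 2) {z ∈ D | ρ z < 0}) :
    Tendsto (fun c : ℝ => ∫ z in {z ∈ D | ρ z < 0},
      Real.smoothTransition (c * ρ z + 3) * ‖h z‖ ^ 2) atTop (𝓝 0) := by
  have ho := isOpen_sublevel hD hρ
  set D₀ := {z ∈ D | ρ z < 0} with hD₀
  have h0 : ∫ z in D₀, (0 : ℝ) = 0 := by simp
  rw [← h0]
  refine tendsto_integral_filter_of_dominated_convergence (fun z => ‖h z‖ ^ 2) ?_ ?_ hi ?_
  · refine Eventually.of_forall fun c => ContinuousOn.aestronglyMeasurable ?_ ho.measurableSet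
    have h1 : ContinuousOn ρ D₀ := continuousOn_of_forall_continuousAt fun z hz => hρ z hz.1
    exact (Real.smoothTransition.continuous.comp_continuousOn
      ((continuousOn_const.mul h1).add continuousOn_const)).mul (hh.norm.pow 2)
  · refine Eventually.of_forall fun c => ae_of_all _ fun z => ?_
    rw [Real.norm_of_nonneg (mul_nonneg (Real.smoothTransition.nonneg _) (by positivity))]
    exact mul_le_of_le_one_left (by positivity) (Real.smoothTransition.le_one _)
  · rw [ae_restrict_iff' ho.measurableSet]
    refine ae_of_all _ fun z hz => ?_
    refine tendsto_const_nhds.congr' ?_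
    filter_upwards [eventually_ge_atTop (3 / (-ρ z))] with c hc
    have hz0 : 0 < -ρ z := neg_pos.2 hz.2
    rw [div_le_iff₀ hz0] at hc
    rw [Real.smoothTransition.zero_of_nonpos (by linarith), zero_mul]

lemma HDomain.exists_approx (hD : HDomain D q) (hρ : ∀ z ∈ D, ContDiffAt ℝ ∞ ρ z)
    (hρL : ∀ z ∈ D, ∀ w, 0 ≤ levi ρ z w)
    (hcpt : IsCompact (closure {z ∈ D | ρ z < 0})) (hsub : closure {z ∈ D | ρ z < 0} ⊆ D)
    (hh : DifferentiableOn ℂ h {z ∈ D | ρ z < 0})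
    (hi : IntegrableOn (fun z => ‖h z‖ ^ 2) {z ∈ D | ρ z < 0}) :
    ∃ C, ∀ c, 0 < c → ∃ G, DifferentiableOn ℂ G D ∧
      ∫ z in {z ∈ D | ρ z < 0}, ‖h z - G z‖ ^ 2
        ≤ C * ∫ z in {z ∈ D | ρ z < 0}, Real.smoothTransition (c * ρ z + 3) * ‖h z‖ ^ 2 := by
  have hρc : ∀ z ∈ D, ContinuousAt ρ z := fun z hz => (hρ z hz).continuousAt
  have ho := isOpen_sublevel hD.isOpen hρc
  obtain ⟨S, hS0, hS⟩ := exists_bound_deriv_smoothTransition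
  obtain ⟨Cq, hCq⟩ := hD.bounded
  obtain ⟨N, hN⟩ := hcpt.exists_bound_of_continuousOn (f := fun z => (q z)⁻¹)
    (continuousOn_of_forall_continuousAt fun z hz =>
      (hD.smooth z (hsub hz)).continuousAt.inv₀ (hD.pos z (hsub hz)).ne')
  set D₀ := {z ∈ D | ρ z < 0} with hD₀
  set M : ℝ := S ^ 2 * Real.exp 2 * Cq ^ 12 with hM
  have hM0 : 0 ≤ M := by
    have : 0 ≤ Cq ^ 12 := Even.pow_nonneg (by decide) _
    positivity
  set A : ℝ := N ^ 12 * Real.exp 1 with hA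
  have hA0 : 0 ≤ A := mul_nonneg (Even.pow_nonneg (by decide) _) (Real.exp_pos _).le
  refine ⟨2 + 4 * A * M, fun c hc => ?_⟩
  set Φ : Cn n → ℝ := fun z => Real.smoothTransition (c * ρ z + 3) * ‖h z‖ ^ 2 with hΦ
  have hΦi : IntegrableOn Φ D₀ := by
    refine Integrable.mono' hi ?_ (ae_of_all _ fun z => ?_)
    · refine ContinuousOn.aestronglyMeasurable ?_ ho.measurableSet
      have h1 : ContinuousOn ρ D₀ := continuousOn_of_forall_continuousAt fun z hz => hρc z hz.1
      exact (Real.smoothTransition.continuous.comp_continuousOn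
        ((continuousOn_const.mul h1).add continuousOn_const)).mul (hh.continuousOn.norm.pow 2)
    · rw [Real.norm_of_nonneg (mul_nonneg (Real.smoothTransition.nonneg _) (by positivity))]
      exact mul_le_of_le_one_left (by positivity) (Real.smoothTransition.le_one _)
  have hΦ0 : ∀ z, 0 ≤ Φ z := fun z => mul_nonneg (Real.smoothTransition.nonneg _) (by positivity)
  have hΦ1 : ∀ z, -2 ≤ c * ρ z → Φ z = ‖h z‖ ^ 2 := fun z hz => by
    rw [hΦ]
    simp only
    rw [Real.smoothTransition.one_of_one_le (by linarith), one_mul]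
  have hP1 : ∀ z ∈ D₀, deriv Real.smoothTransition (-1 - c * ρ z) ^ 2
      * Real.exp (-(c * ρ z)) * wgt q ρ c 12 z * ‖h z‖ ^ 2 ≤ M * Φ z := by
    intro z hz
    by_cases hsh : -1 - c * ρ z ∈ Icc (0 : ℝ) 1
    swap
    · rw [deriv_smoothTransition_eq_zero hsh]
      simpa using mul_nonneg hM0 (hΦ0 z)
    rw [hΦ1 z (by linarith [hsh.2]), hM]
    have h1 : deriv Real.smoothTransition (-1 - c * ρ z) ^ 2 ≤ S ^ 2 := by
      rw [← sq_abs]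
      gcongr
      exact hS _
    have h2 : Real.exp (-(c * ρ z)) ≤ Real.exp 2 := Real.exp_le_exp.2 (by linarith [hsh.2])
    have hq0 := (hD.pos z hz.1).le
    have h3 : wgt q ρ c 12 z ≤ Cq ^ 12 := by
      rw [wgt]
      have h4 : Real.exp (-Real.exp (c * ρ z)) ≤ 1 :=
        Real.exp_le_one_iff.2 (neg_nonpos.2 (Real.exp_pos _).le)
      calc q z ^ 12 * Real.exp (-Real.exp (c * ρ z)) ≤ q z ^ 12 * 1 := by gcongr
        _ ≤ Cq ^ 12 := by rw [mul_one]; gcongr; exact hCq z hz.1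
    have h5 : 0 ≤ wgt q ρ c 12 z := (wgt_pos (hD.pos z hz.1) ρ c 12).le
    gcongr
  have hα : TestFun D₀ (cutoff D ρ c h) := testFun_cutoff hD.isOpen hρ hcpt hsub hh hc
  obtain ⟨G, hG, hGi, hGB⟩ := hD.exists_holomorphic (c := c) hρ (hα.mono fun z hz => hz.1)
    (B := 2 * ∫ z in D₀, M * Φ z)
    (mul_nonneg zero_le_two (integral_nonneg fun z => mul_nonneg hM0 (hΦ0 z)))
    fun v hv => hD.pairing_le hρ hρL hcpt hsub hh hc (hΦi.const_mul M) hP1 hv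
  refine ⟨G, hG, ?_⟩
  have hGi' := hGi.mono_set (fun z hz => hz.1 : D₀ ⊆ D)
  have hpt : ∀ z ∈ D₀, ‖h z - G z‖ ^ 2
      ≤ 2 * Φ z + 2 * A * (wgt q ρ c 12 z * ‖cutoff D ρ c h z - G z‖ ^ 2) := by
    intro z hz
    have hq := hD.pos z hz.1
    have h1 : 1 ≤ A * wgt q ρ c 12 z := by
      have h2 := hN z (subset_closure hz)
      rw [norm_inv, Real.norm_of_nonneg hq.le, inv_le_iff_one_le_mul₀ hq] at h2
      have h3 : 1 ≤ (N * q z) ^ 12 := one_le_pow₀ h2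
      have h4 : 1 ≤ Real.exp 1 * Real.exp (-Real.exp (c * ρ z)) := by
        rw [← Real.exp_add, Real.one_le_exp_iff]
        have : Real.exp (c * ρ z) ≤ 1 :=
          Real.exp_le_one_iff.2 (mul_nonpos_of_nonneg_of_nonpos hc.le hz.2.le)
        linarith
      calc (1 : ℝ) ≤ (N * q z) ^ 12 * (Real.exp 1 * Real.exp (-Real.exp (c * ρ z))) :=
            one_le_mul_of_one_le_of_one_le h3 h4
        _ = A * wgt q ρ c 12 z := by rw [hA, wgt]; ring
    have h2 : ‖h z - cutoff D ρ c h z‖ ^ 2 ≤ Φ z := by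
      have h3 : cutoff D ρ c h z = Real.smoothTransition (-1 - c * ρ z) * h z :=
        indicator_of_mem (s := {z ∈ D | ρ z < 0}) hz _
      by_cases h4 : -2 ≤ c * ρ z
      · rw [hΦ1 z h4, h3]
        have h5 : h z - Real.smoothTransition (-1 - c * ρ z) * h z
            = ((1 - Real.smoothTransition (-1 - c * ρ z) : ℝ) : ℂ) * h z := by push_cast; ring
        rw [h5, norm_mul, norm_real, Real.norm_of_nonneg
          (sub_nonneg.2 (Real.smoothTransition.le_one _))]
        exact pow_le_pow_left₀
          (mul_nonneg (sub_nonneg.2 (Real.smoothTransition.le_one _)) (norm_nonneg (h z)))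
          (mul_le_of_le_one_left (norm_nonneg (h z))
            (by linarith [Real.smoothTransition.nonneg (-1 - c * ρ z)])) 2
      · rw [h3, Real.smoothTransition.one_of_one_le (by linarith)]
        simpa using hΦ0 z
    have h6 : ‖h z - G z‖ ^ 2 ≤ 2 * ‖h z - cutoff D ρ c h z‖ ^ 2
        + 2 * ‖cutoff D ρ c h z - G z‖ ^ 2 := by
      have h7 := norm_sub_le_norm_sub_add_norm_sub (h z) (cutoff D ρ c h z) (G z)
      have h8 := pow_le_pow_left₀ (norm_nonneg _) h7 2
      nlinarith [sq_nonneg (‖h z - cutoff D ρ c h z‖ - ‖cutoff D ρ c h z - G z‖)]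
    have h9 : ‖cutoff D ρ c h z - G z‖ ^ 2
        ≤ A * wgt q ρ c 12 z * ‖cutoff D ρ c h z - G z‖ ^ 2 :=
      le_mul_of_one_le_left (by positivity) h1
    linarith
  have h1 : ∫ z in D₀, wgt q ρ c 12 z * ‖cutoff D ρ c h z - G z‖ ^ 2
      ≤ ∫ z in D, wgt q ρ c 12 z * ‖cutoff D ρ c h z - G z‖ ^ 2 := by
    refine setIntegral_mono_set hGi ?_ (Eventually.of_forall fun z hz => hz.1)
    filter_upwards [ae_restrict_mem hD.isOpen.measurableSet] with z hz
    have := wgt_pos (hD.pos z hz) ρ c 12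
    simp only [Pi.zero_apply]
    positivity
  have h2 := h1.trans hGB
  rw [integral_const_mul] at h2
  have hi1 : IntegrableOn (fun z => 2 * Φ z) D₀ := hΦi.const_mul 2
  have hi2 : IntegrableOn (fun z => 2 * A * (wgt q ρ c 12 z * ‖cutoff D ρ c h z - G z‖ ^ 2)) D₀ :=
    hGi'.const_mul (2 * A)
  have h3 : ∫ z in D₀, ‖h z - G z‖ ^ 2 ≤ ∫ z in D₀, (2 * Φ z
      + 2 * A * (wgt q ρ c 12 z * ‖cutoff D ρ c h z - G z‖ ^ 2)) := by
    refine integral_mono_of_nonneg (ae_of_all _ fun z => by positivity) (hi1.add hi2) ?_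
    filter_upwards [ae_restrict_mem ho.measurableSet] with z hz using hpt z hz
  rw [integral_add hi1 hi2, integral_const_mul, integral_const_mul] at h3
  have h4 := mul_le_mul_of_nonneg_left h2 (mul_nonneg zero_le_two hA0)
  calc _ ≤ _ := h3
    _ ≤ _ := add_le_add le_rfl h4
    _ = _ := by ring

/-- Holomorphic functions on `D` are dense in the square integrable holomorphic functions on the
relatively compact sublevel set `{ρ < 0}`. -/
lemma HDomain.dense (hD : HDomain D q) (hρ : ∀ z ∈ D, ContDiffAt ℝ ∞ ρ z)
    (hρL : ∀ z ∈ D, ∀ w, 0 ≤ levi ρ z w)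
    (hcpt : IsCompact (closure {z ∈ D | ρ z < 0})) (hsub : closure {z ∈ D | ρ z < 0} ⊆ D)
    (hh : DifferentiableOn ℂ h {z ∈ D | ρ z < 0})
    (hi : IntegrableOn (fun z => ‖h z‖ ^ 2) {z ∈ D | ρ z < 0}) {ε : ℝ} (hε : 0 < ε) :
    ∃ G, DifferentiableOn ℂ G D ∧ ∫ z in {z ∈ D | ρ z < 0}, ‖h z - G z‖ ^ 2 < ε := by
  obtain ⟨C, hC⟩ := hD.exists_approx hρ hρL hcpt hsub hh hi
  have h1 := (tendsto_integral_shell hD.isOpen (fun z hz => (hρ z hz).continuousAt)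
    hh.continuousOn hi).const_mul C
  rw [mul_zero] at h1
  obtain ⟨c, hc, hc0⟩ := ((h1.eventually_lt_const hε).and (eventually_gt_atTop 0)).exists
  obtain ⟨G, hG, hGC⟩ := hC c hc0
  exact ⟨G, hG, hGC.trans_lt hc⟩

end

section

variable {K W Ω : Set (Cn n)} {r : Cn n → ℝ} {t : ℝ}

lemma levi_add_const {z : Cn n} (hr : ContDiffAt ℝ ∞ r z) (a : ℝ) (w : Fin n → ℂ) :
    levi (fun x => r x + a) z w = levi r z w := by
  have h1 : fderiv ℝ (fun x => r x + a) = fderiv ℝ r := funext fun x => fderiv_add_const a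
  rw [levi_eq hr, levi_eq (hr.add contDiffAt_const), h1]

lemma levi_const_sub {z : Cn n} (hr : ContDiffAt ℝ ∞ r z) (a : ℝ) (w : Fin n → ℂ) :
    levi (fun x => a - r x) z w = -levi r z w := by
  have h1 : fderiv ℝ (fun x => a - r x) = fun x => -fderiv ℝ r x :=
    funext fun x => fderiv_const_sub a
  rw [levi_eq hr, levi_eq (contDiffAt_const.sub hr), h1, fderiv_fun_neg]
  simp only [neg_apply]
  ring

lemma hDomain_sublevel (hW : IsOpen W) (hr : ContDiffOn ℝ ∞ r W) (hp : PshOn r W)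
    (hK : IsCompact K) (hKW : K ⊆ W) (ho : IsOpen {z ∈ K | r z < t}) :
    HDomain {z ∈ K | r z < t} fun z => t - r z := by
  have hr' : ∀ z ∈ W, ContDiffAt ℝ ∞ r z := fun z hz => hr.contDiffAt (hW.mem_nhds hz)
  have hc : ContinuousOn (fun z => t - r z) K := continuousOn_const.sub (hr.continuousOn.mono hKW)
  have hfd : ContinuousOn (fderiv ℝ fun z => t - r z) K :=
    continuousOn_of_forall_continuousAt fun z hz =>
      ((contDiffAt_const.sub (hr' z (hKW hz))).fderiv_right (m := 0) (by simp)).continuousAt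
  refine ⟨ho, fun z hz => contDiffAt_const.sub (hr' z (hKW hz.1)), fun z hz => sub_pos.2 hz.2,
    fun z hz w => ?_, ?_, ?_, fun ε hε => ?_⟩
  · have hz' := hr' z (hKW hz.1)
    rw [levi_const_sub hz', neg_nonpos]
    exact hp.levi_nonneg hW (hKW hz.1) hz' w
  · obtain ⟨C, hC⟩ := hK.exists_bound_of_continuousOn hc
    exact ⟨C, fun z hz => (le_abs_self _).trans (hC z hz.1)⟩
  · obtain ⟨C, hC⟩ := hK.exists_bound_of_continuousOn hfd
    exact ⟨C, fun z hz => hC z hz.1⟩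
  · have h1 : {z | z ∈ {z ∈ K | r z < t} ∧ ε ≤ t - r z} = K ∩ (fun z => t - r z) ⁻¹' Ici ε := by
      ext z
      refine ⟨fun hz => ⟨hz.1.1, hz.2⟩, fun hz => ⟨⟨hz.1, ?_⟩, hz.2⟩⟩
      have : ε ≤ t - r z := hz.2
      linarith
    rw [h1]
    exact hK.of_isClosed_subset (hc.preimage_isClosed_of_isClosed hK.isClosed isClosed_Ici)
      inter_subset_left

lemma mem_closure_sublevel (hW : IsOpen W) {z : Cn n} (hz : z ∈ W) (hr : r z ≤ 0)
    (hd : fderiv ℝ r z ≠ 0) : z ∈ closure {z ∈ W | r z < 0} := by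
  rcases hr.lt_or_eq with h | h
  · exact subset_closure ⟨hz, h⟩
  by_contra hcl
  refine hd (IsLocalMin.fderiv_eq_zero ?_)
  filter_upwards [hW.mem_nhds hz, isClosed_closure.isOpen_compl.mem_nhds hcl] with y hy hyc
  rw [h]
  by_contra! hlt
  exact hyc (subset_closure ⟨hy, hlt⟩)

lemma exists_sublevel_nhds_closure (hW : IsOpen W) (hcl : closure Ω ⊆ W)
    (hb : Bornology.IsBounded Ω) (hr : ContDiffOn ℝ ∞ r W) (hΩ : IsOpen Ω)
    (hΩW : Ω = {z ∈ W | r z < 0}) (hd : ∀ z ∈ frontier Ω, fderiv ℝ r z ≠ 0) :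
    ∃ K, IsCompact K ∧ K ⊆ W ∧ ∃ t, 0 < t ∧ IsOpen {z ∈ K | r z < t} ∧
      closure Ω ⊆ {z ∈ K | r z < t} ∧ ∀ z ∈ K, r z < 0 → z ∈ Ω := by
  have hfd : ContinuousOn (fderiv ℝ r) W := continuousOn_of_forall_continuousAt fun z hz =>
    ((hr.contDiffAt (hW.mem_nhds hz)).fderiv_right (m := 0) (by simp)).continuousAt
  have hV : IsOpen (W ∩ fderiv ℝ r ⁻¹' {0}ᶜ) :=
    hfd.isOpen_inter_preimage hW isOpen_compl_singleton
  have hcpt : IsCompact (closure Ω) := hb.isCompact_closure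
  have hle : ∀ z ∈ closure Ω, r z ≤ 0 := by
    intro z hz
    have h1 := (hr.continuousOn.continuousAt (hW.mem_nhds (hcl hz))).continuousWithinAt (s := Ω)
    have := mem_closure_iff_nhdsWithin_neBot.1 hz
    refine le_of_tendsto h1.tendsto ?_
    filter_upwards [self_mem_nhdsWithin] with y hy
    rw [hΩW] at hy
    exact hy.2.le
  obtain ⟨τ, hτ, hτO⟩ := hcpt.exists_cthickening_subset_open (hΩ.union hV) (by
    intro z hz
    by_cases h : z ∈ Ω
    · exact Or.inl h
    · exact Or.inr ⟨hcl hz, hd z ⟨hz, by rwa [hΩ.interior_eq]⟩⟩)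
  set K := cthickening τ (closure Ω) with hK
  have hKc : IsCompact K :=
    isCompact_of_isClosed_isBounded isClosed_cthickening hcpt.isBounded.cthickening
  have hKW : K ⊆ W := hτO.trans (union_subset (subset_closure.trans hcl) inter_subset_left)
  have hpos : ∀ z ∈ K, z ∉ closure Ω → 0 < r z := by
    intro z hz hzc
    by_contra! h
    rcases hτO hz with h1 | h1
    · exact hzc (subset_closure h1)
    · exact hzc (hΩW ▸ mem_closure_sublevel hW h1.1 h h1.2)
  have hS : IsCompact (K \ thickening τ (closure Ω)) := hKc.diff isOpen_thickening
  obtain ⟨t, ht, htS⟩ := hS.exists_forall_le' (hr.continuousOn.mono (sdiff_subset.trans hKW))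
    (a := 0) fun z hz => hpos z hz.1 fun h => hz.2 (self_subset_thickening hτ _ h)
  have heq : {z ∈ K | r z < t} = thickening τ (closure Ω) ∩ r ⁻¹' Iio t := by
    ext z
    refine ⟨fun hz => ⟨?_, hz.2⟩, fun hz => ⟨thickening_subset_cthickening _ _ hz.1, hz.2⟩⟩
    by_contra h
    exact absurd (htS z ⟨hz.1, h⟩) (not_le.2 hz.2)
  refine ⟨K, hKc, hKW, t, ht, ?_, fun z hz => ⟨self_subset_cthickening _ hz, (hle z hz).trans_lt ht⟩,
    fun z hz h => ?_⟩
  · rw [heq]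
    exact (hr.continuousOn.mono ((thickening_subset_cthickening _ _).trans hKW)).isOpen_inter_preimage
      isOpen_thickening isOpen_Iio
  · rw [hΩW]
    exact ⟨hKW hz, h⟩

lemma integrableOn_norm_sq (hK : IsCompact K) {g : Cn n → ℂ} (hg : ContinuousOn g K) :
    IntegrableOn (fun z => ‖g z‖ ^ 2) K :=
  (hg.norm.pow 2).integrableOn_compact hK

end

lemma setIntegral_norm_sub_sq_le {S : Set (Cn n)} (hS : IsOpen S) {f g k : Cn n → ℂ}
    (hf : ContinuousOn f S) (hg : ContinuousOn g S) (hk : ContinuousOn k S)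
    (hfi : IntegrableOn (fun z => ‖f z‖ ^ 2) S) (hgi : IntegrableOn (fun z => ‖g z‖ ^ 2) S)
    (hki : IntegrableOn (fun z => ‖k z‖ ^ 2) S) :
    ∫ z in S, ‖f z - k z‖ ^ 2 ≤
      2 * (∫ z in S, ‖f z - g z‖ ^ 2) + 2 * ∫ z in S, ‖g z - k z‖ ^ 2 := by
  have key : ∀ a b : ℂ, ‖a - b‖ ^ 2 ≤ 2 * ‖a‖ ^ 2 + 2 * ‖b‖ ^ 2 := fun a b => by
    have h1 := norm_sub_le a b
    nlinarith [norm_nonneg (a - b), norm_nonneg a, norm_nonneg b, sq_nonneg (‖a‖ - ‖b‖)]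
  have hInt : ∀ {p q : Cn n → ℂ}, ContinuousOn p S → ContinuousOn q S →
      IntegrableOn (fun z => ‖p z‖ ^ 2) S → IntegrableOn (fun z => ‖q z‖ ^ 2) S →
      IntegrableOn (fun z => ‖p z - q z‖ ^ 2) S := by
    intro p q hp hq hpi hqi
    refine ((hpi.const_mul 2).add (hqi.const_mul 2)).mono'
      (((hp.sub hq).norm.pow 2).aestronglyMeasurable hS.measurableSet) ?_
    filter_upwards with z
    rw [Real.norm_of_nonneg (by positivity)]
    exact key _ _
  have h1 := hInt hf hg hfi hgi
  have h2 := hInt hg hk hgi hki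
  rw [← integral_const_mul, ← integral_const_mul,
    ← integral_add (h1.const_mul 2) (h2.const_mul 2)]
  refine integral_mono (hInt hf hk hfi hki) ((h1.const_mul 2).add (h2.const_mul 2)) fun z => ?_
  have h3 := key (f z - g z) (k z - g z)
  rw [sub_sub_sub_cancel_right, norm_sub_rev (k z)] at h3
  exact h3

lemma SmoothlyBoundedPseudoconvex.hDomain {Ω : Set (Cn n)}
    (hΩ : SmoothlyBoundedPseudoconvex n Ω) : ∃ q, HDomain Ω q := by
  obtain ⟨ho, hb, r, W, hW, hcl, hr, hp, hΩW, -⟩ := hΩ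
  have h1 : Ω = {z ∈ closure Ω | r z < 0} := by
    ext z
    refine ⟨fun hz => ⟨subset_closure hz, (hΩW ▸ hz : z ∈ {z ∈ W | r z < 0}).2⟩, fun hz => ?_⟩
    rw [hΩW]
    exact ⟨hcl hz.1, hz.2⟩
  refine ⟨fun z => 0 - r z, ?_⟩
  rw [h1] at ho
  have := hDomain_sublevel hW hr hp hb.isCompact_closure hcl ho
  rwa [← h1] at this

/-- Holomorphic functions on a smoothly bounded pseudoconvex domain are approximated, in `L²` of
any compactly included subset, by functions continuous up to the boundary. -/
lemma SmoothlyBoundedPseudoconvex.exists_continuousOn_closure {Ω Ω' : Set (Cn n)}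
    (hΩ : SmoothlyBoundedPseudoconvex n Ω) (hΩ' : IsCompact (closure Ω'))
    (hsub : closure Ω' ⊆ Ω) {h : Cn n → ℂ} (hh : DifferentiableOn ℂ h Ω) {ε : ℝ} (hε : 0 < ε) :
    ∃ g, DifferentiableOn ℂ g Ω ∧ ContinuousOn g (closure Ω) ∧
      ∫ z in Ω', ‖h z - g z‖ ^ 2 < ε := by
  obtain ⟨ho, hb, r, W, hW, hcl, hr, hp, hΩW, hd⟩ := hΩ
  obtain ⟨K, hK, hKW, t, ht, htO, htcl, hKneg⟩ := exists_sublevel_nhds_closure hW hcl hb hr ho hΩW hd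
  have hr' : ∀ z ∈ W, ContDiffAt ℝ ∞ r z := fun z hz => hr.contDiffAt (hW.mem_nhds hz)
  have hΩr : ∀ z ∈ Ω, r z < 0 := fun z hz => (hΩW ▸ hz : z ∈ {z ∈ W | r z < 0}).2
  have hΩD : Ω ⊆ {z ∈ K | r z < t} := subset_closure.trans htcl
  obtain ⟨a, ha, haS⟩ := hΩ'.exists_forall_le' (f := fun z => -r z) (a := 0)
    ((hr.continuousOn.mono (hsub.trans (subset_closure.trans hcl))).neg)
    fun z hz => neg_pos.2 (hΩr z (hsub hz))
  have hD := hDomain_sublevel hW hr hp hK hKW htO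
  set D := {z ∈ K | r z < t} with hDdef
  have hDW : D ⊆ W := fun z hz => hKW hz.1
  set L := K ∩ r ⁻¹' Iic (-(a / 2)) with hL
  have hLc : IsCompact L := hK.of_isClosed_subset
    ((hr.continuousOn.mono hKW).preimage_isClosed_of_isClosed hK.isClosed isClosed_Iic)
    inter_subset_left
  have hLr : ∀ z ∈ L, r z ≤ -(a / 2) := fun z hz => hz.2
  have hLΩ : L ⊆ Ω := fun z hz => hKneg z hz.1 (by linarith [hLr z hz])
  have hDL : {z ∈ D | r z + a / 2 < 0} ⊆ L := fun z hz => ⟨hz.1.1, by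
    have := hz.2
    simp only [mem_preimage, mem_Iic]
    linarith⟩
  have hDcl : closure {z ∈ D | r z + a / 2 < 0} ⊆ L := closure_minimal hDL hLc.isClosed
  obtain ⟨g, hg, hgi⟩ := hD.dense (ρ := fun z => r z + a / 2) (h := h)
    (fun z hz => (hr' z (hDW hz)).add contDiffAt_const)
    (fun z hz w => by
      rw [levi_add_const (hr' z (hDW hz))]
      exact hp.levi_nonneg hW (hDW hz) (hr' z (hDW hz)) w)
    (hLc.of_isClosed_subset isClosed_closure hDcl) (hDcl.trans (hLΩ.trans hΩD))
    (hh.mono (hDL.trans hLΩ))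
    ((integrableOn_norm_sq hLc (hh.continuousOn.mono hLΩ)).mono_set hDL) hε
  have hgc : ContinuousOn g D := hg.continuousOn
  refine ⟨g, hg.mono hΩD, hgc.mono htcl, lt_of_le_of_lt ?_ hgi⟩
  refine setIntegral_mono_set ((integrableOn_norm_sq hLc (g := fun z => h z - g z)
    ((hh.continuousOn.mono hLΩ).sub (hgc.mono (hLΩ.trans hΩD)))).mono_set hDL)
    (Eventually.of_forall fun z => by positivity) (Eventually.of_forall fun z hz => ?_)
  have hz' := subset_closure hz
  refine ⟨hΩD (hsub hz'), ?_⟩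
  have := haS z hz'
  linarith

end

/-- **Lemma 4.4.**  Let `Ω₀ ⋐ Ω₁` be smoothly bounded pseudoconvex domains in `ℂⁿ` and assume
there is a smooth plurisubharmonic function `ρ` on `Ω̄₁` such that `Ω₀ = {z ∈ Ω₁ : ρ(z) < 0}`.
Then holomorphic functions in `L²(Ω₁)` are dense in the holomorphic functions in `L²(Ω₀)`. -/
theorem density_of_global_holomorphic (n : ℕ) (Ω₀ Ω₁ : Set (Cn n))
    (hΩ₀ : SmoothlyBoundedPseudoconvex n Ω₀) (hΩ₀conn : IsConnected Ω₀)
    (hΩ₁ : SmoothlyBoundedPseudoconvex n Ω₁) (hΩ₁conn : IsConnected Ω₁)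
    (hcpt : closure Ω₀ ⊆ Ω₁)
    (ρ : Cn n → ℝ) (hρ : ContDiffOn ℝ (⊤ : ℕ∞) ρ (closure Ω₁)) (hρpsh : PshOn ρ (closure Ω₁))
    (hΩ₀eq : Ω₀ = {z ∈ Ω₁ | ρ z < 0}) :
    ∀ h : Cn n → ℂ, DifferentiableOn ℂ h Ω₀ →
      IntegrableOn (fun z => ‖h z‖ ^ 2) Ω₀ volume →
      ∀ ε : ℝ, 0 < ε → ∃ g : Cn n → ℂ, DifferentiableOn ℂ g Ω₁ ∧
        IntegrableOn (fun z => ‖g z‖ ^ 2) Ω₁ volume ∧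
        (∫ z in Ω₀, ‖h z - g z‖ ^ 2) < ε := by
  intro h hh hi ε hε
  obtain ⟨q, hD⟩ := hΩ₁.hDomain
  have hcl : IsCompact (closure Ω₀) := hΩ₀.2.1.isCompact_closure
  have hρ' : ∀ z ∈ Ω₁, ContDiffAt ℝ (⊤ : ℕ∞) ρ z := fun z hz =>
    hρ.contDiffAt (mem_of_superset (hΩ₁.1.mem_nhds hz) subset_closure)
  have happ : ∃ G, DifferentiableOn ℂ G Ω₁ ∧ ∫ z in Ω₀, ‖h z - G z‖ ^ 2 < ε / 4 := by
    rw [hΩ₀eq] at hcl hcpt hh hi ⊢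
    exact hD.dense hρ' (fun z hz w => (hρpsh.mono subset_closure).levi_nonneg hΩ₁.1 hz (hρ' z hz) w)
      hcl hcpt hh hi (by positivity)
  obtain ⟨G, hG, hGi⟩ := happ
  obtain ⟨g, hg, hgc, hgi⟩ := hΩ₁.exists_continuousOn_closure hcl hcpt hG (ε := ε / 4) (by positivity)
  have hgI : IntegrableOn (fun z => ‖g z‖ ^ 2) Ω₁ :=
    (integrableOn_norm_sq hΩ₁.2.1.isCompact_closure hgc).mono_set subset_closure
  have hsub : Ω₀ ⊆ Ω₁ := subset_closure.trans hcpt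
  refine ⟨g, hg, hgI, ?_⟩
  have h1 := setIntegral_norm_sub_sq_le hΩ₀.1 hh.continuousOn (hG.continuousOn.mono hsub)
    (hg.continuousOn.mono hsub) hi
    ((integrableOn_norm_sq hcl (hG.continuousOn.mono hcpt)).mono_set subset_closure)
    (hgI.mono_set hsub)
  linarith

end Berndtsson
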